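/- Let n ≥ 2 and p ≥ 1, and let conjugacy classes c_1,…,c_{p+1} ⊂ gl(n,ℂ) be given, where c_1 has n distinct eigenvalues and Σ_{j=1}^{p+1} Σ_{k=1}^{n} λ_{k,j} = 0. Suppose conditions (α_n) and (β_n) hold but there exists NO irreducible tuple (A_1,…,A_{p+1}) with A_j ∈ c_j and A_1 + ⋯ + A_{p+1} = 0. Then r_2 + ⋯ + r_{p+1} = n, and moreover either the index of rigidity κ := 2n² − (d_1 + ⋯ + d_{p+1}) equals 2, or the eigenvalues satisfy a 1-relation, i.e. there exist indices k_1,…,k_{p+1} ∈ {1,…,n} with λ_{k_1,1} + ⋯ + λ_{k_{p+1},p+1} = 0. -/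

import Mathlib

open Polynomial BigOperators

noncomputable def rk {n : ℕ} (Y : Matrix (Fin n) (Fin n) ℂ) : ℕ :=
  ⨅ μ : ℂ, (Y - μ • (1 : Matrix (Fin n) (Fin n) ℂ)).rank

/-- The submodule of matrices commuting with `Y`. -/
noncomputable def centSub {n : ℕ} (Y : Matrix (Fin n) (Fin n) ℂ) : Submodule ℂ (Matrix (Fin n) (Fin n) ℂ) where
  carrier := {Z | Y * Z = Z * Y}
  add_mem' := by
    intro a b ha hb
    simp only [Set.mem_setOf_eq] at *
    rw [Matrix.mul_add, Matrix.add_mul, ha, hb]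
  zero_mem' := by simp
  smul_mem' := by
    intro c a ha
    simp only [Set.mem_setOf_eq] at *
    rw [Matrix.mul_smul, Matrix.smul_mul, ha]

/-- `d(Y) = n² - dim of centralizer of Y`, the dimension of the conjugacy class. -/
noncomputable def dd {n : ℕ} (Y : Matrix (Fin n) (Fin n) ℂ) : ℕ :=
  n ^ 2 - Module.finrank ℂ (centSub Y)

def SameClass {n : ℕ} (A B : Matrix (Fin n) (Fin n) ℂ) : Prop :=
  ∃ S : Matrix (Fin n) (Fin n) ℂ, IsUnit S ∧ A = S * B * S⁻¹

def IrreducibleTuple {n q : ℕ} (A : Fin q → Matrix (Fin n) (Fin n) ℂ) : Prop :=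
  ∀ W : Submodule ℂ (Fin n → ℂ), (∀ j, ∀ v ∈ W, (A j).mulVec v ∈ W) → W = ⊥ ∨ W = ⊤

def TrivialCentralizer {n q : ℕ} (A : Fin q → Matrix (Fin n) (Fin n) ℂ) : Prop :=
  ∀ Z : Matrix (Fin n) (Fin n) ℂ, (∀ j, Z * A j = A j * Z) →
    ∃ c : ℂ, Z = c • (1 : Matrix (Fin n) (Fin n) ℂ)

def HasDistinctEigenvalues {n : ℕ} (Y : Matrix (Fin n) (Fin n) ℂ) : Prop :=
  ∃ μ : Fin n → ℂ, Function.Injective μ ∧ Y.charpoly = ∏ k, (Polynomial.X - Polynomial.C (μ k))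

def IsDiagble {n : ℕ} (Y : Matrix (Fin n) (Fin n) ℂ) : Prop :=
  ∃ S : Matrix (Fin n) (Fin n) ℂ, IsUnit S ∧ ∃ d : Fin n → ℂ, Y = S * Matrix.diagonal d * S⁻¹

noncomputable def multOf {n : ℕ} (Y : Matrix (Fin n) (Fin n) ℂ) (μ : ℂ) : ℕ :=
  Module.finrank ℂ (LinearMap.ker (Y - μ • (1 : Matrix (Fin n) (Fin n) ℂ)).mulVecLin)

/-- The Sylvester map `X ↦ P X - X R`. -/
noncomputable def sylv {l m : ℕ} (P : Matrix (Fin l) (Fin l) ℂ) (R : Matrix (Fin m) (Fin m) ℂ) :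
    Matrix (Fin l) (Fin m) ℂ →ₗ[ℂ] Matrix (Fin l) (Fin m) ℂ where
  toFun Z := P * Z - Z * R
  map_add' Z W := by
    show P * (Z + W) - (Z + W) * R = (P * Z - Z * R) + (P * W - W * R)
    rw [Matrix.mul_add, Matrix.add_mul]; abel
  map_smul' c Z := by
    show P * (c • Z) - (c • Z) * R = c • (P * Z - Z * R)
    rw [Matrix.mul_smul, Matrix.smul_mul, smul_sub]

noncomputable def sDim {l m : ℕ} (P : Matrix (Fin l) (Fin l) ℂ) (R : Matrix (Fin m) (Fin m) ℂ) : ℕ :=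
  Module.finrank ℂ (LinearMap.range (sylv P R))

namespace KP
set_option linter.unusedSectionVars false
open Module

section chains
variable {V : Type*} [AddCommGroup V] [Module ℂ V] [FiniteDimensional ℂ V]

/-- Rank of `f - c`. -/
noncomputable def rg (f : End ℂ V) (c : ℂ) : ℕ := finrank ℂ (LinearMap.range (f - c • (1 : End ℂ V)))

/-- Span of partial Krylov chains. -/
noncomputable def sp (f : End ℂ V) {k : ℕ} (m : Fin k → ℕ) (v : Fin k → V) : Submodule ℂ V :=
  Submodule.span ℂ {y | ∃ a i, i < m a ∧ (f ^ i) (v a) = y}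

lemma mem_sp (f : End ℂ V) {k : ℕ} (m : Fin k → ℕ) (v : Fin k → V) (a : Fin k) (i : ℕ) (h : i < m a) :
    (f ^ i) (v a) ∈ sp f m v := Submodule.subset_span ⟨a, i, h, rfl⟩

lemma sp_le (f : End ℂ V) {k : ℕ} (m : Fin k → ℕ) (v : Fin k → V) (U : Submodule ℂ V)
    (h : ∀ a i, i < m a → (f ^ i) (v a) ∈ U) : sp f m v ≤ U := by
  apply Submodule.span_le.2
  rintro y ⟨a, i, hi, rfl⟩
  exact h a i hi

lemma gen_zero (f : End ℂ V) (U : Submodule ℂ V) (hU : ∀ x ∈ U, f x ∈ U)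
    (h : ∀ c : ℂ, U ⊔ LinearMap.range (f - c • (1 : End ℂ V)) = ⊤) : U = ⊤ := by
  by_contra hne
  have hnt : Nontrivial (V ⧸ U) := Submodule.Quotient.nontrivial_iff.2 hne
  let g : End ℂ (V ⧸ U) := U.mapQ U f (fun x hx => hU x hx)
  obtain ⟨c, hc⟩ := Module.End.exists_eigenvalue g
  have hninj : ¬ Function.Injective (g - c • (1 : End ℂ (V ⧸ U))) := by
    obtain ⟨v, hv⟩ := hc.exists_hasEigenvector
    intro hi
    apply hv.2
    apply hi
    simp [hv.apply_eq_smul]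
  apply hninj
  rw [LinearMap.injective_iff_surjective]
  intro y
  obtain ⟨x, rfl⟩ := Submodule.mkQ_surjective U y
  have hx : x ∈ U ⊔ LinearMap.range (f - c • (1 : End ℂ V)) := by rw [h c]; trivial
  obtain ⟨u, hu, z, ⟨w, rfl⟩, rfl⟩ := Submodule.mem_sup.1 hx
  refine ⟨U.mkQ w, ?_⟩
  have : U.mkQ u = 0 := by simpa using hu
  rw [map_add, this, zero_add]
  simp [g]

lemma range_eq_top_of_not_eig (f : End ℂ V) (c : ℂ) (hc : ¬ f.HasEigenvalue c) :
    LinearMap.range (f - c • (1 : End ℂ V)) = ⊤ := by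
  rw [LinearMap.range_eq_top, ← LinearMap.injective_iff_surjective, ← LinearMap.ker_eq_bot]
  by_contra h
  apply hc
  rw [Module.End.hasEigenvalue_iff, Module.End.eigenspace_def]
  exact h

lemma gen (f : End ℂ V) (k : ℕ) : ∀ (W : Submodule ℂ V), (∀ x ∈ W, f x ∈ W) →
    (∀ c : ℂ, finrank ℂ V ≤ finrank ℂ ↥(W ⊔ LinearMap.range (f - c • (1 : End ℂ V))) + k) →
    ∃ v : Fin k → V, ∀ U : Submodule ℂ V, (∀ x ∈ U, f x ∈ U) → W ≤ U → (∀ a, v a ∈ U) → U = ⊤ := by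
  induction k with
  | zero =>
    intro W hW h
    refine ⟨Fin.elim0, fun U hU hWU _ => gen_zero f U hU fun c => ?_⟩
    have := Submodule.eq_top_of_finrank_eq (le_antisymm (Submodule.finrank_le _) (h c))
    rw [eq_top_iff, ← this]
    exact sup_le_sup_right hWU _
  | succ k ih =>
    intro W hW h
    have hfin : {c : ℂ | f.HasEigenvalue c}.Finite := Module.End.finite_hasEigenvalue f
    obtain ⟨v, hv⟩ : ∃ v : V, ∀ c, W ⊔ LinearMap.range (f - c • (1 : End ℂ V)) ≠ ⊤ →
        v ∉ W ⊔ LinearMap.range (f - c • (1 : End ℂ V)) := by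
      classical
      let s : Finset (Submodule ℂ V) :=
        (hfin.toFinset.image fun c => W ⊔ LinearMap.range (f - c • (1 : End ℂ V))).erase ⊤
      have hs : (⊤ : Submodule ℂ V) ∉ s := by simp [s]
      have := Subspace.biUnion_ne_univ_of_top_notMem hs
      obtain ⟨v, hv⟩ := (Set.ne_univ_iff_exists_notMem _).1 this
      refine ⟨v, fun c hc hvc => hv ?_⟩
      simp only [Set.mem_iUnion]
      refine ⟨_, ?_, hvc⟩
      simp only [s, Finset.mem_erase, Finset.mem_image, Set.Finite.mem_toFinset]
      refine ⟨hc, c, ?_, rfl⟩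
      by_contra hcc
      apply hc
      rw [range_eq_top_of_not_eig f c hcc]; simp
    let W' : Submodule ℂ V := W ⊔ Submodule.span ℂ (Set.range fun i : ℕ => (f ^ i) v)
    have hW' : ∀ x ∈ W', f x ∈ W' := by
      have : W' ≤ W'.comap f := by
        apply sup_le
        · intro x hx; exact Submodule.mem_sup_left (hW x hx)
        · apply Submodule.span_le.2
          rintro _ ⟨i, rfl⟩
          apply Submodule.mem_sup_right
          apply Submodule.subset_span
          exact ⟨i + 1, by simp [pow_succ', Module.End.mul_apply]⟩
      exact fun x hx => this hx
    have hvW' : v ∈ W' := Submodule.mem_sup_right (Submodule.subset_span ⟨0, by simp⟩)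
    obtain ⟨v', hv'⟩ := ih W' hW' (by
      intro c
      by_cases hc : W ⊔ LinearMap.range (f - c • (1 : End ℂ V)) = ⊤
      · have : W' ⊔ LinearMap.range (f - c • (1 : End ℂ V)) = ⊤ := by
          rw [eq_top_iff, ← hc]; exact sup_le_sup_right le_sup_left _
        rw [this, finrank_top]; omega
      · have hlt : W ⊔ LinearMap.range (f - c • (1 : End ℂ V)) <
            W' ⊔ LinearMap.range (f - c • (1 : End ℂ V)) := by
          refine lt_of_le_of_ne (sup_le_sup_right le_sup_left _) fun he => hv c hc ?_
          rw [he]; exact Submodule.mem_sup_left hvW'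
        have := Submodule.finrank_lt_finrank_of_lt hlt
        have := h c
        omega)
    refine ⟨Fin.cons v v', fun U hU hWU hvU => hv' U hU (sup_le hWU ?_) fun a => by
      simpa using hvU a.succ⟩
    apply Submodule.span_le.2
    rintro _ ⟨i, rfl⟩
    induction i with
    | zero => simpa using hvU 0
    | succ i ih2 =>
      have := hU _ ih2
      simpa [pow_succ', Module.End.mul_apply] using this

/-- chain: spanning and of the right total length -/
def IsChain (f : End ℂ V) {k : ℕ} (m : Fin k → ℕ) (v : Fin k → V) : Prop :=
  ∑ a, m a = finrank ℂ V ∧ sp f m v = ⊤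

lemma exists_sp_top (f : End ℂ V) (k : ℕ) (h : ∀ c : ℂ, finrank ℂ V ≤ rg f c + k) :
    ∃ (v : Fin k → V) (m : Fin k → ℕ), sp f m v = ⊤ := by
  obtain ⟨v, hv⟩ := gen f k ⊥ (by simp) (fun c => by rw [bot_sup_eq]; exact h c)
  refine ⟨v, ?_⟩
  let F : ℕ →o Submodule ℂ V := ⟨fun N => sp f (fun _ : Fin k => N) v, fun N N' hN =>
    sp_le _ _ _ _ fun a i hi => mem_sp _ _ _ _ _ (lt_of_lt_of_le hi hN)⟩
  obtain ⟨N, hN⟩ := monotone_stabilizes_iff_noetherian.2 (inferInstance : IsNoetherian ℂ V) F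
  refine ⟨fun _ => N, hv _ ?_ bot_le ?_⟩
  · have : sp f (fun _ => N) v ≤ (sp f (fun _ => N + 1) v).comap f := by
      refine sp_le _ _ _ _ fun a i hi => ?_
      have := mem_sp f (fun _ => N + 1) v a (i + 1) (by simpa using hi)
      simpa [pow_succ', Module.End.mul_apply] using this
    intro x hx
    have h2 := this hx
    have h3 : sp f (fun _ => N) v = sp f (fun _ => N + 1) v := hN (N + 1) (by omega)
    rw [h3]; exact h2
  · intro a
    have h3 : sp f (fun _ => N) v = sp f (fun _ => N + 1) v := hN (N + 1) (by omega)
    rw [h3]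
    have := mem_sp f (fun _ => N + 1) v a 0 (by simp)
    simpa using this

lemma sp_eq_span_range (f : End ℂ V) {k : ℕ} (m : Fin k → ℕ) (v : Fin k → V) :
    sp f m v = Submodule.span ℂ (Set.range fun x : (Σ a : Fin k, Fin (m a)) => (f ^ (x.2 : ℕ)) (v x.1)) := by
  unfold sp
  congr 1
  ext y
  constructor
  · rintro ⟨a, i, hi, rfl⟩; exact ⟨⟨a, i, hi⟩, rfl⟩
  · rintro ⟨⟨a, i⟩, rfl⟩; exact ⟨a, i, i.2, rfl⟩

lemma exists_chain (f : End ℂ V) (k : ℕ) (h : ∀ c : ℂ, finrank ℂ V ≤ rg f c + k) :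
    ∃ (v : Fin k → V) (m : Fin k → ℕ), IsChain f m v := by
  classical
  obtain ⟨v, m0, hm0⟩ := exists_sp_top f k h
  have hex : ∃ s, ∃ m : Fin k → ℕ, ∑ a, m a = s ∧ sp f m v = ⊤ := ⟨_, m0, rfl, hm0⟩
  obtain ⟨m, hms, hm⟩ := Nat.find_spec hex
  refine ⟨v, m, le_antisymm ?_ ?_, hm⟩
  · by_contra hlt
    push Not at hlt
    have hcard : finrank ℂ V < Fintype.card (Σ a : Fin k, Fin (m a)) := by
      simpa using hlt
    have hdep : ¬ LinearIndependent ℂ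
        (fun x : (Σ a : Fin k, Fin (m a)) => (f ^ (x.2 : ℕ)) (v x.1)) := fun hli => by
      have := hli.fintype_card_le_finrank
      omega
    obtain ⟨g, hg, x1, hx1⟩ := Fintype.not_linearIndependent_iff.1 hdep
    obtain ⟨x0, hx0, hmin⟩ := Finset.exists_min_image (Finset.univ.filter fun x => g x ≠ 0)
      (fun x : (Σ a : Fin k, Fin (m a)) => m x.1 - 1 - (x.2 : ℕ)) ⟨x1, by simpa using hx1⟩
    obtain ⟨a, i⟩ := x0
    simp only [Finset.mem_filter, Finset.mem_univ, true_and] at hx0 hmin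
    set j := m a - 1 - (i : ℕ) with hj
    let m' := Function.update m a (m a - 1)
    have hma : 0 < m a := lt_of_le_of_lt (Nat.zero_le _) i.2
    have hkey : (f ^ (m a - 1)) (v a) ∈ sp f m' v := by
      have h1 := congrArg (f ^ j) hg
      rw [map_sum, map_zero, ← Finset.add_sum_erase _ _ (Finset.mem_univ (⟨a, i⟩ : Σ a, Fin (m a)))] at h1
      simp only [map_smul, ← Module.End.mul_apply, ← pow_add] at h1
      have hji : j + (i : ℕ) = m a - 1 := by have := i.2; omega
      rw [hji] at h1
      have h2 : g ⟨a, i⟩ • (f ^ (m a - 1)) (v a) ∈ sp f m' v := by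
        rw [eq_neg_of_add_eq_zero_left h1]
        apply Submodule.neg_mem
        apply Submodule.sum_mem
        rintro ⟨b, l⟩ hb
        by_cases hgb : g ⟨b, l⟩ = 0
        · rw [hgb]; simp
        apply Submodule.smul_mem
        apply mem_sp
        have h3 := hmin _ hgb
        have hl := l.2
        simp only at h3
        by_cases hba : b = a
        · subst hba
          have : l ≠ i := by rintro rfl; simp at hb
          have : (l : ℕ) ≠ i := fun h => this (Fin.ext h)
          simp only [m', Function.update_self]
          omega
        · simp only [m', Function.update_of_ne hba]
          omega
      have := Submodule.smul_mem _ (g ⟨a, i⟩)⁻¹ h2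
      rwa [smul_smul, inv_mul_cancel₀ hx0, one_smul] at this
    have htop : sp f m' v = ⊤ := by
      rw [eq_top_iff, ← hm]
      refine sp_le _ _ _ _ fun b l hl => ?_
      by_cases hba : b = a
      · subst hba
        by_cases hl2 : l = m b - 1
        · rw [hl2]; exact hkey
        · apply mem_sp; simp only [m', Function.update_self]; omega
      · apply mem_sp; simpa only [m', Function.update_of_ne hba]
    have hsum : ∑ a, m' a < ∑ a, m a := by
      apply Finset.sum_lt_sum
      · intro b _
        by_cases hba : b = a
        · subst hba; simp [m']
        · simp [m', Function.update_of_ne hba]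
      · exact ⟨a, Finset.mem_univ _, by simp [m', hma]⟩
    exact Nat.find_min hex (by rw [← hms]; exact hsum) ⟨m', rfl, htop⟩
  · rw [← finrank_top ℂ V, ← hm, sp_eq_span_range]
    refine (finrank_range_le_card _).trans ?_
    simp

lemma exchange (f : End ℂ V) {k : ℕ} (m : Fin k → ℕ) (v : Fin k → V) (hc : IsChain f m v)
    (a b : Fin k) (hab : m b + 1 ≤ m a) :
    ∃ v', IsChain f (Function.update (Function.update m a (m a - 1)) b (m b + 1)) v' := by
  classical
  have hne : b ≠ a := by rintro rfl; omega
  obtain ⟨hsum, htop⟩ := hc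
  set m' := Function.update (Function.update m a (m a - 1)) b (m b + 1) with hm'
  have hm'a : m' a = m a - 1 := by simp [hm', Function.update_of_ne hne.symm]
  have hm'b : m' b = m b + 1 := by simp [hm']
  have hm'o : ∀ c, c ≠ a → c ≠ b → m' c = m c := by
    intro c h1 h2; simp [hm', Function.update_of_ne h1, Function.update_of_ne h2]
  set P := sp f (Function.update m a (m a - 1)) v with hP
  have hPtop : P ≠ ⊤ := by
    intro h
    have h1 : finrank ℂ V ≤ ∑ c, Function.update m a (m a - 1) c := by
      rw [← finrank_top ℂ V, ← h, hP, sp_eq_span_range]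
      refine (finrank_range_le_card _).trans ?_
      simp
    have : ∑ c, Function.update m a (m a - 1) c < ∑ c, m c := by
      apply Finset.sum_lt_sum
      · intro c _
        by_cases hba : c = a
        · subst hba; simp
        · simp [Function.update_of_ne hba]
      · exact ⟨a, Finset.mem_univ _, by simp; omega⟩
    omega
  have hsup : ∀ z, z ∈ P ⊔ Submodule.span ℂ {(f ^ (m a - 1)) (v a)} := by
    intro z
    have : sp f m v ≤ P ⊔ Submodule.span ℂ {(f ^ (m a - 1)) (v a)} := by
      refine sp_le _ _ _ _ fun c l hl => ?_
      by_cases hca : c = a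
      · subst hca
        by_cases hl2 : l = m c - 1
        · apply Submodule.mem_sup_right; rw [hl2]; exact Submodule.mem_span_singleton_self _
        · apply Submodule.mem_sup_left; apply mem_sp; simp; omega
      · apply Submodule.mem_sup_left; apply mem_sp; simpa [Function.update_of_ne hca]
    exact this (htop ▸ Submodule.mem_top)
  have htopv : (f ^ (m a - 1)) (v a) ∉ P := by
    intro h
    apply hPtop
    rw [eq_top_iff]
    intro z _
    have := hsup z
    rwa [sup_eq_left.2 ((Submodule.span_singleton_le_iff_mem _ _).2 h)] at this
  -- choose c
  obtain ⟨c, hc⟩ : ∃ c : ℂ, (f ^ (m b)) (v b) + c • (f ^ (m a - 1)) (v a) ∉ P := by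
    by_cases h : (f ^ (m b)) (v b) ∈ P
    · refine ⟨1, fun h2 => htopv ?_⟩
      have := P.sub_mem h2 h
      simpa using this
    · exact ⟨0, by simpa using h⟩
  let d := m a - 1 - m b
  let v' := Function.update v b (v b + c • (f ^ d) (v a))
  have hv'b : v' b = v b + c • (f ^ d) (v a) := by simp [v']
  have hv'o : ∀ e, e ≠ b → v' e = v e := fun e he => by simp [v', Function.update_of_ne he]
  have hPle : P ≤ sp f m' v' := by
    have hoth : ∀ e l, e ≠ b → l < m' e → (f ^ l) (v e) ∈ sp f m' v' := by
      intro e l he hl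
      rw [← hv'o e he]; exact mem_sp _ _ _ _ _ hl
    refine sp_le _ _ _ _ fun e l hl => ?_
    by_cases heb : e = b
    · subst heb
      rw [Function.update_of_ne hne] at hl
      have h1 := mem_sp f m' v' e l (by omega)
      rw [hv'b, map_add, map_smul, ← Module.End.mul_apply, ← pow_add] at h1
      have h2 := hoth a (l + d) hne.symm (by rw [hm'a]; omega)
      have := Submodule.sub_mem _ h1 (Submodule.smul_mem _ c h2)
      simpa using this
    · apply hoth _ _ heb
      by_cases hea : e = a
      · subst hea; simpa [hm'a] using hl
      · rw [hm'o e hea heb]; simpa [Function.update_of_ne hea] using hl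
  have hnew : (f ^ (m b)) (v b) + c • (f ^ (m a - 1)) (v a) ∈ sp f m' v' := by
    have h1 := mem_sp f m' v' b (m b) (by omega)
    rw [hv'b, map_add, map_smul, ← Module.End.mul_apply, ← pow_add] at h1
    rwa [show m b + d = m a - 1 by omega] at h1
  refine ⟨v', ?_, ?_⟩
  · rw [← hsum]
    have h1 : ∑ c, m' c = m' a + (m' b + ∑ c ∈ (Finset.univ.erase a).erase b, m' c) := by
      rw [Finset.add_sum_erase _ _ (by simp [hne]), Finset.add_sum_erase _ _ (by simp)]
    have h2 : ∑ c, m c = m a + (m b + ∑ c ∈ (Finset.univ.erase a).erase b, m c) := by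
      rw [Finset.add_sum_erase _ _ (by simp [hne]), Finset.add_sum_erase _ _ (by simp)]
    have h3 : ∑ c ∈ (Finset.univ.erase a).erase b, m' c = ∑ c ∈ (Finset.univ.erase a).erase b, m c := by
      apply Finset.sum_congr rfl
      intro c hc
      simp at hc
      exact hm'o c hc.2 hc.1
    rw [h1, h2, h3, hm'a, hm'b]; omega
  · -- top
    obtain ⟨p, hp, q, hq, hpq⟩ := Submodule.mem_sup.1 (hsup ((f ^ (m b)) (v b) + c • (f ^ (m a - 1)) (v a)))
    obtain ⟨s, rfl⟩ := Submodule.mem_span_singleton.1 hq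
    have hs : s ≠ 0 := by
      rintro rfl
      apply hc; rw [← hpq]; simpa using hp
    have h1 : (f ^ (m a - 1)) (v a) ∈ sp f m' v' := by
      have h2 : s • (f ^ (m a - 1)) (v a) ∈ sp f m' v' := by
        have := Submodule.sub_mem _ hnew (hPle hp)
        rw [← hpq] at this; simpa using this
      have := Submodule.smul_mem _ s⁻¹ h2
      rwa [smul_smul, inv_mul_cancel₀ hs, one_smul] at this
    rw [eq_top_iff]
    intro z _
    have := hsup z
    exact (sup_le hPle ((Submodule.span_singleton_le_iff_mem _ _).2 h1)) this

/-- chains of prescribed balanced type -/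
lemma chain_balanced (f : End ℂ V) (k : ℕ) (h : ∀ c : ℂ, finrank ℂ V ≤ rg f c + k)
    (m' : Fin k → ℕ) (hs : ∑ a, m' a = finrank ℂ V) (hb : ∀ a b, m' a ≤ m' b + 1) :
    ∃ v, IsChain f m' v := by
  classical
  obtain ⟨v, m, hc⟩ := exists_chain f k h
  clear h
  induction hd : ∑ a, (m a - m' a) using Nat.strong_induction_on generalizing m v with
  | _ d ih =>
    by_cases hle : ∀ a, m a ≤ m' a
    · have : m = m' := by
        by_contra hne
        obtain ⟨a, ha⟩ := Function.ne_iff.1 hne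
        have : ∑ a, m a < ∑ a, m' a :=
          Finset.sum_lt_sum (fun a _ => hle a) ⟨a, Finset.mem_univ _, lt_of_le_of_ne (hle a) ha⟩
        rw [hs, hc.1] at this
        exact lt_irrefl _ this
      exact ⟨v, this ▸ hc⟩
    · push Not at hle
      obtain ⟨a, ha⟩ := hle
      obtain ⟨b, hb'⟩ : ∃ b, m b < m' b := by
        by_contra hcon
        push Not at hcon
        have : ∑ a, m' a < ∑ a, m a :=
          Finset.sum_lt_sum (fun a _ => hcon a) ⟨a, Finset.mem_univ _, ha⟩
        rw [hs, hc.1] at this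
        exact lt_irrefl _ this
      have hba := hb b a
      obtain ⟨v', hv'⟩ := exchange f m v hc a b (by omega)
      have hne : b ≠ a := by rintro rfl; omega
      refine ih _ ?_ v' _ hv' rfl
      rw [← hd]
      apply Finset.sum_lt_sum
      · intro c _
        by_cases h1 : c = b
        · subst h1; simp; omega
        · by_cases h2 : c = a
          · subst h2; simp [Function.update_of_ne h1]; omega
          · simp [Function.update_of_ne h1, Function.update_of_ne h2]
      · exact ⟨a, Finset.mem_univ _, by simp [Function.update_of_ne hne.symm]; omega⟩

end chains
end KP

namespace KP
set_option linter.unusedSectionVars false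
open Module

section lim

/-- similarity of endomorphisms -/
def Sim {V W : Type*} [AddCommGroup V] [Module ℂ V] [AddCommGroup W] [Module ℂ W]
    (f : End ℂ V) (g : End ℂ W) : Prop := ∃ e : V ≃ₗ[ℂ] W, ∀ v, e (f v) = g (e v)

section sim
variable {V W Z : Type*} [AddCommGroup V] [Module ℂ V] [AddCommGroup W] [Module ℂ W]
  [AddCommGroup Z] [Module ℂ Z]

lemma Sim.refl (f : End ℂ V) : Sim f f := ⟨LinearEquiv.refl _ _, fun _ => rfl⟩
lemma Sim.symm {f : End ℂ V} {g : End ℂ W} (h : Sim f g) : Sim g f := by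
  obtain ⟨e, he⟩ := h
  exact ⟨e.symm, fun v => by rw [LinearEquiv.symm_apply_eq, he]; simp⟩
lemma Sim.trans {f : End ℂ V} {g : End ℂ W} {h : End ℂ Z} (h1 : Sim f g) (h2 : Sim g h) : Sim f h := by
  obtain ⟨e, he⟩ := h1
  obtain ⟨e', he'⟩ := h2
  exact ⟨e.trans e', fun v => by simp [he, he']⟩
lemma Sim.smul {f : End ℂ V} {g : End ℂ W} (h : Sim f g) (t : ℂ) : Sim (t • f) (t • g) := by
  obtain ⟨e, he⟩ := h
  exact ⟨e, fun v => by simp [he]⟩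
lemma Sim.neg {f : End ℂ V} {g : End ℂ W} (h : Sim f g) : Sim (-f) (-g) := by
  obtain ⟨e, he⟩ := h
  exact ⟨e, fun v => by simp [he]⟩
lemma Sim.sub_smul {f : End ℂ V} {g : End ℂ W} (h : Sim f g) (c : ℂ) :
    Sim (f - c • (1 : End ℂ V)) (g - c • (1 : End ℂ W)) := by
  obtain ⟨e, he⟩ := h
  exact ⟨e, fun v => by simp [he]⟩
lemma Sim.finrank_range {f : End ℂ V} {g : End ℂ W} (h : Sim f g) :
    finrank ℂ (LinearMap.range f) = finrank ℂ (LinearMap.range g) := by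
  obtain ⟨e, he⟩ := h
  have : LinearMap.range g = (LinearMap.range f).map (e : V →ₗ[ℂ] W) := by
    ext y
    constructor
    · rintro ⟨x, rfl⟩
      exact ⟨f (e.symm x), ⟨_, rfl⟩, by simp [he]⟩
    · rintro ⟨_, ⟨x, rfl⟩, rfl⟩
      exact ⟨e x, by simp [he]⟩
  rw [this]
  exact (LinearEquiv.finrank_map_eq e _).symm
lemma Sim.rg {f : End ℂ V} {g : End ℂ W} (h : Sim f g) (c : ℂ) : KP.rg f c = KP.rg g c :=
  (h.sub_smul c).finrank_range
lemma Sim.finrank {f : End ℂ V} {g : End ℂ W} (h : Sim f g) : finrank ℂ V = finrank ℂ W := by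
  obtain ⟨e, he⟩ := h
  exact e.finrank_eq
lemma Sim.trace {f : End ℂ V} {g : End ℂ W} (h : Sim f g) :
    LinearMap.trace ℂ V f = LinearMap.trace ℂ W g := by
  obtain ⟨e, he⟩ := h
  have : g = e.conj f := by
    ext x; simp [LinearEquiv.conj_apply, he]
  rw [this, LinearMap.trace_conj']
end sim

variable {V W : Type*} [NormedAddCommGroup V] [NormedSpace ℂ V] [FiniteDimensional ℂ V]
  [AddCommGroup W] [Module ℂ W] [FiniteDimensional ℂ W]

open Filter Topology in
/-- `A0` is a limit of conjugates of `t • B` as `t → 0`. -/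
def Lim (A0 : End ℂ V) (B : End ℂ W) : Prop :=
  ∃ F : ℂ → End ℂ V, (∀ v, Tendsto (fun t => F t v) (𝓝[≠] 0) (𝓝 (A0 v))) ∧
    ∀ t ≠ 0, Sim (F t) (t • B)

lemma Lim.zero (B : End ℂ W) (h : finrank ℂ V = finrank ℂ W) : Lim (0 : End ℂ V) B := by
  let e : V ≃ₗ[ℂ] W := LinearEquiv.ofFinrankEq _ _ h
  refine ⟨fun t => t • e.symm.conj B, fun v => ?_, fun t ht => ⟨e, fun v => ?_⟩⟩
  · have : Filter.Tendsto (fun t : ℂ => t • (e.symm.conj B) v) (nhds 0) (nhds ((0:ℂ) • (e.symm.conj B) v)) :=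
      (continuous_id.smul continuous_const).tendsto 0
    simpa using this.mono_left nhdsWithin_le_nhds
  · simp [LinearEquiv.conj_apply]

lemma Lim.sim {W' : Type*} [AddCommGroup W'] [Module ℂ W'] {A0 : End ℂ V} {B : End ℂ W} {B' : End ℂ W'}
    (h : Lim A0 B) (hs : Sim B B') : Lim A0 B' := by
  obtain ⟨F, h1, h2⟩ := h
  exact ⟨F, h1, fun t ht => (h2 t ht).trans (hs.smul t)⟩

lemma lim_of_scaling (A0 B R : End ℂ V) (D : ℂ → End ℂ V) (hD : ∀ v, Continuous fun t => D t v)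
    (hu : ∀ t ≠ 0, Function.Injective (D t))
    (h : ∀ t ≠ 0, ∀ v, D t (t • B v) = A0 (D t v) + t • D t (R (D t v))) : Lim A0 B := by
  refine ⟨fun t => A0 + t • (D t * R), fun v => ?_, fun t ht => ?_⟩
  · have : Filter.Tendsto (fun t : ℂ => A0 v + t • D t (R v)) (nhds 0) (nhds (A0 v + (0:ℂ) • D 0 (R v))) :=
      (continuous_const.add (continuous_id.smul (hD (R v)))).tendsto 0
    simpa using this.mono_left nhdsWithin_le_nhds
  · apply Sim.symm
    refine ⟨LinearEquiv.ofInjectiveEndo (D t) (hu t ht), fun v => ?_⟩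
    have := h t ht v
    simpa using this

noncomputable def chainBasis {W : Type*} [AddCommGroup W] [Module ℂ W] [FiniteDimensional ℂ W]
    {f : End ℂ W} {k : ℕ} {m : Fin k → ℕ} {v : Fin k → W} (h : IsChain f m v) :
    Basis (Σ a : Fin k, Fin (m a)) ℂ W :=
  basisOfTopLeSpanOfCardEqFinrank (fun x : (Σ a : Fin k, Fin (m a)) => (f ^ (x.2 : ℕ)) (v x.1))
    (by rw [← sp_eq_span_range, h.2]) (by simp [h.1])

lemma chainBasis_apply {W : Type*} [AddCommGroup W] [Module ℂ W] [FiniteDimensional ℂ W]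
    {f : End ℂ W} {k : ℕ} {m : Fin k → ℕ} {v : Fin k → W} (h : IsChain f m v)
    (x : Σ a : Fin k, Fin (m a)) : chainBasis h x = (f ^ (x.2 : ℕ)) (v x.1) := by
  simp [chainBasis]

lemma lim_of_chain {A : End ℂ V} {B : End ℂ W} {k : ℕ} {m : Fin k → ℕ} {v0 : Fin k → V} {v : Fin k → W}
    (hA : IsChain A m v0) (hB : IsChain B m v) (h0 : ∀ a, (A ^ m a) (v0 a) = 0) : Lim A B := by
  classical
  set b0 := chainBasis hA with hb0
  set b := chainBasis hB with hb
  let e : W ≃ₗ[ℂ] V := b.equiv b0 (Equiv.refl _)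
  have he : ∀ x, e (b x) = b0 x := fun x => by simp [e]
  let B' : End ℂ V := e.conj B
  have hBB : Sim B' B := ⟨e.symm, fun v => by simp [B', LinearEquiv.conj_apply]⟩
  refine Lim.sim ?_ hBB
  let D : ℂ → End ℂ V := fun t => b0.constr ℂ (fun x => t ^ (m x.1 - 1 - (x.2 : ℕ)) • b0 x)
  have hD : ∀ t x, D t (b0 x) = t ^ (m x.1 - 1 - (x.2 : ℕ)) • b0 x := fun t x => by
    simp only [D, Basis.constr_basis]
  let R : End ℂ V := b0.constr ℂ (fun x => if (x.2 : ℕ) + 1 = m x.1 then B' (b0 x) else 0)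
  have hR : ∀ x, R (b0 x) = if (x.2 : ℕ) + 1 = m x.1 then B' (b0 x) else 0 := fun x => by
    simp only [R, Basis.constr_basis]
  refine lim_of_scaling A B' R D (fun v => ?_) (fun t ht => ?_) fun t ht v => ?_
  · simp only [D, Basis.constr_apply_fintype]
    fun_prop
  · have : Function.Surjective (D t) := by
      rw [← LinearMap.range_eq_top, eq_top_iff, ← b0.span_eq]
      apply Submodule.span_le.2
      rintro _ ⟨x, rfl⟩
      refine ⟨(t ^ (m x.1 - 1 - (x.2 : ℕ)))⁻¹ • b0 x, ?_⟩
      rw [map_smul, hD, smul_smul, inv_mul_cancel₀ (pow_ne_zero _ ht), one_smul]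
    exact LinearMap.injective_iff_surjective.2 this
  · have : D t ∘ₗ (t • B') = A ∘ₗ D t + t • (D t ∘ₗ R ∘ₗ D t) := by
      apply b0.ext
      rintro ⟨a, i⟩
      have hi := i.2
      have hBx : B' (b0 ⟨a, i⟩) = e (B (b ⟨a, i⟩)) := by
        rw [← he]; simp [B', LinearEquiv.conj_apply]
      simp only [LinearMap.comp_apply, LinearMap.add_apply, LinearMap.smul_apply, hD, map_smul, hR]
      by_cases hend : (i : ℕ) + 1 = m a
      · have h1 : m a - 1 - (i : ℕ) = 0 := by omega
        have hA0 : A (b0 ⟨a, i⟩) = 0 := by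
          rw [hb0, chainBasis_apply, ← Module.End.mul_apply, ← pow_succ', hend, h0]
        simp [h1, hend, hA0]
      · let y : Σ a : Fin k, Fin (m a) := ⟨a, ⟨(i : ℕ) + 1, by omega⟩⟩
        have h2 : B' (b0 ⟨a, i⟩) = b0 y := by
          rw [hBx, ← he]; congr 1
          rw [hb, chainBasis_apply, chainBasis_apply, ← Module.End.mul_apply, ← pow_succ']
        have h3 : A (b0 ⟨a, i⟩) = b0 y := by
          rw [hb0, chainBasis_apply, chainBasis_apply, ← Module.End.mul_apply, ← pow_succ']
        rw [h2, h3, hD]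
        simp only [hend, if_false, map_zero, smul_zero, add_zero, smul_smul]
        congr 1
        have : m a - 1 - (i : ℕ) = (m a - 1 - ((i : ℕ) + 1)) + 1 := by omega
        rw [this, pow_succ']
    have := LinearMap.congr_fun this v
    simpa using this

lemma lim_sqzero {T : End ℂ V} {B : End ℂ W} (hVW : finrank ℂ V = finrank ℂ W)
    (hT : ∀ x, T (T x) = 0) (hr : ∀ c, finrank ℂ (LinearMap.range T) ≤ rg B c) : Lim T B := by
  classical
  set s := finrank ℂ (LinearMap.range T) with hs
  set n := finrank ℂ V with hn
  have hle : LinearMap.range T ≤ LinearMap.ker T := by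
    rintro _ ⟨x, rfl⟩; exact hT x
  have hrn : finrank ℂ (LinearMap.range T) + finrank ℂ (LinearMap.ker T) = n :=
    LinearMap.finrank_range_add_finrank_ker T
  have h2s : 2 * s ≤ n := by
    have := Submodule.finrank_mono hle
    omega
  obtain ⟨K, hK⟩ := Submodule.exists_isCompl ((LinearMap.range T).comap (LinearMap.ker T).subtype)
  have hKdim : finrank ℂ K = n - 2 * s := by
    have h1 := Submodule.finrank_add_eq_of_isCompl hK
    have h2 : finrank ℂ ((LinearMap.range T).comap (LinearMap.ker T).subtype) = s :=
      (Submodule.comapSubtypeEquivOfLe hle).finrank_eq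
    omega
  let bK : Basis (Fin (n - 2 * s)) ℂ K := finBasisOfFinrankEq ℂ K hKdim
  let bR : Basis (Fin s) ℂ (LinearMap.range T) := finBasisOfFinrankEq ℂ _ hs.symm
  have hw : ∀ i, ∃ w, T w = (bR i : V) := fun i => (bR i).2
  choose w hw using hw
  let m : Fin (n - s) → ℕ := fun a => if (a : ℕ) < s then 2 else 1
  have hm : ∑ a, m a = n := by
    have h1 : ∑ a : Fin (n - s), m a = ∑ a ∈ Finset.range (n - s), (if a < s then 2 else 1) :=
      Fin.sum_univ_eq_sum_range (fun a => if a < s then 2 else 1) (n - s)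
    rw [h1, show n - s = s + (n - 2 * s) by omega, Finset.sum_range_add,
      Finset.sum_congr rfl (g := fun _ => 2) (fun x hx => by simp at hx; simp [hx]),
      Finset.sum_congr rfl (s₁ := Finset.range (n - 2 * s)) (g := fun _ => 1) (fun x hx => by simp)]
    simp; omega
  let v0 : Fin (n - s) → V := fun a => if h : (a : ℕ) < s then w ⟨a, h⟩
    else ((bK ⟨(a : ℕ) - s, by omega⟩ : LinearMap.ker T) : V)
  obtain ⟨v, hv⟩ := chain_balanced B (n - s) (fun c => by have := hr c; omega) m (by rw [hm, hVW])
    (fun a b => by simp only [m]; split_ifs <;> omega)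
  refine lim_of_chain (v0 := v0) ⟨hm, ?_⟩ hv ?_
  · set U := sp T m v0 with hU
    have hR : LinearMap.range T ≤ U := by
      have h1 : ∀ i, (bR i : V) ∈ U := fun i => by
        have hi := i.2
        have := mem_sp T m v0 ⟨i, by omega⟩ 1 (by simp [m])
        simpa [v0, hw] using this
      intro x hx
      have h2 := bR.sum_repr ⟨x, hx⟩
      have h3 : x = ∑ i, (bR.repr ⟨x, hx⟩ i) • (bR i : V) := by
        have h3 := congrArg (LinearMap.range T).subtype h2
        rw [map_sum] at h3
        exact h3.symm
      rw [h3]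
      exact Submodule.sum_mem _ fun i _ => Submodule.smul_mem _ _ (h1 i)
    have hKU : ∀ x : LinearMap.ker T, x ∈ K → (x : V) ∈ U := by
      have h1 : ∀ i, ((bK i : LinearMap.ker T) : V) ∈ U := fun i => by
        have hi := i.2
        have := mem_sp T m v0 ⟨s + i, by omega⟩ 0 (by simp [m])
        simpa [v0] using this
      intro x hx
      have h2 := bK.sum_repr ⟨x, hx⟩
      have h3 : (x : V) = ∑ i, (bK.repr ⟨x, hx⟩ i) • ((bK i : LinearMap.ker T) : V) := by
        have h3 := congrArg ((LinearMap.ker T).subtype ∘ₗ K.subtype) h2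
        rw [map_sum] at h3
        exact h3.symm
      rw [h3]
      exact Submodule.sum_mem _ fun i _ => Submodule.smul_mem _ _ (h1 i)
    have hker : LinearMap.ker T ≤ U := by
      intro x hx
      have h1 : (⟨x, hx⟩ : LinearMap.ker T) ∈
          (LinearMap.range T).comap (LinearMap.ker T).subtype ⊔ K := by
        rw [hK.sup_eq_top]; trivial
      obtain ⟨y, hy, z, hz, hyz⟩ := Submodule.mem_sup.1 h1
      have h2 : x = (y : V) + z := by rw [← Submodule.coe_add, hyz]
      rw [h2]
      exact U.add_mem (hR hy) (hKU z hz)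
    have hwU : ∀ i, w i ∈ U := fun i => by
      have hi := i.2
      have := mem_sp T m v0 ⟨i, by omega⟩ 0 (by simp [m])
      simpa [v0] using this
    rw [eq_top_iff]
    intro x _
    have h2 := bR.sum_repr ⟨T x, x, rfl⟩
    have h3 : T x = T (∑ i, (bR.repr ⟨T x, x, rfl⟩ i) • w i) := by
      have h3 := congrArg (LinearMap.range T).subtype h2
      rw [map_sum] at h3
      simp only [map_sum, map_smul, hw]
      exact h3.symm
    have h4 : x - (∑ i, (bR.repr ⟨T x, x, rfl⟩ i) • w i) ∈ U := hker (by
      rw [LinearMap.mem_ker, map_sub, ← h3, sub_self])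
    have h5 : (∑ i, (bR.repr ⟨T x, x, rfl⟩ i) • w i) ∈ U :=
      Submodule.sum_mem _ fun i _ => Submodule.smul_mem _ _ (hwU i)
    have := U.add_mem h4 h5
    simpa using this
  · intro a
    by_cases h : (a : ℕ) < s
    · simp [m, h, pow_two, hT]
    · simp [m, h, v0]

end lim
end KP

namespace KP
set_option linter.unusedSectionVars false
open Module

section ift
open Filter Topology

lemma ift {E : Type*} [NormedRing E] [NormedAlgebra ℂ E] [CompleteSpace E] {ι : Type*} [Fintype ι]
    (A0 : ι → E) (hs : ∀ Y : E, ∃ (X : ι → E) (c : ℂ), ∑ j, (X j * A0 j - A0 j * X j) + c • 1 = Y) :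
    map (fun h : (ι → E) × (ι → E) × ℂ =>
      (h.1, ∑ j, (1 + h.2.1 j) * h.1 j * Ring.inverse (1 + h.2.1 j) + h.2.2 • (1 : E)))
      (𝓝 (A0, 0, 0)) = 𝓝 (A0, ∑ j, A0 j) := by
  classical
  let H := (ι → E) × (ι → E) × ℂ
  let pA : H →L[ℂ] (ι → E) := ContinuousLinearMap.fst ℂ _ _
  let pX : H →L[ℂ] (ι → E) := (ContinuousLinearMap.fst ℂ _ _).comp (ContinuousLinearMap.snd ℂ _ _)
  let pc : H →L[ℂ] ℂ := (ContinuousLinearMap.snd ℂ _ _).comp (ContinuousLinearMap.snd ℂ _ _)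
  let pAj : ι → (H →L[ℂ] E) := fun j => (ContinuousLinearMap.proj j).comp pA
  let pXj : ι → (H →L[ℂ] E) := fun j => (ContinuousLinearMap.proj j).comp pX
  let x0 : H := (A0, 0, 0)
  have hpA : ∀ h : H, pA h = h.1 := fun _ => rfl
  have hpc : ∀ h : H, pc h = h.2.2 := fun _ => rfl
  have hpAj : ∀ j (h : H), pAj j h = h.1 j := fun _ _ => rfl
  have hpXj : ∀ j (h : H), pXj j h = h.2.1 j := fun _ _ => rfl
  have hx1 : x0.1 = A0 := rfl
  have hx2 : x0.2.1 = 0 := rfl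
  have hx3 : x0.2.2 = 0 := rfl
  have hX : ∀ j, HasStrictFDerivAt (fun h : H => 1 + h.2.1 j) (pXj j) x0 := fun j => by
    have := (pXj j).hasStrictFDerivAt (x := x0)
    exact this.const_add 1
  have hI : ∀ j, HasStrictFDerivAt (fun h : H => Ring.inverse (1 + h.2.1 j)) (-(pXj j)) x0 := fun j => by
    have h1 : HasStrictFDerivAt (Ring.inverse : E → E)
        (-ContinuousLinearMap.mulLeftRight ℂ E (↑(1 : Eˣ)⁻¹) (↑(1 : Eˣ)⁻¹)) ((fun h : H => 1 + h.2.1 j) x0) := by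
      have := hasStrictFDerivAt_ringInverse (𝕜 := ℂ) (1 : Eˣ)
      simpa [x0] using this
    have h2 := h1.comp x0 (hX j)
    refine h2.congr_fderiv ?_
    ext z <;> simp
  have hg : ∀ j, HasStrictFDerivAt (fun h : H => (1 + h.2.1 j) * h.1 j * Ring.inverse (1 + h.2.1 j))
      (((ContinuousLinearMap.mul ℂ E).flip (A0 j)).comp (pXj j) + pAj j
        - ((ContinuousLinearMap.mul ℂ E) (A0 j)).comp (pXj j)) x0 := fun j => by
    have h1 := (hX j).mul' ((pAj j).hasStrictFDerivAt (x := x0))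
    have h2 := h1.mul' (hI j)
    refine h2.congr_fderiv ?_
    refine ContinuousLinearMap.ext fun z => ?_
    simp [hx1, hx2, hpAj, hpXj]
    abel
  have hsum : HasStrictFDerivAt (fun h : H => ∑ j, (1 + h.2.1 j) * h.1 j * Ring.inverse (1 + h.2.1 j)
      + h.2.2 • (1 : E))
      (∑ j, (((ContinuousLinearMap.mul ℂ E).flip (A0 j)).comp (pXj j) + pAj j
        - ((ContinuousLinearMap.mul ℂ E) (A0 j)).comp (pXj j)) + pc.smulRight (1 : E)) x0 := by
    apply HasStrictFDerivAt.add
    · exact HasStrictFDerivAt.fun_sum fun j _ => hg j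
    · exact (pc.smulRight (1 : E)).hasStrictFDerivAt
  have hall := (pA.hasStrictFDerivAt (x := x0)).prodMk hsum
  have := hall.map_nhds_eq_of_surj (by
    rw [LinearMap.range_eq_top]
    rintro ⟨G, Y⟩
    obtain ⟨X, c, h⟩ := hs (Y - ∑ j, G j)
    refine ⟨(G, X, c), ?_⟩
    refine Prod.ext ?_ ?_
    · rfl
    · have h' := eq_add_of_sub_eq h.symm
      change (∑ j, (((ContinuousLinearMap.mul ℂ E).flip (A0 j)).comp (pXj j) + pAj j
        - ((ContinuousLinearMap.mul ℂ E) (A0 j)).comp (pXj j)) + pc.smulRight (1 : E)) (G, X, c) = Y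
      have h3 : ∑ j, (X j * A0 j + G j - A0 j * X j) = ∑ j, (X j * A0 j - A0 j * X j) + ∑ j, G j := by
        rw [← Finset.sum_add_distrib]; exact Finset.sum_congr rfl fun j _ => by abel
      rw [add_apply, sum_apply]
      change ∑ j, (X j * A0 j + G j - A0 j * X j) + c • (1 : E) = Y
      rw [h3, h']; abel)
  have h0 : ∑ j, (1 + x0.2.1 j) * x0.1 j * Ring.inverse (1 + x0.2.1 j) + x0.2.2 • (1 : E) = ∑ j, A0 j := by
    simp [hx1, hx2, hx3]
  rw [h0] at this
  exact this

/-- Irreducibility of a tuple of endomorphisms. -/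
def Irr {V : Type*} [AddCommGroup V] [Module ℂ V] {ι : Type*} (A : ι → End ℂ V) : Prop :=
  ∀ W : Submodule ℂ V, (∀ i, ∀ v ∈ W, A i v ∈ W) → W = ⊥ ∨ W = ⊤

variable {V : Type*} [NormedAddCommGroup V] [NormedSpace ℂ V] [FiniteDimensional ℂ V]

lemma word_mem {ι : Type*} (A : ι → V →L[ℂ] V) (W : Submodule ℂ V) (hW : ∀ i, ∀ v ∈ W, A i v ∈ W)
    (w : List ι) (v : V) (hv : v ∈ W) : (w.map A).prod v ∈ W := by
  induction w with
  | nil => simpa using hv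
  | cons a w ih => simpa using hW a _ ih

lemma irr_word {ι : Type*} (A : ι → V →L[ℂ] V) (h : Irr fun i => (A i : End ℂ V)) (v : V) (hv : v ≠ 0)
    (φ : V →L[ℂ] ℂ) (hφ : φ ≠ 0) : ∃ w : List ι, φ ((w.map A).prod v) ≠ 0 := by
  by_contra hcon
  push Not at hcon
  rcases h (Submodule.span ℂ (Set.range fun w : List ι => (w.map A).prod v)) (by
    intro i
    have : Submodule.span ℂ (Set.range fun w : List ι => (w.map A).prod v) ≤
      (Submodule.span ℂ (Set.range fun w : List ι => (w.map A).prod v)).comap (A i : End ℂ V) := by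
      apply Submodule.span_le.2
      rintro _ ⟨w, rfl⟩
      exact Submodule.subset_span ⟨i :: w, by simp⟩
    exact fun v hv => this hv) with h1 | h1
  · apply hv
    have : v ∈ Submodule.span ℂ (Set.range fun w : List ι => (w.map A).prod v) :=
      Submodule.subset_span ⟨[], by simp⟩
    rw [h1] at this
    simpa using this
  · apply hφ
    ext x
    have hx : x ∈ Submodule.span ℂ (Set.range fun w : List ι => (w.map A).prod v) := by
      rw [h1]; trivial
    have : Submodule.span ℂ (Set.range fun w : List ι => (w.map A).prod v) ≤ LinearMap.ker (φ : V →ₗ[ℂ] ℂ) := by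
      apply Submodule.span_le.2
      rintro _ ⟨w, rfl⟩
      exact hcon w
    exact this hx

lemma irr_open {ι : Type*} [Finite ι] (A0 : ι → V →L[ℂ] V) (h : Irr fun i => (A0 i : End ℂ V)) :
    ∀ᶠ A in 𝓝 A0, Irr fun i => (A i : End ℂ V) := by
  have hprop : ProperSpace V := FiniteDimensional.proper ℂ V
  have hprop2 : ProperSpace (V →L[ℂ] ℂ) := FiniteDimensional.proper ℂ _
  have hK : IsCompact (Metric.sphere (0 : V) 1 ×ˢ Metric.sphere (0 : V →L[ℂ] ℂ) 1) :=
    (isCompact_sphere _ _).prod (isCompact_sphere _ _)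
  have := hK.eventually_forall_of_forall_eventually (x₀ := A0)
    (P := fun A y => ∃ w : List ι, y.2 ((w.map A).prod y.1) ≠ 0) (by
      rintro ⟨v, φ⟩ ⟨hv, hφ⟩
      have hv0 : v ≠ 0 := by rintro rfl; simp at hv
      have hφ0 : φ ≠ 0 := by rintro rfl; simp at hφ
      obtain ⟨w, hw⟩ := irr_word A0 h v hv0 φ hφ0
      have hcont : Continuous fun z : (ι → V →L[ℂ] V) × V × (V →L[ℂ] ℂ) => z.2.2 ((w.map z.1).prod z.2.1) := by
        have h1 : Continuous fun z : (ι → V →L[ℂ] V) × V × (V →L[ℂ] ℂ) => (w.map z.1).prod := by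
          clear hw
          induction w with
          | nil => simpa using continuous_const
          | cons a w ih =>
            simp only [List.map_cons, List.prod_cons]
            exact ((continuous_apply a).comp continuous_fst).mul ih
        exact (continuous_snd.comp continuous_snd).clm_apply
          (h1.clm_apply (continuous_fst.comp continuous_snd))
      have : ∀ᶠ z in 𝓝 (A0, v, φ), z.2.2 ((w.map z.1).prod z.2.1) ≠ 0 :=
        hcont.continuousAt.eventually_ne hw
      exact this.mono fun z hz => ⟨w, hz⟩)
  refine this.mono fun A hA W hW => ?_
  by_contra hcon
  push Not at hcon
  obtain ⟨hb, ht⟩ := hcon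
  obtain ⟨v, hvW, hv⟩ := Submodule.exists_mem_ne_zero_of_ne_bot hb
  obtain ⟨φ, hφ, hφW⟩ := Submodule.exists_le_ker_of_lt_top W (lt_top_iff_ne_top.2 ht)
  let φc : V →L[ℂ] ℂ := LinearMap.toContinuousLinearMap φ
  have hφc : φc ≠ 0 := by
    intro h0; apply hφ; ext x
    have := congrArg (fun f : V →L[ℂ] ℂ => f x) h0
    simpa [φc] using this
  obtain ⟨w, hw⟩ := hA (((‖v‖⁻¹ : ℝ) : ℂ) • v, ((‖φc‖⁻¹ : ℝ) : ℂ) • φc) ⟨by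
      simp only [mem_sphere_zero_iff_norm, norm_smul, Complex.norm_real, norm_inv, norm_norm]
      exact inv_mul_cancel₀ (norm_ne_zero_iff.2 hv), by
      simp only [mem_sphere_zero_iff_norm, norm_smul, Complex.norm_real, norm_inv, norm_norm]
      exact inv_mul_cancel₀ (norm_ne_zero_iff.2 hφc)⟩
  apply hw
  have h1 : (w.map A).prod v ∈ W := word_mem A W hW w v hvW
  have h2 : φ ((w.map A).prod v) = 0 := hφW h1
  simp [φc, h2]

lemma schur {V : Type*} [AddCommGroup V] [Module ℂ V] [FiniteDimensional ℂ V] [Nontrivial V]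
    {ι : Type*} (A : ι → End ℂ V) (h : Irr A) (Z : End ℂ V)
    (hZ : ∀ i v, Z (A i v) = A i (Z v)) : ∃ c : ℂ, Z = c • 1 := by
  obtain ⟨c, hc⟩ := Module.End.exists_eigenvalue Z
  refine ⟨c, ?_⟩
  rcases h (Z.eigenspace c) (fun i v hv => by
    rw [Module.End.mem_eigenspace_iff] at hv ⊢
    rw [hZ, hv, map_smul]) with h1 | h1
  · exact absurd h1 hc
  · ext x
    have : x ∈ Z.eigenspace c := by rw [h1]; trivial
    simpa using Module.End.mem_eigenspace_iff.1 this

lemma trace_rep {V : Type*} [AddCommGroup V] [Module ℂ V] [FiniteDimensional ℂ V]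
    (φ : End ℂ V →ₗ[ℂ] ℂ) : ∃ Z : End ℂ V, ∀ A, φ A = LinearMap.trace ℂ V (Z * A) := by
  let τ : End ℂ V →ₗ[ℂ] (End ℂ V →ₗ[ℂ] ℂ) :=
    LinearMap.mk₂ ℂ (fun Z A => LinearMap.trace ℂ V (Z * A)) (by intros; simp [add_mul])
      (by intros; simp) (by intros; simp [mul_add]) (by intros; simp)
  have hinj : Function.Injective τ := by
    rw [← LinearMap.ker_eq_bot, eq_bot_iff]
    intro Z hZ
    rw [Submodule.mem_bot]
    ext v
    rw [LinearMap.zero_apply, ← Module.forall_dual_apply_eq_zero_iff ℂ]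
    intro ψ
    have h1 := LinearMap.congr_fun hZ (LinearMap.smulRight ψ v)
    have h2 : Z * (LinearMap.smulRight ψ v) = LinearMap.smulRight ψ (Z v) := by
      ext x; simp
    simp only [τ, LinearMap.mk₂_apply, h2, LinearMap.trace_smulRight, LinearMap.zero_apply] at h1
    exact h1
  have hsurj : Function.Surjective τ :=
    (LinearMap.injective_iff_surjective_of_finrank_eq_finrank (by
      rw [Subspace.dual_finrank_eq])).1 hinj
  obtain ⟨Z, hZ⟩ := hsurj φ
  exact ⟨Z, fun A => by rw [← hZ]; rfl⟩

lemma comm_surj {V : Type*} [AddCommGroup V] [Module ℂ V] [FiniteDimensional ℂ V] [Nontrivial V]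
    {ι : Type*} [Fintype ι] (A : ι → End ℂ V) (h : Irr A) (Y : End ℂ V) :
    ∃ (X : ι → End ℂ V) (c : ℂ), ∑ j, (X j * A j - A j * X j) + c • 1 = Y := by
  classical
  let L : ((ι → End ℂ V) × ℂ) →ₗ[ℂ] End ℂ V :=
    { toFun := fun x => ∑ j, (x.1 j * A j - A j * x.1 j) + x.2 • 1
      map_add' := by
        intro x y
        simp only [Prod.fst_add, Prod.snd_add, Pi.add_apply, add_mul, mul_add, add_smul]
        rw [show ∑ j, (x.1 j * A j + y.1 j * A j - (A j * x.1 j + A j * y.1 j)) =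
          ∑ j, (x.1 j * A j - A j * x.1 j) + ∑ j, (y.1 j * A j - A j * y.1 j) by
            rw [← Finset.sum_add_distrib]; exact Finset.sum_congr rfl fun j _ => by abel]
        abel
      map_smul' := by
        intro c x
        simp [Finset.smul_sum, smul_sub, smul_smul] }
  have htop : LinearMap.range L = ⊤ := by
    by_contra hne
    obtain ⟨φ, hφ, hle⟩ := Submodule.exists_le_ker_of_lt_top _ (lt_top_iff_ne_top.2 hne)
    obtain ⟨Z, hZ⟩ := trace_rep φ
    have hL : ∀ x, LinearMap.trace ℂ V (Z * L x) = 0 := fun x => by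
      rw [← hZ]; exact hle ⟨x, rfl⟩
    have hcomm : ∀ j, A j * Z - Z * A j = 0 := by
      intro j
      have hz : ∀ X : End ℂ V, LinearMap.trace ℂ V ((A j * Z - Z * A j) * X) = 0 := by
        intro X
        have h1 := hL (Pi.single j X, 0)
        have h2 : L (Pi.single j X, 0) = X * A j - A j * X := by
          simp only [L, LinearMap.coe_mk, AddHom.coe_mk, zero_smul, add_zero]
          rw [Finset.sum_eq_single j]
          · simp
          · intro b _ hb; simp [Pi.single_eq_of_ne hb]
          · simp
        rw [h2, mul_sub, map_sub, ← mul_assoc, ← mul_assoc, LinearMap.trace_mul_comm ℂ (Z * X),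
          ← mul_assoc] at h1
        rw [sub_mul, map_sub, h1]
      ext v
      rw [LinearMap.zero_apply, ← Module.forall_dual_apply_eq_zero_iff ℂ]
      intro ψ
      have h1 := hz (LinearMap.smulRight ψ v)
      have h2 : (A j * Z - Z * A j) * (LinearMap.smulRight ψ v) =
          LinearMap.smulRight ψ ((A j * Z - Z * A j) v) := by
        ext x; simp [smul_sub]
      rw [h2, LinearMap.trace_smulRight] at h1
      exact h1
    obtain ⟨c, hc⟩ := schur A h Z (fun i v => by
      have := LinearMap.congr_fun (sub_eq_zero.1 (hcomm i)) v
      simpa using this.symm)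
    have h1 := hL (0, 1)
    have h2 : L (0, 1) = 1 := by simp [L]
    rw [h2, hc] at h1
    have hn : (finrank ℂ V : ℂ) ≠ 0 := by exact_mod_cast finrank_pos.ne'
    have hc0 : c = 0 := by simpa [hn] using h1
    apply hφ
    ext A
    rw [hZ, hc, hc0]; simp
  obtain ⟨x, hx⟩ := (LinearMap.range_eq_top.1 htop) Y
  exact ⟨x.1, x.2, hx⟩

/-- pointwise limits are limits in operator norm -/
lemma tendsto_clm {α : Type*} {l : Filter α} (F : α → End ℂ V) (A : End ℂ V)
    (h : ∀ v, Tendsto (fun t => F t v) l (𝓝 (A v))) :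
    Tendsto (fun t => LinearMap.toContinuousLinearMap (F t)) l (𝓝 (LinearMap.toContinuousLinearMap A)) := by
  let b := finBasis ℂ V
  let g : (Fin (finrank ℂ V) → V) →ₗ[ℂ] (V →L[ℂ] V) :=
    (LinearMap.toContinuousLinearMap (𝕜 := ℂ) (E := V) (F' := V)).toLinearMap ∘ₗ
      (b.constr ℂ).toLinearMap
  have hg : ∀ f : End ℂ V, g (fun i => f (b i)) = LinearMap.toContinuousLinearMap f := by
    intro f
    have h1 : b.constr ℂ (fun i => f (b i)) = f := by
      apply b.ext; intro i; simp
    simp only [g, LinearMap.comp_apply, LinearEquiv.coe_coe, h1]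
  have hgc : Continuous g := LinearMap.continuous_of_finiteDimensional g
  rw [← hg A]
  simp_rw [← hg]
  exact (hgc.tendsto _).comp (tendsto_pi_nhds.2 fun i => h (b i))

theorem limit_sol [Nontrivial V] {W : Type*} [AddCommGroup W] [Module ℂ W] [FiniteDimensional ℂ W]
    {ι : Type*} [Fintype ι] (A0 : ι → End ℂ V) (B : ι → End ℂ W)
    (hL : ∀ i, Lim (A0 i) (B i)) (hsum : ∑ i, A0 i = 0) (htr : ∑ i, LinearMap.trace ℂ W (B i) = 0)
    (hirr : Irr A0) :
    ∃ A : ι → End ℂ V, (∀ i, Sim (A i) (B i)) ∧ ∑ i, A i = 0 ∧ Irr A := by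
  classical
  have hcomp : CompleteSpace V := FiniteDimensional.complete ℂ V
  choose F hF hFs using hL
  let cl : End ℂ V ≃ₗ[ℂ] (V →L[ℂ] V) := LinearMap.toContinuousLinearMap
  have clmul : ∀ a b : End ℂ V, cl (a * b) = cl a * cl b := fun a b => rfl
  have clone : cl 1 = 1 := rfl
  let A0c : ι → V →L[ℂ] V := fun i => cl (A0 i)
  have hmap := ift A0c (fun Y => by
    obtain ⟨X, c, h⟩ := comm_surj A0 hirr (cl.symm Y)
    refine ⟨fun j => cl (X j), c, ?_⟩
    have := congrArg cl h
    simpa [map_sum, clmul, clone] using this)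
  have hs0 : ∑ j, A0c j = 0 := by
    simp only [A0c, ← map_sum, hsum, map_zero]
  rw [hs0] at hmap
  -- the neighbourhood
  have hunit : ∀ᶠ h : (ι → V →L[ℂ] V) × (ι → V →L[ℂ] V) × ℂ in 𝓝 (A0c, 0, 0), ∀ j, IsUnit (1 + h.2.1 j) := by
    rw [Filter.eventually_all]
    intro j
    have hc : Continuous fun h : (ι → V →L[ℂ] V) × (ι → V →L[ℂ] V) × ℂ => 1 + h.2.1 j := by fun_prop
    have : {x : V →L[ℂ] V | IsUnit x} ∈ 𝓝 (1 + (0 : ι → V →L[ℂ] V) j) := by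
      apply Units.isOpen.mem_nhds
      simp
    exact (hc.continuousAt (x := (A0c, 0, 0))).preimage_mem_nhds this
  have hcontj : ∀ j, ContinuousAt (fun h : (ι → V →L[ℂ] V) × (ι → V →L[ℂ] V) × ℂ =>
      (1 + h.2.1 j) * h.1 j * Ring.inverse (1 + h.2.1 j)) (A0c, 0, 0) := by
    intro j
    have h1 : ContinuousAt (fun h : (ι → V →L[ℂ] V) × (ι → V →L[ℂ] V) × ℂ =>
      (1 + h.2.1 j) * h.1 j) (A0c, 0, 0) := by fun_prop
    refine h1.mul ?_
    have h2 : ContinuousAt (Ring.inverse : (V →L[ℂ] V) → _) (1 + (0 : ι → V →L[ℂ] V) j) := by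
      have := NormedRing.inverse_continuousAt (1 : (V →L[ℂ] V)ˣ)
      simpa using this
    exact ContinuousAt.comp (x := (A0c, 0, 0))
      (f := fun h : (ι → V →L[ℂ] V) × (ι → V →L[ℂ] V) × ℂ => 1 + h.2.1 j) h2 (by fun_prop)
  have hirr' : ∀ᶠ h : (ι → V →L[ℂ] V) × (ι → V →L[ℂ] V) × ℂ in 𝓝 (A0c, 0, 0),
      Irr fun j => (((1 + h.2.1 j) * h.1 j * Ring.inverse (1 + h.2.1 j) : V →L[ℂ] V) : End ℂ V) := by
    have h1 : ContinuousAt (fun h : (ι → V →L[ℂ] V) × (ι → V →L[ℂ] V) × ℂ =>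
      fun j => (1 + h.2.1 j) * h.1 j * Ring.inverse (1 + h.2.1 j)) (A0c, 0, 0) :=
      continuousAt_pi.2 hcontj
    have h2 : ∀ᶠ A in 𝓝 (fun j => (1 + (0 : ι → V →L[ℂ] V) j) * A0c j * Ring.inverse (1 + (0 : ι → V →L[ℂ] V) j)),
        Irr fun i => (A i : End ℂ V) := by
      have := irr_open A0c (by exact hirr)
      simpa using this
    exact h1.eventually h2
  have hgood := hunit.and hirr'
  have himg : ∀ᶠ y in 𝓝 (A0c, (0 : V →L[ℂ] V)), ∃ h : (ι → V →L[ℂ] V) × (ι → V →L[ℂ] V) × ℂ,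
      ((∀ j, IsUnit (1 + h.2.1 j)) ∧
        Irr fun j => (((1 + h.2.1 j) * h.1 j * Ring.inverse (1 + h.2.1 j) : V →L[ℂ] V) : End ℂ V)) ∧
      (h.1, ∑ j, (1 + h.2.1 j) * h.1 j * Ring.inverse (1 + h.2.1 j) + h.2.2 • (1 : V →L[ℂ] V)) = y := by
    rw [← hmap, Filter.eventually_map]
    exact hgood.mono fun h hh => ⟨h, hh, rfl⟩
  have htend : Tendsto (fun t : ℂ => ((fun i => cl (F i t)), (0 : V →L[ℂ] V))) (𝓝[≠] 0) (𝓝 (A0c, 0)) :=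
    (tendsto_pi_nhds.2 fun i => tendsto_clm (F i) (A0 i) (hF i)).prodMk_nhds tendsto_const_nhds
  have hev := (htend.eventually himg).and self_mem_nhdsWithin
  obtain ⟨t, ⟨⟨A, X, c⟩, ⟨hu, hir⟩, heq⟩, ht⟩ := hev.exists
  simp only [Prod.mk.injEq] at heq
  obtain ⟨rfl, heq⟩ := heq
  simp only at hu hir heq
  have ht0 : t ≠ 0 := ht
  let A' : ι → End ℂ V := fun j => (((1 + X j) * cl (F j t) * Ring.inverse (1 + X j) : V →L[ℂ] V) : End ℂ V)
  have hsim : ∀ j, Sim (A' j) (F j t) := by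
    intro j
    obtain ⟨u, hu⟩ := hu j
    refine Sim.symm ⟨LinearEquiv.ofBijective ((u : V →L[ℂ] V) : End ℂ V) ?_, fun v => ?_⟩
    · refine ⟨Function.LeftInverse.injective (g := ((u⁻¹ : (V →L[ℂ] V)ˣ) : V →L[ℂ] V)) fun x => ?_,
        Function.RightInverse.surjective (g := ((u⁻¹ : (V →L[ℂ] V)ˣ) : V →L[ℂ] V)) fun x => ?_⟩
      · exact congrArg (fun f : V →L[ℂ] V => f x) u.inv_mul
      · exact congrArg (fun f : V →L[ℂ] V => f x) u.mul_inv
    · have h1 : (↑u⁻¹ : V →L[ℂ] V) ((u : V →L[ℂ] V) v) = v :=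
        congrArg (fun f : V →L[ℂ] V => f v) u.inv_mul
      simp only [A', ← hu, Ring.inverse_unit]
      change (u : V →L[ℂ] V) (F j t v) = (u : V →L[ℂ] V) (F j t ((↑u⁻¹ : V →L[ℂ] V) ((u : V →L[ℂ] V) v)))
      rw [h1]
  have htrA : ∀ j, LinearMap.trace ℂ V (A' j) = t * LinearMap.trace ℂ W (B j) := fun j => by
    rw [((hsim j).trans (hFs j t ht0)).trace]; simp
  have hsumA : ∑ j, A' j + c • (1 : End ℂ V) = 0 := by
    have h1 := congrArg cl.symm heq
    rw [map_add, map_sum, map_zero, map_smul] at h1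
    exact h1
  have hc : c = 0 := by
    have h1 := congrArg (LinearMap.trace ℂ V) hsumA
    rw [map_add, map_sum, map_smul, map_zero] at h1
    simp only [htrA, ← Finset.mul_sum, htr] at h1
    have hn : (finrank ℂ V : ℂ) ≠ 0 := by exact_mod_cast finrank_pos.ne'
    simpa [hn] using h1
  refine ⟨fun j => t⁻¹ • A' j, fun j => ?_, ?_, ?_⟩
  · have := ((hsim j).trans (hFs j t ht0)).smul t⁻¹
    rwa [smul_smul, inv_mul_cancel₀ ht0, one_smul] at this
  · rw [← Finset.smul_sum]
    rw [hc, zero_smul, add_zero] at hsumA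
    rw [hsumA, smul_zero]
  · intro U hU
    apply hir U
    intro i v hv
    have h1 := U.smul_mem t (hU i v hv)
    rw [LinearMap.smul_apply, smul_smul, mul_inv_cancel₀ ht0, one_smul] at h1
    exact h1

end ift
end KP

namespace KP
set_option linter.unusedSectionVars false
open Module

section pair
variable {n : ℕ}

/-- standard basis vector with natural index -/
def ee (n : ℕ) (i : ℕ) : Fin n → ℂ := fun j => if (j : ℕ) = i then 1 else 0

/-- endomorphism with prescribed images of basis vectors -/
def mkE (n : ℕ) (g : ℕ → (Fin n → ℂ)) : End ℂ (Fin n → ℂ) where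
  toFun x := ∑ i : Fin n, x i • g i
  map_add' x y := by simp [add_smul, Finset.sum_add_distrib]
  map_smul' c x := by simp [mul_smul, Finset.smul_sum]

lemma mkE_ee (g : ℕ → (Fin n → ℂ)) (i : ℕ) (hi : i < n) : mkE n g (ee n i) = g i := by
  show ∑ j : Fin n, (ee n i) j • g j = g i
  rw [Finset.sum_eq_single (⟨i, hi⟩ : Fin n)]
  · simp [ee]
  · intro b _ hb
    have : (b : ℕ) ≠ i := fun h => hb (Fin.ext h)
    simp [ee, this]
  · simp

lemma ee_out (i : ℕ) (hi : n ≤ i) : ee n i = 0 := by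
  funext j; simp [ee]; omega

lemma ee_span (U : Submodule ℂ (Fin n → ℂ)) (h : ∀ i < n, ee n i ∈ U) : U = ⊤ := by
  rw [eq_top_iff]
  intro x _
  have : x = ∑ i : Fin n, x i • ee n i := by
    funext j
    simp [ee, Finset.sum_apply, Fin.val_inj]
  rw [this]
  exact U.sum_mem fun i _ => U.smul_mem _ (h i i.2)

lemma ee_ne (i : ℕ) (hi : i < n) : ee n i ≠ 0 := by
  intro h
  have := congrFun h ⟨i, hi⟩
  simp [ee] at this

lemma end_ext (f g : End ℂ (Fin n → ℂ)) (h : ∀ i < n, f (ee n i) = g (ee n i)) : f = g := by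
  have : LinearMap.eqLocus f g = ⊤ := ee_span _ (fun i hi => h i hi)
  exact LinearMap.eqLocus_eq_top.1 this

/-- a good pair -/
def Good (A T : End ℂ (Fin n → ℂ)) : Prop :=
  ∃ u c : Fin n → ℂ, u ≠ 0 ∧ (A + T) u = 0 ∧ A u = c ∧ ((A + T) ^ n) c = 0 ∧
    Submodule.span ℂ (Set.range fun i : Fin n => ((A + T) ^ (i : ℕ)) c) = ⊤

lemma Good.symm {A T : End ℂ (Fin n → ℂ)} (h : Good A T) : Good T A := by
  obtain ⟨u, c, hu, h0, h1, h2, h3⟩ := h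
  refine ⟨-u, c, neg_ne_zero.2 hu, ?_, ?_, ?_, ?_⟩
  · rw [add_comm, map_neg, h0, neg_zero]
  · rw [map_neg]
    rw [LinearMap.add_apply, h1] at h0
    rw [neg_eq_iff_add_eq_zero, add_comm]; exact h0
  · rw [add_comm]; exact h2
  · rw [add_comm T A]; exact h3

lemma pow_mem_inv (S : End ℂ (Fin n → ℂ)) (W : Submodule ℂ (Fin n → ℂ)) (hW : ∀ v ∈ W, S v ∈ W) (i : ℕ) :
    ∀ v ∈ W, (S ^ i) v ∈ W := by
  induction i with
  | zero => intro v hv; simpa using hv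
  | succ i ih => intro v hv; rw [pow_succ']; exact hW _ (ih v hv)

lemma Good.irr {A T : End ℂ (Fin n → ℂ)} (h : Good A T) (W : Submodule ℂ (Fin n → ℂ))
    (hA : ∀ v ∈ W, A v ∈ W) (hT : ∀ v ∈ W, T v ∈ W) : W = ⊥ ∨ W = ⊤ := by
  obtain ⟨u, c, hu, h0, h1, h2, h3⟩ := h
  set S := A + T with hS
  have hSW : ∀ v ∈ W, S v ∈ W := fun v hv => by
    rw [hS, LinearMap.add_apply]; exact W.add_mem (hA v hv) (hT v hv)
  rw [or_iff_not_imp_left]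
  intro hW
  have hSn : S ^ n = 0 := by
    have : LinearMap.ker (S ^ n) = ⊤ := by
      rw [eq_top_iff, ← h3, Submodule.span_le]
      rintro _ ⟨i, rfl⟩
      show (S ^ n) ((S ^ (i : ℕ)) c) = 0
      rw [← Module.End.mul_apply, ← pow_add, add_comm, pow_add, Module.End.mul_apply, h2, map_zero]
    exact LinearMap.ker_eq_top.1 this
  -- kernel is one-dimensional
  have hli : LinearIndependent ℂ (fun i : Fin n => (S ^ (i : ℕ)) c) :=
    linearIndependent_of_top_le_span_of_card_eq_finrank (by rw [h3]) (by simp)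
  have hker : ∀ x, S x = 0 → ∃ a : ℂ, x = a • (S ^ (n - 1)) c := by
    intro x hx
    have hxs : x ∈ Submodule.span ℂ (Set.range fun i : Fin n => (S ^ (i : ℕ)) c) := by
      rw [h3]; trivial
    obtain ⟨a, rfl⟩ := (Submodule.mem_span_range_iff_exists_fun ℂ).1 hxs
    have key : ∀ i : Fin n, (i : ℕ) + 1 < n → a i = 0 := by
      rcases n with _ | n
      · intro i; exact i.elim0
      · rw [map_sum, Fin.sum_univ_castSucc] at hx
        simp only [map_smul, Fin.val_castSucc, Fin.val_last] at hx
        have e1 : ∀ i : ℕ, S ((S ^ i) c) = (S ^ (i + 1)) c := fun i => by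
          rw [pow_succ', Module.End.mul_apply]
        simp only [e1] at hx
        rw [h2, smul_zero, add_zero] at hx
        have h' := Fintype.linearIndependent_iff.1 (hli.comp _ (Fin.succ_injective n))
          (fun i => a i.castSucc) (by simpa using hx)
        intro i hi
        have := h' ⟨i, by omega⟩
        simpa using this
    rcases Nat.eq_zero_or_pos n with hn | hn
    · subst hn; exact ⟨0, by simp⟩
    · refine ⟨a ⟨n - 1, by omega⟩, ?_⟩
      rw [Finset.sum_eq_single (⟨n - 1, by omega⟩ : Fin n)]
      · intro b _ hb
        rw [key b, zero_smul]
        have := b.2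
        have : (b : ℕ) ≠ n - 1 := fun h => hb (Fin.ext h)
        omega
      · simp
  obtain ⟨w, hw, hw0⟩ := (Submodule.ne_bot_iff _).1 hW
  -- nonzero kernel vector in W
  have hz : ∃ z ∈ W, z ≠ 0 ∧ S z = 0 := by
    classical
    have hex : ∃ i, (S ^ i) w = 0 := ⟨n, by rw [hSn]; rfl⟩
    have hm := Nat.find_spec hex
    have hpos : Nat.find hex ≠ 0 := by
      intro h; rw [h] at hm; exact hw0 (by simpa using hm)
    obtain ⟨i, hi⟩ := Nat.exists_eq_succ_of_ne_zero hpos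
    refine ⟨(S ^ i) w, pow_mem_inv S W hSW i w hw, Nat.find_min hex (by omega), ?_⟩
    rw [hi, Nat.succ_eq_add_one, pow_succ', Module.End.mul_apply] at hm
    exact hm
  obtain ⟨z, hzW, hz0, hSz⟩ := hz
  obtain ⟨a, ha⟩ := hker z hSz
  obtain ⟨b, hb⟩ := hker u h0
  have ha0 : a ≠ 0 := by rintro rfl; simp at ha; exact hz0 ha
  have huW : u ∈ W := by
    have : u = (b * a⁻¹) • z := by rw [hb, ha, smul_smul, mul_assoc, inv_mul_cancel₀ ha0, mul_one]
    rw [this]; exact W.smul_mem _ hzW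
  have hcW : c ∈ W := by rw [← h1]; exact hA u huW
  rw [eq_top_iff, ← h3, Submodule.span_le]
  rintro _ ⟨i, rfl⟩
  exact pow_mem_inv S W hSW i c hcW

/-- Padovan-like sequence -/
def pad : ℕ → ℕ
  | 0 => 1
  | 1 => 0
  | 2 => 1
  | (j + 3) => pad (j + 1) + pad j

lemma pad_pos : ∀ j, 0 < pad (j + 2)
  | 0 => by simp [pad]
  | 1 => by simp [pad]
  | 2 => by simp [pad]
  | (j + 3) => by
      have := pad_pos (j + 1)
      show 0 < pad (j + 1 + 2) + pad (j + 2)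
      omega

/-- shift with cuts -/
noncomputable def shiftE (n : ℕ) (Y : Finset ℕ) : End ℂ (Fin n → ℂ) := mkE n fun j => if j ∈ Y then 0 else ee n (j + 1)

lemma good_case1 (hn : 4 ≤ n) (Y : Finset ℕ) (h0 : 0 ∉ Y) (h1 : 1 ∉ Y) (hl : n - 1 ∈ Y) (hl2 : n - 2 ∉ Y)
    (hl3 : n - 3 ∉ Y) (hc : ∀ y ∈ Y, y + 1 ∉ Y) :
    ∃ T : End ℂ (Fin n → ℂ), (∀ x, T (T x) = 0) ∧ finrank ℂ (LinearMap.range T) ≤ Y.card + 1 ∧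
      Good (shiftE n Y) T := by
  classical
  let e := ee n
  let G : ℕ → (Fin n → ℂ) := fun y => if y = n - 1 then e (n - 2) + e (n - 3) - (pad n : ℂ) • e 0
    else e (y + 1) - (pad (y + 1) : ℂ) • e 0
  let ph : ℕ → ℂ := fun j => if j = 0 then 1 else pad j
  let T : End ℂ (Fin n → ℂ) := mkE n fun j => -(ph j) • e 1 + if j ∈ Y then G j else 0
  have hT : ∀ j < n, T (e j) = -(ph j) • e 1 + if j ∈ Y then G j else 0 := fun j hj => mkE_ee _ j hj
  have hA : ∀ j < n, shiftE n Y (e j) = if j ∈ Y then 0 else e (j + 1) := fun j hj => mkE_ee _ j hj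
  have hT0 : T (e 0) = - e 1 := by rw [hT 0 (by omega)]; simp [h0, ph]
  have hT1 : T (e 1) = 0 := by rw [hT 1 (by omega)]; simp [h1, ph, pad]
  have hTn : ∀ j, j < n → j ≠ 0 → j ∉ Y → T (e j) = -(pad j : ℂ) • e 1 := fun j hj hj0 hjY => by
    rw [hT j hj]; simp [hjY, ph, hj0]
  have hpn : (pad n : ℂ) = pad (n - 2) + pad (n - 3) := by
    obtain ⟨j, rfl⟩ : ∃ j, n = j + 3 := ⟨n - 3, by omega⟩
    have : pad (j + 3) = pad (j + 1) + pad j := rfl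
    rw [this]; push_cast; rfl
  have hTG : ∀ y ∈ Y, y < n → T (G y) = 0 := by
    intro y hy hyn
    by_cases h : y = n - 1
    · simp only [G, h, if_true]
      rw [map_sub, map_add, map_smul, hT0, hTn _ (by omega) (by omega) hl2, hTn _ (by omega) (by omega) hl3, hpn]
      module
    · simp only [G, h, if_false]
      rw [map_sub, map_smul, hT0, hTn _ (by omega) (by omega) (hc y hy)]
      module
  refine ⟨T, ?_, ?_, ?_⟩
  · intro x
    have : T * T = 0 := by
      apply end_ext
      intro i hi
      rw [Module.End.mul_apply, hT i hi, map_add, map_smul, hT1]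
      split_ifs with h
      · rw [hTG i h hi]; simp
      · simp
    exact congrFun (congrArg DFunLike.coe this) x
  · have hle : LinearMap.range T ≤ Submodule.span ℂ ((insert (e 1) (Y.image G) : Finset (Fin n → ℂ)) : Set (Fin n → ℂ)) := by
      rintro _ ⟨x, rfl⟩
      show (∑ i : Fin n, x i • (-(ph i) • e 1 + if (i : ℕ) ∈ Y then G i else 0)) ∈ _
      refine Submodule.sum_mem _ fun i _ => Submodule.smul_mem _ _ (Submodule.add_mem _ (Submodule.smul_mem _ _ ?_) ?_)
      · exact Submodule.subset_span (by simp)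
      · split_ifs with h
        · exact Submodule.subset_span (by
            rw [Finset.coe_insert, Finset.coe_image]; right; exact ⟨i, h, rfl⟩)
        · exact Submodule.zero_mem _
    calc _ ≤ _ := Submodule.finrank_mono hle
      _ ≤ (insert (e 1) (Y.image G) : Finset (Fin n → ℂ)).card := finrank_span_finset_le_card _
      _ ≤ (Y.image G).card + 1 := Finset.card_insert_le _ _
      _ ≤ Y.card + 1 := by gcongr; exact Finset.card_image_le
  · set S := shiftE n Y + T with hS
    have hSe : ∀ j < n, S (e j) = (if j ∈ Y then 0 else e (j + 1)) + (-(ph j) • e 1 + if j ∈ Y then G j else 0) := by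
      intro j hj; rw [hS, LinearMap.add_apply, hA j hj, hT j hj]
    have hS0 : S (e 0) = 0 := by rw [hSe 0 (by omega)]; simp [h0, ph]
    have hA0 : shiftE n Y (e 0) = e 1 := by rw [hA 0 (by omega)]; simp [h0]
    have hSn : ∀ j, j < n → j ≠ 0 → j ∉ Y → S (e j) = e (j + 1) - (pad j : ℂ) • e 1 := by
      intro j hj hj0 hjY; rw [hSe j hj]; simp [hjY, ph, hj0]; abel
    -- the sequence g
    let g : ℕ → (Fin n → ℂ) := fun j => Nat.rec 0 (fun j x => S x + (pad j : ℂ) • e 1) j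
    have gs : ∀ j, g (j + 1) = S (g j) + (pad j : ℂ) • e 1 := fun j => rfl
    have g0 : g 0 = 0 := rfl
    have g1 : g 1 = e 1 := by
      have := gs 0; rw [g0] at this; simpa [pad] using this
    have g2 : g 2 = S (e 1) := by
      have := gs 1; rw [g1] at this; simpa [pad] using this
    have hrec : ∀ j, g (j + 3) - g (j + 1) - g j = (S ^ (j + 2)) (e 1) := by
      intro j
      induction j with
      | zero =>
        show g 3 - g 1 - g 0 = (S ^ 2) (e 1)
        have h3 : g 3 = S (S (e 1)) + e 1 := by
          have := gs 2; rw [g2] at this; simpa [pad] using this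
        rw [h3, g1, g0]; simp [pow_two]
      | succ j ih =>
        rw [pow_succ', Module.End.mul_apply, ← ih, gs (j + 3), gs (j + 1), gs j, map_sub, map_sub]
        have : pad (j + 3) = pad (j + 1) + pad j := rfl
        rw [this]; push_cast; module
    have hg : ∀ j, 1 ≤ j → j ≤ n - 1 → g j = e j - (if j - 1 ∈ Y then (pad j : ℂ) else 0) • e 0 := by
      intro j hj
      induction j, hj using Nat.le_induction with
      | base => intro _; rw [g1]; simp [h0]
      | succ j hj ih =>
        intro hjn
        rw [gs, ih (by omega), map_sub, map_smul, hS0, smul_zero, sub_zero, hSe j (by omega)]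
        have hj0 : j ≠ 0 := by omega
        have hjn' : j ≠ n - 1 := by omega
        by_cases hjY : j ∈ Y
        · simp [hjY, ph, hj0, G, hjn']
        · simp [hjY, ph, hj0]
    have hgn : g n = e (n - 2) + e (n - 3) - (pad n : ℂ) • e 0 := by
      obtain ⟨j, hj⟩ : ∃ j, n = j + 1 := ⟨n - 1, by omega⟩
      have hj' : n - 1 = j := by omega
      have : g n = g (j + 1) := congrArg g hj
      rw [this, gs, hg j (by omega) (by omega), map_sub, map_smul, hS0, smul_zero, sub_zero, hSe j (by omega)]
      have hj0 : j ≠ 0 := by omega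
      rw [hj'] at hl
      simp [hl, ph, hj0, G, hj']
    have hgn1 : g (n + 1) = e (n - 1) + e (n - 2) := by
      rw [gs, hgn, map_sub, map_add, map_smul, hS0, hSn _ (by omega) (by omega) hl2,
        hSn _ (by omega) (by omega) hl3, hpn, show n - 2 + 1 = n - 1 by omega, show n - 3 + 1 = n - 2 by omega]
      module
    have hSnc : (S ^ n) (e 1) = 0 := by
      have := hrec (n - 2)
      rw [show n - 2 + 3 = n + 1 by omega, show n - 2 + 1 = n - 1 by omega, show n - 2 + 2 = n by omega] at this
      rw [← this, hgn1, hg (n - 1) (by omega) le_rfl, hg (n - 2) (by omega) (by omega),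
        show n - 1 - 1 = n - 2 by omega, show n - 2 - 1 = n - 3 by omega]
      simp [hl2, hl3]
    refine ⟨e 0, e 1, ee_ne 0 (by omega), hS0, hA0, hSnc, ?_⟩
    set U := Submodule.span ℂ (Set.range fun i : Fin n => (S ^ (i : ℕ)) (e 1)) with hU
    have hSU : ∀ i, (S ^ i) (e 1) ∈ U := by
      intro i
      by_cases hi : i < n
      · exact Submodule.subset_span ⟨⟨i, hi⟩, rfl⟩
      · have : (S ^ i) (e 1) = 0 := by
          rw [show i = (i - n) + n by omega, pow_add, Module.End.mul_apply, hSnc, map_zero]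
        rw [this]; exact U.zero_mem
    have hgU : ∀ j, g j ∈ U ∧ g (j + 1) ∈ U ∧ g (j + 2) ∈ U := by
      intro j
      induction j with
      | zero =>
        refine ⟨by rw [g0]; exact U.zero_mem, by show g 1 ∈ U; rw [g1]; simpa using hSU 0, by show g 2 ∈ U; rw [g2]; simpa using hSU 1⟩
      | succ j ih =>
        refine ⟨ih.2.1, ih.2.2, ?_⟩
        have : g (j + 3) = (S ^ (j + 2)) (e 1) + g (j + 1) + g j := by rw [← hrec j]; abel
        show g (j + 3) ∈ U
        rw [this]
        exact U.add_mem (U.add_mem (hSU _) ih.2.1) ih.1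
    have he0 : e 0 ∈ U := by
      have hx : g n - g (n - 2) - g (n - 3) ∈ U := U.sub_mem (U.sub_mem (hgU _).1 (hgU _).1) (hgU _).1
      have : ∃ a : ℂ, a ≠ 0 ∧ g n - g (n - 2) - g (n - 3) = a • e 0 := by
        rw [hgn, hg (n - 2) (by omega) (by omega), hg (n - 3) (by omega) (by omega),
          show n - 2 - 1 = n - 3 by omega]
        by_cases hy : n - 3 - 1 ∈ Y
        · refine ⟨-(pad (n - 2)), ?_, ?_⟩
          · have := pad_pos (n - 4)
            rw [show n - 4 + 2 = n - 2 by omega] at this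
            simp; omega
          · simp only [hl3, hy, if_true, if_false, hpn]; module
        · refine ⟨-(pad n), ?_, ?_⟩
          · have := pad_pos (n - 2)
            rw [show n - 2 + 2 = n by omega] at this
            simp; omega
          · simp only [hl3, hy, if_false]; module
      obtain ⟨a, ha, hae⟩ := this
      rw [hae] at hx
      exact (U.smul_mem_iff ha).1 hx
    apply ee_span
    intro i hi
    rcases Nat.eq_zero_or_pos i with rfl | hi0
    · exact he0
    · have h := hg i hi0 (by omega)
      have : ee n i = g i + (if i - 1 ∈ Y then (pad i : ℂ) else 0) • e 0 := by rw [h]; simp [e]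
      rw [this]
      exact U.add_mem (hgU i).1 (U.smul_mem _ he0)

end pair
end KP

namespace KP
set_option linter.unusedSectionVars false
open Module

section pair2
variable {n : ℕ}

lemma shift_chain (k : ℕ) (m : ℕ → ℕ) (hm : ∀ a, 1 ≤ m a) (M : ℕ → ℕ) (hM0 : M 0 = 0) (hM : ∀ a, M (a + 1) = M a + m a)
    (hMk : M k = n) :
    IsChain (shiftE n ((Finset.range k).image fun a => M (a + 1) - 1)) (fun a : Fin k => m a) (fun a : Fin k => ee n (M a)) ∧
    ∀ a : Fin k, ((shiftE n ((Finset.range k).image fun a => M (a + 1) - 1)) ^ (m a)) (ee n (M a)) = 0 := by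
  classical
  set Y := (Finset.range k).image fun a => M (a + 1) - 1 with hY
  have hmono : StrictMono M := strictMono_nat_of_lt_succ fun a => by rw [hM]; have := hm a; omega
  have hsum : ∀ k, ∑ a ∈ Finset.range k, m a = M k := by
    intro k
    induction k with
    | zero => simp [hM0]
    | succ k ih => rw [Finset.sum_range_succ, ih, hM]
  have hA : ∀ j < n, shiftE n Y (ee n j) = if j ∈ Y then 0 else ee n (j + 1) := fun j hj => mkE_ee _ j hj
  have hle : ∀ a < k, M (a + 1) ≤ n := fun a ha => by rw [← hMk]; exact hmono.monotone (by omega)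
  have hpow : ∀ a < k, ∀ i < m a, ((shiftE n Y) ^ i) (ee n (M a)) = ee n (M a + i) := by
    intro a ha i
    induction i with
    | zero => intro _; simp
    | succ i ih =>
      intro hi
      have h1 := hle a ha
      have h2 := hM a
      rw [pow_succ', Module.End.mul_apply, ih (by omega), hA _ (by omega), if_neg]
      · rfl
      · intro h
        obtain ⟨b, hb, hbe⟩ := Finset.mem_image.1 h
        have hb1 : M b < M (b + 1) := hmono (by omega)
        have hbe' : M (b + 1) = M a + i + 1 := by omega
        have h3 : M a < M (b + 1) := by omega
        have h4 : M (b + 1) < M (a + 1) := by omega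
        have := hmono.lt_iff_lt.1 h3
        have := hmono.lt_iff_lt.1 h4
        omega
  refine ⟨⟨?_, ?_⟩, ?_⟩
  · rw [Fin.sum_univ_eq_sum_range (fun a => m a) k, hsum, hMk]; simp
  · apply ee_span
    intro i hi
    have hcov : ∀ k, i < M k → ∃ a < k, M a ≤ i ∧ i < M (a + 1) := by
      intro k
      induction k with
      | zero => intro h; omega
      | succ k ih =>
        intro h
        by_cases h' : i < M k
        · obtain ⟨a, ha, h1⟩ := ih h'; exact ⟨a, by omega, h1⟩
        · exact ⟨k, by omega, by omega, h⟩
    obtain ⟨a, ha, h1, h2⟩ := hcov k (by omega)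
    rw [hM] at h2
    have := mem_sp (shiftE n Y) (fun a : Fin k => m a) (fun a : Fin k => ee n (M a)) ⟨a, ha⟩ (i - M a) (by show _ < m a; omega)
    rw [show ((shiftE n Y) ^ (i - M a)) (ee n (M (⟨a, ha⟩ : Fin k))) = ee n i by
      have := hpow a ha (i - M a) (by omega)
      rw [this]; congr 1; omega] at this
    exact this
  · intro a
    obtain ⟨j, hj⟩ : ∃ j, m a = j + 1 := ⟨m a - 1, by have := hm a; omega⟩
    rw [hj, pow_succ', Module.End.mul_apply, hpow a a.2 j (by omega)]
    have h1 := hle a a.2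
    have h2 := hM a
    rw [hA _ (by omega), if_pos]
    exact Finset.mem_image.2 ⟨a, by simp, by omega⟩

lemma pair_case1 {W : Type*} [AddCommGroup W] [Module ℂ W] [FiniteDimensional ℂ W] (hW : finrank ℂ W = n)
    (Ba Bb : End ℂ W) (k rb : ℕ) (hk : 1 ≤ k) (hkn : 2 * k + 2 ≤ n) (ha : ∀ c, n ≤ rg Ba c + k) (hb : ∀ c, rb ≤ rg Bb c)
    (hkr : k + 1 ≤ rb) : ∃ A T : End ℂ (Fin n → ℂ), Lim A Ba ∧ Lim T Bb ∧ Good A T := by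
  classical
  obtain ⟨q, r, hqr, hr, hq⟩ : ∃ q r, n = k * q + r ∧ r < k ∧ 2 ≤ q :=
    ⟨n / k, n % k, (Nat.div_add_mod n k).symm, Nat.mod_lt _ hk, (Nat.le_div_iff_mul_le hk).2 (by omega)⟩
  have hq2 : q = 2 → 2 ≤ r := by rintro rfl; omega
  let m : ℕ → ℕ := fun a => q + ((if a < r - 1 then 1 else 0) + (if a + 1 = k ∧ 1 ≤ r then 1 else 0))
  let M : ℕ → ℕ := fun a => ∑ b ∈ Finset.range a, m b
  have hM : ∀ a, M (a + 1) = M a + m a := fun a => Finset.sum_range_succ _ _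
  have hMk : M k = n := by
    simp only [M, m, Finset.sum_add_distrib, Finset.sum_const, Finset.card_range, smul_eq_mul]
    rw [← Finset.card_filter, ← Finset.card_filter]
    have e1 : (Finset.range k).filter (fun a => a < r - 1) = Finset.range (r - 1) := by
      ext a; simp; omega
    rw [e1, Finset.card_range]
    by_cases h : 1 ≤ r
    · have e2 : (Finset.range k).filter (fun a => a + 1 = k ∧ 1 ≤ r) = {k - 1} := by
        ext a; simp; omega
      rw [e2, Finset.card_singleton]; omega
    · have e2 : (Finset.range k).filter (fun a => a + 1 = k ∧ 1 ≤ r) = ∅ := by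
        ext a; simp; omega
      rw [e2, Finset.card_empty]; omega
  have hm2 : ∀ a, 2 ≤ m a := fun a => by simp only [m]; omega
  have hm0 : 3 ≤ m 0 := by
    simp only [m]
    by_cases h : q = 2
    · have := hq2 h
      have : 0 < r - 1 := by omega
      rw [if_pos this]; omega
    · omega
  have hml : 3 ≤ m (k - 1) := by
    simp only [m]
    by_cases h : q = 2
    · have := hq2 h
      have h' : k - 1 + 1 = k ∧ 1 ≤ r := by omega
      rw [if_pos h']; omega
    · omega
  have hmb : ∀ a b, m a ≤ m b + 1 := by
    intro a b
    simp only [m]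
    split_ifs <;> omega
  obtain ⟨hch, hz⟩ := shift_chain (n := n) k m (fun a => by have := hm2 a; omega) M (by simp [M]) hM hMk
  set Y := (Finset.range k).image fun a => M (a + 1) - 1 with hY
  have hmono : StrictMono M := strictMono_nat_of_lt_succ fun a => by rw [hM]; have := hm2 a; omega
  have hM1 : M 1 = m 0 := by simp [M]
  have hMk1 : M (k - 1) + m (k - 1) = n := by rw [← hM, ← hMk]; congr 1; omega
  have hge : ∀ a, 3 ≤ M (a + 1) := fun a => by
    have : M 1 ≤ M (a + 1) := hmono.monotone (by omega)
    omega
  have hle : ∀ a, a + 1 < k → M (a + 1) + 3 ≤ n := fun a h => by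
    have : M (a + 1) ≤ M (k - 1) := hmono.monotone (by omega)
    omega
  have hlast : ∀ a, a < k → M (a + 1) = n ∨ M (a + 1) + 3 ≤ n := fun a h => by
    by_cases h' : a + 1 < k
    · right; exact hle a h'
    · left; rw [← hMk]; congr 1; omega
  have hYmem : ∀ y, y ∈ Y → ∃ a < k, M (a + 1) = y + 1 := by
    intro y hy
    obtain ⟨a, ha, h⟩ := Finset.mem_image.1 hy
    exact ⟨a, by simpa using ha, by have := hge a; omega⟩
  obtain ⟨T, hT2, hTr, hG⟩ := good_case1 (n := n) (by omega) Y
    (fun h => by obtain ⟨a, _, h⟩ := hYmem _ h; have := hge a; omega)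
    (fun h => by obtain ⟨a, _, h⟩ := hYmem _ h; have := hge a; omega)
    (Finset.mem_image.2 ⟨k - 1, by simp; omega, by rw [show k - 1 + 1 = k by omega, hMk]⟩)
    (fun h => by obtain ⟨a, ha, h⟩ := hYmem _ h; have := hlast a ha; omega)
    (fun h => by obtain ⟨a, ha, h⟩ := hYmem _ h; have := hlast a ha; omega)
    (fun y hy hy' => by
      obtain ⟨a, ha, h⟩ := hYmem _ hy
      obtain ⟨b, hb, h'⟩ := hYmem _ hy'
      have h1 : a + 1 < b + 1 := hmono.lt_iff_lt.1 (by omega)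
      have h2 : M (a + 1 + 1) ≤ M (b + 1) := hmono.monotone (by omega)
      have := hM (a + 1)
      have := hm2 (a + 1)
      omega)
  have hYc : Y.card ≤ k := (Finset.card_image_le).trans (by simp)
  obtain ⟨v, hv⟩ := chain_balanced Ba k (by rw [hW]; exact ha) (fun a : Fin k => m a)
    (by rw [Fin.sum_univ_eq_sum_range (fun a => m a) k, hW]; exact hMk) (fun a b => hmb a b)
  refine ⟨_, T, lim_of_chain hch hv hz, lim_sqzero (by rw [hW]; simp) hT2 (fun c => ?_), hG⟩
  exact hTr.trans (by have := hb c; omega)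

lemma pair_case2 {W : Type*} [AddCommGroup W] [Module ℂ W] [FiniteDimensional ℂ W] (hW : finrank ℂ W = n)
    (Ba Bb : End ℂ W) (k : ℕ) (hk : 1 ≤ k) (hkn : 2 * k + 1 = n) (ha : ∀ c, n ≤ rg Ba c + k) (hb : ∀ c, n ≤ rg Bb c + k) :
    ∃ A T : End ℂ (Fin n → ℂ), Lim A Ba ∧ Lim T Bb ∧ Good A T := by
  classical
  let e := ee n
  let m : Fin k → ℕ := fun a => if (a : ℕ) = k - 1 then 3 else 2
  have hsum : ∑ a, m a = n := by
    have : ∀ a : Fin k, m a = 2 + if (a : ℕ) = k - 1 then 1 else 0 := fun a => by simp only [m]; split_ifs <;> rfl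
    simp only [this, Finset.sum_add_distrib, Finset.sum_const, Finset.card_univ, Fintype.card_fin, smul_eq_mul]
    rw [Finset.sum_eq_single (⟨k - 1, by omega⟩ : Fin k)]
    · simp; omega
    · intro b _ hb
      rw [if_neg]
      intro h; exact hb (Fin.ext h)
    · simp
  have hmb : ∀ a b, m a ≤ m b + 1 := by
    intro a b; simp only [m]; split_ifs <;> omega
  let A : End ℂ (Fin n → ℂ) := mkE n fun j => if j = n - 1 then 0 else if j = n - 2 then e (n - 1)
    else if j % 2 = 0 then e (j + 1) else 0
  let T : End ℂ (Fin n → ℂ) := mkE n fun j => if j = n - 1 then e 0 else if j = n - 2 then - e (n - 1)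
    else if j % 2 = 0 then 0 else e (j + 1)
  have hA : ∀ j < n, A (e j) = if j = n - 1 then 0 else if j = n - 2 then e (n - 1)
    else if j % 2 = 0 then e (j + 1) else 0 := fun j hj => mkE_ee _ j hj
  have hT : ∀ j < n, T (e j) = if j = n - 1 then e 0 else if j = n - 2 then - e (n - 1)
    else if j % 2 = 0 then 0 else e (j + 1) := fun j hj => mkE_ee _ j hj
  have hA1 : A (e (n - 1)) = 0 := by rw [hA _ (by omega), if_pos rfl]
  have hA2 : A (e (n - 2)) = e (n - 1) := by rw [hA _ (by omega), if_neg (by omega), if_pos rfl]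
  have hA3 : A (e (n - 3)) = e (n - 2) := by
    rw [hA _ (by omega), if_neg (by omega), if_neg (by omega), if_pos (by omega)]; congr 1; omega
  have hAe : ∀ a, a + 1 < k → A (e (2 * a)) = e (2 * a + 1) := fun a h => by
    rw [hA _ (by omega), if_neg (by omega), if_neg (by omega), if_pos (by omega)]
  have hAo : ∀ a, a + 1 < k → A (e (2 * a + 1)) = 0 := fun a h => by
    rw [hA _ (by omega), if_neg (by omega), if_neg (by omega), if_neg (by omega)]
  have hT1 : T (e (n - 1)) = e 0 := by rw [hT _ (by omega), if_pos rfl]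
  have hT2 : T (e (n - 2)) = - e (n - 1) := by rw [hT _ (by omega), if_neg (by omega), if_pos rfl]
  have hTe : ∀ a, a < k → T (e (2 * a)) = 0 := fun a h => by
    rw [hT _ (by omega), if_neg (by omega), if_neg (by omega), if_pos (by omega)]
  have hTo : ∀ a, a + 1 < k → T (e (2 * a + 1)) = e (2 * a + 2) := fun a h => by
    rw [hT _ (by omega), if_neg (by omega), if_neg (by omega), if_neg (by omega)]
  -- general chain lemma input
  have hchA : IsChain A m (fun a => e (2 * a)) := by
    refine ⟨by rw [hsum]; simp, ee_span _ fun i hi => ?_⟩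
    by_cases h : i < 2 * (k - 1)
    · have hm : m ⟨i / 2, by omega⟩ = 2 := if_neg (by show ¬ (i / 2 = k - 1); omega)
      rcases Nat.mod_two_eq_zero_or_one i with h2 | h2
      · have := mem_sp A m (fun a => e (2 * a)) ⟨i / 2, by omega⟩ 0 (by omega)
        rw [pow_zero, Module.End.one_apply] at this
        have e1 : 2 * (i / 2) = i := by omega
        simpa [e1, e] using this
      · have := mem_sp A m (fun a => e (2 * a)) ⟨i / 2, by omega⟩ 1 (by omega)
        rw [pow_one] at this
        simp only [hAe (i / 2) (by omega)] at this
        have e1 : 2 * (i / 2) + 1 = i := by omega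
        simpa [e1, e] using this
    · have hm : m ⟨k - 1, by omega⟩ = 3 := if_pos rfl
      have h0 := mem_sp A m (fun a => e (2 * a)) ⟨k - 1, by omega⟩ 0 (by omega)
      have h1 := mem_sp A m (fun a => e (2 * a)) ⟨k - 1, by omega⟩ 1 (by omega)
      have h2 := mem_sp A m (fun a => e (2 * a)) ⟨k - 1, by omega⟩ 2 (by omega)
      have e1 : 2 * (k - 1) = n - 3 := by omega
      simp only [pow_zero, Module.End.one_apply, pow_one, pow_two, Module.End.mul_apply, e1, hA3, hA2] at h0 h1 h2
      have : i = n - 3 ∨ i = n - 2 ∨ i = n - 1 := by omega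
      rcases this with rfl | rfl | rfl <;> assumption
  have hzA : ∀ a : Fin k, (A ^ m a) (e (2 * a)) = 0 := by
    intro a
    by_cases h : (a : ℕ) = k - 1
    · have hm : m a = 3 := if_pos h
      have e1 : 2 * (a : ℕ) = n - 3 := by omega
      rw [hm, e1, pow_succ', pow_two, Module.End.mul_apply, Module.End.mul_apply, hA3, hA2, hA1]
    · have hm : m a = 2 := if_neg h
      have := a.2
      rw [hm, pow_two, Module.End.mul_apply, hAe _ (by omega), hAo _ (by omega)]
  have hchT : IsChain T m (fun a => e (2 * a + 1)) := by
    refine ⟨by rw [hsum]; simp, ee_span _ fun i hi => ?_⟩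
    by_cases h : 1 ≤ i ∧ i ≤ 2 * (k - 1)
    · have hm : m ⟨(i - 1) / 2, by omega⟩ = 2 := if_neg (by show ¬ ((i - 1) / 2 = k - 1); omega)
      rcases Nat.mod_two_eq_zero_or_one i with h2 | h2
      · have := mem_sp T m (fun a => e (2 * a + 1)) ⟨(i - 1) / 2, by omega⟩ 1 (by omega)
        rw [pow_one] at this
        simp only [hTo ((i - 1) / 2) (by omega)] at this
        have e1 : 2 * ((i - 1) / 2) + 2 = i := by omega
        simpa [e1, e] using this
      · have := mem_sp T m (fun a => e (2 * a + 1)) ⟨(i - 1) / 2, by omega⟩ 0 (by omega)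
        rw [pow_zero, Module.End.one_apply] at this
        have e1 : 2 * ((i - 1) / 2) + 1 = i := by omega
        simpa [e1, e] using this
    · have hm : m ⟨k - 1, by omega⟩ = 3 := if_pos rfl
      have h0 := mem_sp T m (fun a => e (2 * a + 1)) ⟨k - 1, by omega⟩ 0 (by omega)
      have h1 := mem_sp T m (fun a => e (2 * a + 1)) ⟨k - 1, by omega⟩ 1 (by omega)
      have h2 := mem_sp T m (fun a => e (2 * a + 1)) ⟨k - 1, by omega⟩ 2 (by omega)
      have e1 : 2 * (k - 1) + 1 = n - 2 := by omega
      simp only [pow_zero, Module.End.one_apply, pow_one, pow_two, Module.End.mul_apply, e1, hT2, map_neg, hT1] at h0 h1 h2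
      rw [Submodule.neg_mem_iff] at h1 h2
      have : i = n - 2 ∨ i = n - 1 ∨ i = 0 := by omega
      rcases this with rfl | rfl | rfl <;> assumption
  have hzT : ∀ a : Fin k, (T ^ m a) (e (2 * a + 1)) = 0 := by
    intro a
    by_cases h : (a : ℕ) = k - 1
    · have hm : m a = 3 := if_pos h
      have e1 : 2 * (a : ℕ) + 1 = n - 2 := by omega
      have := hTe 0 (by omega)
      rw [hm, e1, pow_succ', pow_two, Module.End.mul_apply, Module.End.mul_apply, hT2, map_neg, map_neg, hT1]
      simpa using this
    · have hm : m a = 2 := if_neg h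
      have := a.2
      have := hTe (a + 1) (by omega)
      rw [hm, pow_two, Module.End.mul_apply, hTo _ (by omega)]
      exact this
  obtain ⟨v, hv⟩ := chain_balanced Ba k (by rw [hW]; exact ha) m (by rw [hsum, hW]) hmb
  obtain ⟨v', hv'⟩ := chain_balanced Bb k (by rw [hW]; exact hb) m (by rw [hsum, hW]) hmb
  have hS : ∀ j, j + 2 < n → (A + T) (e j) = e (j + 1) := by
    intro j hj
    rw [LinearMap.add_apply, hA _ (by omega), hT _ (by omega)]
    simp only [show ¬ j = n - 1 by omega, show ¬ j = n - 2 by omega, if_false]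
    split_ifs <;> simp
  have hS2 : (A + T) (e (n - 2)) = 0 := by rw [LinearMap.add_apply, hA2, hT2, add_neg_cancel]
  have hS1 : (A + T) (e (n - 1)) = e 0 := by rw [LinearMap.add_apply, hA1, hT1, zero_add]
  have hp : ∀ j, j + 2 ≤ n → ((A + T) ^ (j + 1)) (e (n - 1)) = e j := by
    intro j
    induction j with
    | zero => intro _; rw [zero_add, pow_one, hS1]
    | succ j ih => intro h; rw [pow_succ', Module.End.mul_apply, ih (by omega), hS j (by omega)]
  refine ⟨A, T, lim_of_chain hchA hv hzA, lim_of_chain hchT hv' hzT, e (n - 2), e (n - 1), ee_ne _ (by omega), hS2, hA2, ?_, ?_⟩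
  · have := hp (n - 2) (by omega)
    have h2 : (A + T) ^ n = (A + T) * (A + T) ^ (n - 2 + 1) := by rw [← pow_succ']; congr 1; omega
    rw [h2, Module.End.mul_apply, this, hS2]
  · apply ee_span
    intro i hi
    by_cases h : i = n - 1
    · exact Submodule.subset_span ⟨⟨0, by omega⟩, by simp [h, e]⟩
    · exact Submodule.subset_span ⟨⟨i + 1, by omega⟩, hp i (by omega)⟩

lemma pair_exists {W : Type*} [AddCommGroup W] [Module ℂ W] [FiniteDimensional ℂ W] (hW : finrank ℂ W = n)
    (Ba Bb : End ℂ W) (ra rb : ℕ) (ha : ∀ c, ra ≤ rg Ba c) (hb : ∀ c, rb ≤ rg Bb c) (ha' : ra < n) (hb' : rb < n)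
    (h : n + 1 ≤ ra + rb) : ∃ A T : End ℂ (Fin n → ℂ), Lim A Ba ∧ Lim T Bb ∧ Good A T := by
  have hac : ∀ c, n ≤ rg Ba c + (n - ra) := fun c => by have := ha c; omega
  have hbc : ∀ c, n ≤ rg Bb c + (n - rb) := fun c => by have := hb c; omega
  by_cases h1 : 2 * (n - ra) + 2 ≤ n
  · exact pair_case1 hW Ba Bb (n - ra) rb (by omega) h1 hac hb (by omega)
  · by_cases h2 : 2 * (n - rb) + 2 ≤ n
    · obtain ⟨A, T, h3, h4, h5⟩ := pair_case1 hW Bb Ba (n - rb) ra (by omega) h2 hbc ha (by omega)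
      exact ⟨T, A, h4, h3, h5.symm⟩
    · have : n - ra = n - rb := by omega
      exact pair_case2 hW Ba Bb (n - ra) (by omega) (by omega) hac (by rw [this]; exact hbc)

end pair2
end KP

namespace KP
set_option linter.unusedSectionVars false
open Module

section T1
open Filter Topology

lemma sum_two {J M : Type*} [Fintype J] [DecidableEq J] [AddCommMonoid M] {i j : J} (h : i ≠ j) (f : J → M) :
    ∑ l, f l = f i + f j + ∑ l ∈ Finset.univ.filter (fun l => l ≠ i ∧ l ≠ j), f l := by
  have h1 : (Finset.univ : Finset J) = {i, j} ∪ Finset.univ.filter (fun l => l ≠ i ∧ l ≠ j) := by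
    ext l; simp; tauto
  conv_lhs => rw [h1]
  rw [Finset.sum_union, Finset.sum_pair h]
  rw [Finset.disjoint_left]
  intro a ha; simp at ha ⊢; tauto

lemma Lim.neg {V W : Type*} [NormedAddCommGroup V] [NormedSpace ℂ V] [FiniteDimensional ℂ V]
    [AddCommGroup W] [Module ℂ W] [FiniteDimensional ℂ W] {A : End ℂ V} {B : End ℂ W} (h : Lim A B) : Lim (-A) (-B) := by
  obtain ⟨F, h1, h2⟩ := h
  refine ⟨fun t => - F t, fun v => ?_, fun t ht => ?_⟩
  · simpa using (h1 v).neg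
  · simpa using (h2 t ht).neg

variable {n : ℕ}

/-- solution of the additive problem -/
def Sol {V W : Type*} [AddCommGroup V] [Module ℂ V] [AddCommGroup W] [Module ℂ W] {J : Type*} [Fintype J]
    (B : J → End ℂ V) (M : End ℂ W) : Prop :=
  ∃ A : J → End ℂ V, (∀ j, Sim (A j) (B j)) ∧ Sim (∑ j, A j) M ∧ Irr A

lemma sol_of_limits {J : Type*} [Fintype J] (hn : 1 ≤ n) (B : J → End ℂ (Fin n → ℂ)) (M : End ℂ (Fin n → ℂ))
    (hM : ∀ c, n ≤ rg M c + 1) (htr : LinearMap.trace ℂ _ M = ∑ j, LinearMap.trace ℂ _ (B j))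
    (A0 : J → End ℂ (Fin n → ℂ)) (hL : ∀ j, Lim (A0 j) (B j)) (hirr : Irr A0)
    (c : Fin n → ℂ) (hc : ((∑ j, A0 j) ^ n) c = 0)
    (hs : Submodule.span ℂ (Set.range fun i : Fin n => ((∑ j, A0 j) ^ (i : ℕ)) c) = ⊤) : Sol B M := by
  classical
  have : Nonempty (Fin n) := ⟨⟨0, hn⟩⟩
  set S := ∑ j, A0 j with hS
  have hLS : Lim S M := by
    obtain ⟨v, hv⟩ := chain_balanced M 1 (by simpa using hM) (fun _ => n) (by simp) (fun _ _ => by omega)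
    have hch : IsChain S (fun _ : Fin 1 => n) (fun _ => c) := by
      refine ⟨by simp, ?_⟩
      rw [eq_top_iff, ← hs, Submodule.span_le]
      rintro _ ⟨i, rfl⟩
      exact mem_sp S (fun _ : Fin 1 => n) (fun _ => c) 0 i i.2
    exact lim_of_chain hch hv (fun _ => hc)
  let A1 : Option J → End ℂ (Fin n → ℂ) := fun o => o.elim (-S) A0
  let B1 : Option J → End ℂ (Fin n → ℂ) := fun o => o.elim (-M) B
  obtain ⟨A, hA, hA0, hAi⟩ := limit_sol A1 B1
    (by rintro (_ | j); exacts [hLS.neg, hL j])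
    (by rw [Fintype.sum_option]; show -S + ∑ j, A0 j = 0; rw [← hS]; simp)
    (by rw [Fintype.sum_option]; show LinearMap.trace ℂ _ (-M) + ∑ j, LinearMap.trace ℂ _ (B j) = 0; rw [map_neg, htr]; simp)
    (fun W hW => hirr W fun i => hW (some i))
  rw [Fintype.sum_option] at hA0
  have hsum : ∑ j, A (some j) = - A none := (neg_eq_of_add_eq_zero_right hA0).symm
  refine ⟨fun j => A (some j), fun j => hA (some j), ?_, ?_⟩
  · rw [hsum]
    have := (hA none).neg
    simpa [B1] using this
  · intro W hW
    refine hAi W ?_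
    rintro (_ | j)
    · intro v hv
      have : A none v = - (∑ j, A (some j)) v := by rw [hsum]; simp
      rw [this, LinearMap.sum_apply]
      exact W.neg_mem (W.sum_mem fun j _ => hW j v hv)
    · exact hW j

lemma sol_of_pair {J : Type*} [Fintype J] (hn : 1 ≤ n) (B : J → End ℂ (Fin n → ℂ)) (M : End ℂ (Fin n → ℂ))
    (hM : ∀ c, n ≤ rg M c + 1) (htr : LinearMap.trace ℂ _ M = ∑ j, LinearMap.trace ℂ _ (B j))
    (a b : J) (hab : a ≠ b) (ra rb : ℕ) (ha : ∀ c, ra ≤ rg (B a) c) (hb : ∀ c, rb ≤ rg (B b) c) (ha' : ra < n) (hb' : rb < n)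
    (h : n + 1 ≤ ra + rb) : Sol B M := by
  classical
  obtain ⟨A, T, hA, hT, hG⟩ := pair_exists (by simp) (B a) (B b) ra rb ha hb ha' hb' h
  let A0 : J → End ℂ (Fin n → ℂ) := fun j => if j = a then A else if j = b then T else 0
  have hAa : A0 a = A := if_pos rfl
  have hAb : A0 b = T := by simp [A0, hab.symm]
  have hsum : ∑ j, A0 j = A + T := by
    rw [sum_two hab, hAa, hAb, Finset.sum_eq_zero, add_zero]
    intro l hl; simp at hl; simp [A0, hl.1, hl.2]
  have hirr : Irr A0 := by
    intro W hW
    refine hG.irr W ?_ ?_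
    · have := hW a; rwa [hAa] at this
    · have := hW b; rwa [hAb] at this
  obtain ⟨u, c, -, -, -, h3, h4⟩ := hG
  refine sol_of_limits hn B M hM htr A0 ?_ hirr c (by rw [hsum]; exact h3) (by rw [hsum]; exact h4)
  intro j
  by_cases h1 : j = a
  · subst h1; rw [hAa]; exact hA
  · by_cases h2 : j = b
    · subst h2; rw [hAb]; exact hT
    · simp only [A0, h1, h2, if_false]; exact Lim.zero _ rfl

lemma rg_lt (hn : 1 ≤ n) (f : End ℂ (Fin n → ℂ)) : ∃ c, rg f c < n := by
  have : Nonempty (Fin n) := ⟨⟨0, hn⟩⟩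
  obtain ⟨c, hc⟩ := Module.End.exists_eigenvalue f
  refine ⟨c, ?_⟩
  have h1 := LinearMap.finrank_range_add_finrank_ker (f - c • (1 : End ℂ (Fin n → ℂ)))
  have h2 : 0 < finrank ℂ (LinearMap.ker (f - c • (1 : End ℂ (Fin n → ℂ)))) := by
    rw [Module.finrank_pos_iff, Submodule.nontrivial_iff_ne_bot]
    have := hc
    rw [Module.End.hasEigenvalue_iff, Module.End.eigenspace_def] at this
    exact this
  simp at h1
  unfold rg; omega

lemma rg_open {α : Type*} {l : Filter α} (F : α → End ℂ (Fin n → ℂ)) (E : End ℂ (Fin n → ℂ))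
    (hF : ∀ v, Tendsto (fun t => F t v) l (𝓝 (E v))) (ρ : ℕ) (hρ : ρ ≤ n) (hE : ∀ c, ρ ≤ rg E c) :
    ∀ᶠ t in l, ∀ c, ρ ≤ rg (F t) c := by
  have hT := tendsto_clm F E hF
  set V := Fin n → ℂ
  let E' : V →L[ℂ] V := LinearMap.toContinuousLinearMap E
  have hO : IsOpen {f : V →L[ℂ] V | (ρ : Cardinal) ≤ (f : V →ₗ[ℂ] V).rank} := isOpen_setOfPred_nat_le_rank ρ
  have hrk : ∀ f : V →ₗ[ℂ] V, (ρ : Cardinal) ≤ f.rank ↔ ρ ≤ finrank ℂ (LinearMap.range f) := by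
    intro f
    rw [LinearMap.rank, ← Module.finrank_eq_rank]; norm_cast
  have hev : ∀ᶠ f in 𝓝 E', ∀ c ∈ Metric.closedBall (0 : ℂ) (‖E'‖ + 1), (ρ : Cardinal) ≤ ((f - c • (1 : V →L[ℂ] V) : V →L[ℂ] V) : V →ₗ[ℂ] V).rank := by
    apply IsCompact.eventually_forall_of_forall_eventually (isCompact_closedBall _ _)
    intro c _
    have hcont : Continuous fun z : (V →L[ℂ] V) × ℂ => z.1 - z.2 • (1 : V →L[ℂ] V) := by fun_prop
    refine (hO.preimage hcont).mem_nhds ?_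
    show (ρ : Cardinal) ≤ _
    rw [hrk]
    exact hE c
  have hev2 : ∀ᶠ f in 𝓝 E', ‖f‖ < ‖E'‖ + 1 :=
    (continuous_norm.tendsto E').eventually (gt_mem_nhds (by linarith))
  filter_upwards [hT.eventually hev, hT.eventually hev2] with t h1 h2 c
  by_cases hc : c ∈ Metric.closedBall (0 : ℂ) (‖E'‖ + 1)
  · have := h1 c hc
    rw [hrk] at this
    exact this
  · have hc' : ‖E'‖ + 1 < ‖c‖ := by simpa using hc
    have hnot : ¬ (F t).HasEigenvalue c := by
      intro he
      obtain ⟨x, hx⟩ := he.exists_hasEigenvector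
      have h3 := hx.apply_eq_smul
      have h4 := (LinearMap.toContinuousLinearMap (F t)).le_opNorm x
      rw [LinearMap.coe_toContinuousLinearMap', h3, norm_smul] at h4
      have h5 : 0 < ‖x‖ := norm_pos_iff.2 hx.2
      have := le_of_mul_le_mul_right h4 h5
      linarith
    unfold rg
    rw [range_eq_top_of_not_eig _ _ hnot]
    simpa using hρ

end T1
end KP

namespace KP
set_option linter.unusedSectionVars false
open Module

section T1b
open Filter Topology
variable {n : ℕ}

/-- the merged pair exists -/
lemma merge_exists (hn : 3 ≤ n) (Bi Bj : End ℂ (Fin n → ℂ)) (ri rj : ℕ) (hi : ∀ c, ri ≤ rg Bi c) (hj : ∀ c, rj ≤ rg Bj c)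
    (hji : rj ≤ ri) (h2 : 2 * ri ≤ n) : ∃ X Y : End ℂ (Fin n → ℂ), Sim X Bi ∧ Sim Y Bj ∧
      ∀ c, min (n - 1) (ri + rj) ≤ rg (X + Y) c := by
  classical
  let rj' := min rj ((n - 1) / 2)
  let e := ee n
  let Ti : End ℂ (Fin n → ℂ) := mkE n fun l => if l % 2 = 0 ∧ l / 2 < ri then e (l + 1) else 0
  let Tj : End ℂ (Fin n → ℂ) := mkE n fun l => if l % 2 = 1 ∧ l / 2 < rj' then e (l + 1) else 0
  have hTi : ∀ l < n, Ti (e l) = if l % 2 = 0 ∧ l / 2 < ri then e (l + 1) else 0 := fun l hl => mkE_ee _ l hl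
  have hTj : ∀ l < n, Tj (e l) = if l % 2 = 1 ∧ l / 2 < rj' then e (l + 1) else 0 := fun l hl => mkE_ee _ l hl
  have hout : ∀ l, n ≤ l → e l = 0 := fun l hl => ee_out l hl
  have hTi2 : Ti * Ti = 0 := by
    apply end_ext
    intro l hl
    rw [Module.End.mul_apply, hTi l hl]
    split_ifs with h
    · by_cases hl' : l + 1 < n
      · rw [hTi _ hl', if_neg (by omega)]; rfl
      · rw [hout _ (by omega), map_zero]; rfl
    · rw [map_zero]; rfl
  have hTj2 : Tj * Tj = 0 := by
    apply end_ext
    intro l hl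
    rw [Module.End.mul_apply, hTj l hl]
    split_ifs with h
    · by_cases hl' : l + 1 < n
      · rw [hTj _ hl', if_neg (by omega)]; rfl
      · rw [hout _ (by omega), map_zero]; rfl
    · rw [map_zero]; rfl
  have rank_le : ∀ (g : ℕ → (Fin n → ℂ)) (r : ℕ) (w : ℕ → (Fin n → ℂ)), (∀ l, g l = 0 ∨ ∃ a < r, g l = w a) →
      finrank ℂ (LinearMap.range (mkE n g)) ≤ r := by
    intro g r w hg
    have hle : LinearMap.range (mkE n g) ≤ Submodule.span ℂ (((Finset.range r).image w : Finset (Fin n → ℂ)) : Set (Fin n → ℂ)) := by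
      rintro _ ⟨x, rfl⟩
      show (∑ i : Fin n, x i • g i) ∈ _
      refine Submodule.sum_mem _ fun i _ => Submodule.smul_mem _ _ ?_
      rcases hg i with h | ⟨a, ha, h⟩
      · rw [h]; exact Submodule.zero_mem _
      · rw [h]; exact Submodule.subset_span (by simpa using ⟨a, ha, rfl⟩)
    calc _ ≤ _ := Submodule.finrank_mono hle
      _ ≤ ((Finset.range r).image w).card := finrank_span_finset_le_card _
      _ ≤ (Finset.range r).card := Finset.card_image_le
      _ = r := by simp
  have hLi : Lim Ti Bi := by
    refine lim_sqzero rfl (fun x => congrFun (congrArg DFunLike.coe hTi2) x) (fun c => le_trans ?_ (hi c))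
    refine rank_le _ ri (fun a => e (2 * a + 1)) fun l => ?_
    split_ifs with h
    · right; exact ⟨l / 2, h.2, by congr 1; omega⟩
    · left; rfl
  have hLj : Lim Tj Bj := by
    refine lim_sqzero rfl (fun x => congrFun (congrArg DFunLike.coe hTj2) x) (fun c => le_trans ?_ (hj c))
    refine (rank_le _ rj' (fun a => e (2 * a + 2)) fun l => ?_).trans (min_le_left _ _)
    split_ifs with h
    · right; exact ⟨l / 2, h.2, by congr 1; omega⟩
    · left; rfl
  obtain ⟨Fi, hFi, hFi'⟩ := hLi
  obtain ⟨Fj, hFj, hFj'⟩ := hLj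
  have hE : ∀ c, ri + rj' ≤ rg (Ti + Tj) c := by
    intro c
    let s : Finset ℕ := (Finset.range ri).image (fun a => 2 * a + 1) ∪ (Finset.range rj').image (fun a => 2 * a + 2)
    have hs : s.card = ri + rj' := by
      rw [Finset.card_union_of_disjoint, Finset.card_image_of_injective, Finset.card_image_of_injective]
      · simp
      · intro a b h; simp at h; omega
      · intro a b h; simp at h; omega
      · rw [Finset.disjoint_left]
        intro a ha hb
        simp at ha hb
        omega
    have hsn : s ⊆ Finset.range n := by
      intro a ha
      simp [s] at ha ⊢
      omega
    let g : Finset ℕ := Finset.range n \ s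
    have hg : g.card = n - (ri + rj') := by rw [Finset.card_sdiff_of_subset hsn, hs, Finset.card_range]
    have htop : LinearMap.range (Ti + Tj - c • (1 : End ℂ (Fin n → ℂ))) ⊔
        Submodule.span ℂ ((g.image e : Finset (Fin n → ℂ)) : Set (Fin n → ℂ)) = ⊤ := by
      apply ee_span
      intro l
      induction l with
      | zero =>
        intro h
        refine Submodule.mem_sup_right (Submodule.subset_span ?_)
        rw [Finset.mem_coe]
        exact Finset.mem_image.2 ⟨0, by simp [g, s, h], rfl⟩
      | succ l ih =>
        intro h
        by_cases hl : l + 1 ∈ s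
        · have h1 : (Ti + Tj) (e l) = e (l + 1) := by
            rw [LinearMap.add_apply, hTi l (by omega), hTj l (by omega)]
            rcases Finset.mem_union.1 hl with h' | h'
            · obtain ⟨a, ha, h'⟩ := Finset.mem_image.1 h'
              simp at ha
              rw [if_pos (by omega), if_neg (by omega), add_zero]
            · obtain ⟨a, ha, h'⟩ := Finset.mem_image.1 h'
              rw [Finset.mem_range] at ha
              rw [if_neg (by omega), if_pos (by omega), zero_add]
          have h2 : ee n (l + 1) = (Ti + Tj - c • (1 : End ℂ (Fin n → ℂ))) (e l) + c • e l := by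
            rw [LinearMap.sub_apply, h1]; simp [e]
          rw [h2]
          exact Submodule.add_mem _ (Submodule.mem_sup_left ⟨_, rfl⟩) (Submodule.smul_mem _ _ (ih (by omega)))
        · refine Submodule.mem_sup_right (Submodule.subset_span ?_)
          rw [Finset.mem_coe]
          exact Finset.mem_image.2 ⟨l + 1, by simp [g, h, hl], rfl⟩
    have h1 := Submodule.finrank_add_le_finrank_add_finrank (LinearMap.range (Ti + Tj - c • (1 : End ℂ (Fin n → ℂ))))
      (Submodule.span ℂ ((g.image e : Finset (Fin n → ℂ)) : Set (Fin n → ℂ)))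
    rw [htop, finrank_top] at h1
    have h2 : finrank ℂ (Submodule.span ℂ ((g.image e : Finset (Fin n → ℂ)) : Set (Fin n → ℂ))) ≤ g.card :=
      (finrank_span_finset_le_card _).trans Finset.card_image_le
    simp at h1 h2
    have h3 : s.card ≤ n := by simpa using Finset.card_le_card hsn
    unfold rg
    omega
  have hev := rg_open (l := 𝓝[≠] (0 : ℂ)) (fun t => Fi t + Fj t) (Ti + Tj) (fun v => (hFi v).add (hFj v)) (ri + rj')
    (by have : rj' ≤ (n - 1) / 2 := min_le_right _ _; omega) hE
  obtain ⟨t, ht, ht0⟩ := (hev.and eventually_mem_nhdsWithin).exists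
  have ht0 : t ≠ 0 := ht0
  refine ⟨t⁻¹ • Fi t, t⁻¹ • Fj t, ?_, ?_, ?_⟩
  · have := (hFi' t ht0).smul t⁻¹
    rwa [smul_smul, inv_mul_cancel₀ ht0, one_smul] at this
  · have := (hFj' t ht0).smul t⁻¹
    rwa [smul_smul, inv_mul_cancel₀ ht0, one_smul] at this
  · intro c
    have h1 : min (n - 1) (ri + rj) ≤ ri + rj' := by
      have : rj' = min rj ((n - 1) / 2) := rfl
      omega
    refine h1.trans ((ht (t * c)).trans (le_of_eq ?_))
    unfold rg
    have : t⁻¹ • Fi t + t⁻¹ • Fj t - c • (1 : End ℂ (Fin n → ℂ)) = t⁻¹ • (Fi t + Fj t - (t * c) • (1 : End ℂ (Fin n → ℂ))) := by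
      rw [smul_sub, smul_add, smul_smul, ← mul_assoc, inv_mul_cancel₀ ht0, one_mul]
    rw [this, LinearMap.range_smul _ _ (inv_ne_zero ht0)]

lemma sim_zero_eq {V W : Type*} [AddCommGroup V] [Module ℂ V] [AddCommGroup W] [Module ℂ W] {f : End ℂ V}
    (h : Sim f (0 : End ℂ W)) : f = 0 := by
  obtain ⟨e, he⟩ := h
  ext v
  have := he v
  simpa using this

lemma T1_two {J : Type*} [Fintype J] (B : J → End ℂ (Fin 2 → ℂ)) (M : End ℂ (Fin 2 → ℂ))
    (hM : ∀ c, 2 ≤ rg M c + 1) (htr : LinearMap.trace ℂ _ M = ∑ j, LinearMap.trace ℂ _ (B j))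
    (a b d : J) (hab : a ≠ b) (had : a ≠ d) (hbd : b ≠ d) (ha : ∀ c, 1 ≤ rg (B a) c) (hb : ∀ c, 1 ≤ rg (B b) c)
    (hd : ∀ c, 1 ≤ rg (B d) c) : Sol B M := by
  classical
  let e := ee 2
  let P : End ℂ (Fin 2 → ℂ) := mkE 2 fun l => if l = 0 then 0 else e 0
  let Q : End ℂ (Fin 2 → ℂ) := mkE 2 fun l => if l = 0 then e 1 else 0
  have hP0 : P (e 0) = 0 := by rw [show P (e 0) = _ from mkE_ee _ 0 (by omega)]; rfl
  have hP1 : P (e 1) = e 0 := by rw [show P (e 1) = _ from mkE_ee _ 1 (by omega)]; rfl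
  have hQ0 : Q (e 0) = e 1 := by rw [show Q (e 0) = _ from mkE_ee _ 0 (by omega)]; rfl
  have hQ1 : Q (e 1) = 0 := by rw [show Q (e 1) = _ from mkE_ee _ 1 (by omega)]; rfl
  have ext2 : ∀ f g : End ℂ (Fin 2 → ℂ), f (e 0) = g (e 0) → f (e 1) = g (e 1) → f = g := by
    intro f g h0 h1
    apply end_ext
    intro i hi
    have : i = 0 ∨ i = 1 := by omega
    rcases this with rfl | rfl
    · exact h0
    · exact h1
  have hPP : P * P = 0 := ext2 _ _ (by simp [hP0]) (by simp [hP1, hP0])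
  have hQQ : Q * Q = 0 := ext2 _ _ (by simp [hQ0, hQ1]) (by simp [hQ1])
  have hrk : ∀ f : End ℂ (Fin 2 → ℂ), f * f = 0 → finrank ℂ (LinearMap.range f) ≤ 1 := by
    intro f hf
    have h1 := LinearMap.finrank_range_add_finrank_ker f
    have h2 : LinearMap.range f ≤ LinearMap.ker f := by
      rintro _ ⟨x, rfl⟩
      exact congrFun (congrArg DFunLike.coe hf) x
    have h3 := Submodule.finrank_mono h2
    simp at h1
    omega
  have hL : ∀ (f B : End ℂ (Fin 2 → ℂ)), f * f = 0 → (∀ c, 1 ≤ rg B c) → Lim f B := by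
    intro f B hf hB
    exact lim_sqzero rfl (fun x => congrFun (congrArg DFunLike.coe hf) x) (fun c => (hrk f hf).trans (hB c))
  let A0 : J → End ℂ (Fin 2 → ℂ) := fun j => if j = a then P else if j = b then -P else if j = d then Q else 0
  have hAa : A0 a = P := if_pos rfl
  have hAb : A0 b = -P := by simp [A0, hab.symm]
  have hAd : A0 d = Q := by simp [A0, had.symm, hbd.symm]
  have hsum : ∑ j, A0 j = Q := by
    rw [sum_two hab, hAa, hAb, add_neg_cancel, zero_add, Finset.sum_eq_single d, hAd]
    · intro l hl hld; simp at hl; simp [A0, hl.1, hl.2, hld]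
    · intro h; simp [had.symm, hbd.symm] at h
  have hG : Good (Q + P) (-P) := by
    refine ⟨e 1, e 0, ee_ne 1 (by omega), ?_, ?_, ?_, ?_⟩
    · simp [hQ1]
    · simp [hP1, hQ1]
    · rw [add_neg_cancel_right, pow_two, hQQ]; rfl
    · rw [add_neg_cancel_right]
      apply ee_span
      intro i hi
      have : i = 0 ∨ i = 1 := by omega
      rcases this with rfl | rfl
      · exact Submodule.subset_span ⟨0, rfl⟩
      · exact Submodule.subset_span ⟨1, by simpa using hQ0⟩
  have hirr : Irr A0 := by
    intro W hW
    have h1 := hW a; rw [hAa] at h1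
    have h2 := hW d; rw [hAd] at h2
    exact hG.irr W (fun v hv => W.add_mem (h2 v hv) (h1 v hv)) (fun v hv => W.neg_mem (h1 v hv))
  obtain ⟨u, c, -, -, -, h3, h4⟩ := hG
  rw [add_neg_cancel_right] at h3 h4
  refine sol_of_limits (by omega) B M hM htr A0 ?_ hirr c (by rw [hsum]; exact h3) (by rw [hsum]; exact h4)
  intro j
  by_cases h1 : j = a
  · subst h1; rw [hAa]; exact hL _ _ hPP ha
  · by_cases h2 : j = b
    · subst h2; rw [hAb]; exact hL _ _ ((neg_mul_neg P P).trans hPP) hb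
    · by_cases h3 : j = d
      · subst h3; rw [hAd]; exact hL _ _ hQQ hd
      · simp only [A0, h1, h2, h3, if_false]; exact Lim.zero _ rfl

end T1b
end KP

namespace KP
set_option linter.unusedSectionVars false
open Module

section T1c
variable {n : ℕ}

lemma sol_of_merge {J : Type*} [Fintype J] [DecidableEq J] (B : J → End ℂ (Fin n → ℂ)) (M : End ℂ (Fin n → ℂ))
    (i j : J) (hij : i ≠ j) (X Y : End ℂ (Fin n → ℂ)) (hX : Sim X (B i)) (hY : Sim Y (B j))
    (h : Sol (Function.update (Function.update B i (X + Y)) j 0) M) : Sol B M := by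
  obtain ⟨A, hA, hAs, hAi⟩ := h
  have hj := hA j
  rw [Function.update_self] at hj
  have hj0 := sim_zero_eq hj
  have hi := hA i
  rw [Function.update_of_ne hij, Function.update_self] at hi
  obtain ⟨e, he⟩ := hi
  let X' := e.symm.conj X
  let Y' := e.symm.conj Y
  have hX' : Sim X' X := ⟨e, fun v => by simp [X', LinearEquiv.conj_apply]⟩
  have hY' : Sim Y' Y := ⟨e, fun v => by simp [Y', LinearEquiv.conj_apply]⟩
  have hAi' : A i = X' + Y' := by
    apply LinearMap.ext; intro v
    apply e.injective
    rw [he]; simp [X', Y', LinearEquiv.conj_apply]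
  let A' := Function.update (Function.update A i X') j Y'
  have hA'j : A' j = Y' := Function.update_self _ _ _
  have hA'i : A' i = X' := by simp [A', Function.update_of_ne hij]
  have hA'l : ∀ l, l ≠ i → l ≠ j → A' l = A l := fun l h1 h2 => by simp [A', h1, h2]
  refine ⟨A', ?_, ?_, ?_⟩
  · intro l
    by_cases h2 : l = j
    · subst h2; rw [hA'j]; exact hY'.trans hY
    · by_cases h1 : l = i
      · subst h1; rw [hA'i]; exact hX'.trans hX
      · rw [hA'l l h1 h2]
        have := hA l
        rwa [Function.update_of_ne h2, Function.update_of_ne h1] at this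
  · have : ∑ l, A' l = ∑ l, A l := by
      rw [sum_two hij, sum_two hij A, hA'i, hA'j, hj0, hAi', add_zero]
      congr 1
      apply Finset.sum_congr rfl
      intro l hl
      simp at hl
      exact hA'l l hl.1 hl.2
    rw [this]; exact hAs
  · intro W hW
    apply hAi W
    intro l v hv
    by_cases h2 : l = j
    · subst h2; rw [hj0]; simp
    · by_cases h1 : l = i
      · subst h1; rw [hAi']
        have h3 := hW l v hv
        have h4 := hW j v hv
        rw [hA'i] at h3; rw [hA'j] at h4
        exact W.add_mem h3 h4
      · rw [← hA'l l h1 h2]; exact hW l v hv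

lemma T1_aux {J : Type*} [Fintype J] (hn : 2 ≤ n) (M : End ℂ (Fin n → ℂ)) (hM : ∀ c, n ≤ rg M c + 1) :
    ∀ (N : ℕ) (B : J → End ℂ (Fin n → ℂ)) (r : J → ℕ), (Finset.univ.filter fun j => r j ≠ 0).card ≤ N →
      LinearMap.trace ℂ _ M = ∑ j, LinearMap.trace ℂ _ (B j) → (∀ j c, r j ≤ rg (B j) c) → n + 1 ≤ ∑ j, r j → Sol B M := by
  classical
  intro N
  induction N with
  | zero =>
    intro B r hc _ _ hs
    have : ∀ j, r j = 0 := by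
      intro j
      by_contra h
      have := Finset.card_eq_zero.1 (Nat.le_zero.1 hc)
      have hj : j ∈ (Finset.univ.filter fun j => r j ≠ 0) := by simp [h]
      rw [this] at hj; simp at hj
    simp [this] at hs
  | succ N ih =>
    intro B r hc htr hr hs
    have hlt : ∀ j, r j < n := fun j => by
      obtain ⟨c, hc⟩ := rg_lt (by omega) (B j)
      exact (hr j c).trans_lt hc
    by_cases hpair : ∃ a b, a ≠ b ∧ n + 1 ≤ r a + r b
    · obtain ⟨a, b, hab, h⟩ := hpair
      exact sol_of_pair (by omega) B M hM htr a b hab (r a) (r b) (hr a) (hr b) (hlt a) (hlt b) h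
    push Not at hpair
    have hne : Nonempty J := by
      by_contra h
      rw [not_nonempty_iff] at h
      simp at hs
    obtain ⟨a, ha⟩ := Finite.exists_max r
    obtain ⟨i, hia, hi0⟩ : ∃ i, i ≠ a ∧ r i ≠ 0 := by
      by_contra h
      push Not at h
      rw [Finset.sum_eq_single a (fun b _ hb => h b hb) (by simp)] at hs
      have := hlt a; omega
    obtain ⟨j, hja, hji, hj0⟩ : ∃ j, j ≠ a ∧ j ≠ i ∧ r j ≠ 0 := by
      by_contra h
      push Not at h
      rw [sum_two hia.symm, Finset.sum_eq_zero] at hs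
      · have := hpair a i hia.symm; omega
      · intro l hl; simp at hl; exact h l hl.1 hl.2
    -- wlog r j ≤ r i
    obtain ⟨i, j, hia, hja, hij, hi0, hj0, hle⟩ : ∃ i j, i ≠ a ∧ j ≠ a ∧ i ≠ j ∧ r i ≠ 0 ∧ r j ≠ 0 ∧ r j ≤ r i := by
      rcases le_total (r j) (r i) with h | h
      · exact ⟨i, j, hia, hja, hji.symm, hi0, hj0, h⟩
      · exact ⟨j, i, hja, hia, hji, hj0, hi0, h⟩
    rcases Nat.lt_or_ge n 3 with hn3 | hn3
    · obtain rfl : n = 2 := by omega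
      have := ha i
      exact T1_two B M hM htr a i j hia.symm hja.symm hij (fun c => le_trans (by omega) (hr a c))
        (fun c => le_trans (by omega) (hr i c)) (fun c => le_trans (by omega) (hr j c))
    have h2i : 2 * r i ≤ n := by
      have := hpair a i hia.symm
      have := ha i
      omega
    obtain ⟨X, Y, hX, hY, hXY⟩ := merge_exists hn3 (B i) (B j) (r i) (r j) (hr i) (hr j) hle h2i
    apply sol_of_merge B M i j hij X Y hX hY
    set B' := Function.update (Function.update B i (X + Y)) j 0 with hB'
    set r' := Function.update (Function.update r i (min (n - 1) (r i + r j))) j 0 with hr'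
    have hB'j : B' j = 0 := Function.update_self _ _ _
    have hB'i : B' i = X + Y := by simp [B', Function.update_of_ne hij]
    have hB'l : ∀ l, l ≠ i → l ≠ j → B' l = B l := fun l h1 h2 => by simp [B', h1, h2]
    have hr'j : r' j = 0 := Function.update_self _ _ _
    have hr'i : r' i = min (n - 1) (r i + r j) := by simp [r', Function.update_of_ne hij]
    have hr'l : ∀ l, l ≠ i → l ≠ j → r' l = r l := fun l h1 h2 => by simp [r', h1, h2]
    refine ih B' r' ?_ ?_ ?_ ?_
    · have : (Finset.univ.filter fun j => r' j ≠ 0) ⊂ (Finset.univ.filter fun j => r j ≠ 0) := by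
        rw [Finset.ssubset_iff_of_subset]
        · exact ⟨j, by simp [hj0], by simp [hr'j]⟩
        · intro l hl
          simp at hl ⊢
          by_cases h2 : l = j
          · subst h2; exact absurd hr'j hl
          · by_cases h1 : l = i
            · subst h1; exact hi0
            · rwa [hr'l l h1 h2] at hl
      have := Finset.card_lt_card this
      omega
    · rw [htr, sum_two hij, sum_two hij (fun j => LinearMap.trace ℂ _ (B' j)), hB'i, hB'j, map_add, hX.trace, hY.trace, map_zero, add_zero]
      congr 1
      apply Finset.sum_congr rfl
      intro l hl
      simp at hl
      rw [hB'l l hl.1 hl.2]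
    · intro l c
      by_cases h2 : l = j
      · subst h2; rw [hr'j]; omega
      · by_cases h1 : l = i
        · subst h1; rw [hr'i, hB'i]; exact hXY c
        · rw [hr'l l h1 h2, hB'l l h1 h2]; exact hr l c
    · rw [sum_two hij, hr'i, hr'j]
      rw [sum_two hij] at hs
      have e1 : ∑ l ∈ Finset.univ.filter (fun l => l ≠ i ∧ l ≠ j), r' l = ∑ l ∈ Finset.univ.filter (fun l => l ≠ i ∧ l ≠ j), r l := by
        apply Finset.sum_congr rfl
        intro l hl
        simp at hl
        rw [hr'l l hl.1 hl.2]
      rw [e1]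
      have h3 : r a ≤ ∑ l ∈ Finset.univ.filter (fun l => l ≠ i ∧ l ≠ j), r l :=
        Finset.single_le_sum (f := r) (fun _ _ => Nat.zero_le _) (by simp [hia.symm, hja.symm])
      have := ha i
      omega

theorem T1 {J : Type*} [Fintype J] (hn : 2 ≤ n) (M : End ℂ (Fin n → ℂ)) (hM : ∀ c, n ≤ rg M c + 1)
    (B : J → End ℂ (Fin n → ℂ)) (r : J → ℕ) (htr : LinearMap.trace ℂ _ M = ∑ j, LinearMap.trace ℂ _ (B j))
    (hr : ∀ j c, r j ≤ rg (B j) c) (hs : n + 1 ≤ ∑ j, r j) : Sol B M :=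
  T1_aux hn M hM _ B r le_rfl htr hr hs

end T1c
end KP

namespace KP
set_option linter.unusedSectionVars false
open Module

section factor
variable {V U V' U' : Type*} [AddCommGroup V] [Module ℂ V] [FiniteDimensional ℂ V]
  [AddCommGroup U] [Module ℂ U] [FiniteDimensional ℂ U]
  [AddCommGroup V'] [Module ℂ V'] [FiniteDimensional ℂ V']
  [AddCommGroup U'] [Module ℂ U'] [FiniteDimensional ℂ U']

/-- complement of `ker Y ∩ im X` in `ker Y` -/
lemma exists_K0 (X : U →ₗ[ℂ] V) (Y : V →ₗ[ℂ] U) (hX : Function.Injective X) (hY : Function.Surjective Y) :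
    ∃ K : Submodule ℂ V, K ≤ LinearMap.ker Y ∧ (∀ u, X u ∈ K → u = 0) ∧
      (∀ v, Y v = 0 → ∃ u, ∃ k ∈ K, v = X u + k) ∧
      finrank ℂ K + finrank ℂ (LinearMap.ker (Y ∘ₗ X)) + finrank ℂ U = finrank ℂ V := by
  obtain ⟨q, hq⟩ := Submodule.exists_isCompl (LinearMap.ker Y ⊓ LinearMap.range X)
  have hsup : (LinearMap.ker Y ⊓ LinearMap.range X) ⊔ (q ⊓ LinearMap.ker Y) = LinearMap.ker Y := by
    rw [← sup_inf_assoc_of_le _ inf_le_left, hq.sup_eq_top, top_inf_eq]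
  have hinf : (LinearMap.ker Y ⊓ LinearMap.range X) ⊓ (q ⊓ LinearMap.ker Y) = ⊥ := by
    rw [← inf_assoc, hq.inf_eq_bot, bot_inf_eq]
  refine ⟨q ⊓ LinearMap.ker Y, inf_le_right, ?_, ?_, ?_⟩
  · intro u hu
    have : X u ∈ (LinearMap.ker Y ⊓ LinearMap.range X) ⊓ (q ⊓ LinearMap.ker Y) := ⟨⟨hu.2, ⟨u, rfl⟩⟩, hu⟩
    rw [hinf] at this
    exact (map_eq_zero_iff X hX).1 this
  · intro v hv
    have : v ∈ (LinearMap.ker Y ⊓ LinearMap.range X) ⊔ (q ⊓ LinearMap.ker Y) := by rw [hsup]; exact hv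
    obtain ⟨y, ⟨_, ⟨u, rfl⟩⟩, z, hz, rfl⟩ := Submodule.mem_sup.1 this
    exact ⟨u, z, hz, rfl⟩
  · have h1 := Submodule.finrank_sup_add_finrank_inf_eq (LinearMap.ker Y ⊓ LinearMap.range X) (q ⊓ LinearMap.ker Y)
    rw [hsup, hinf, finrank_bot] at h1
    have h2 := LinearMap.finrank_range_add_finrank_ker Y
    rw [LinearMap.range_eq_top.2 hY, finrank_top] at h2
    have h3 : (LinearMap.ker (Y ∘ₗ X)).map X = LinearMap.ker Y ⊓ LinearMap.range X := by
      rw [LinearMap.ker_comp, Submodule.map_comap_eq, inf_comm]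
    have h4 : finrank ℂ (LinearMap.ker (Y ∘ₗ X)) = finrank ℂ ↥(LinearMap.ker Y ⊓ LinearMap.range X) := by
      rw [← h3]; exact (LinearEquiv.finrank_eq (Submodule.equivMapOfInjective X hX _))
    omega

lemma lemQ (X : U →ₗ[ℂ] V) (Y : V →ₗ[ℂ] U) (hX : Function.Injective X) (hY : Function.Surjective Y)
    (X' : U' →ₗ[ℂ] V') (Y' : V' →ₗ[ℂ] U') (hX' : Function.Injective X') (hY' : Function.Surjective Y')
    (hd : finrank ℂ V = finrank ℂ V') (hC : Sim (Y ∘ₗ X : End ℂ U) (Y' ∘ₗ X' : End ℂ U')) :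
    Sim (X ∘ₗ Y : End ℂ V) (X' ∘ₗ Y' : End ℂ V') := by
  have hU := hC.finrank
  have hrC := hC.finrank_range
  obtain ⟨φ, hφ⟩ := hC
  obtain ⟨K, hK, hKX, hKd, hKf⟩ := exists_K0 X Y hX hY
  obtain ⟨K', hK', hKX', hKd', hKf'⟩ := exists_K0 X' Y' hX' hY'
  have h1 := LinearMap.finrank_range_add_finrank_ker (Y ∘ₗ X)
  have h2 := LinearMap.finrank_range_add_finrank_ker (Y' ∘ₗ X')
  have hKK : finrank ℂ K = finrank ℂ K' := by omega
  let ψ : K ≃ₗ[ℂ] K' := LinearEquiv.ofFinrankEq _ _ hKK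
  let β : U × K →ₗ[ℂ] V := X.coprod K.subtype
  have hβ : LinearMap.ker β = ⊥ := by
    rw [LinearMap.ker_eq_bot']
    rintro ⟨u, k⟩ h
    have h : X u + k = 0 := by simpa [β] using h
    have hu : u = 0 := hKX u (by rw [eq_neg_of_add_eq_zero_left h]; exact K.neg_mem k.2)
    subst hu
    have hk : (k : V) = 0 := by simpa using h
    ext <;> simp [hk]
  obtain ⟨θ, hθ⟩ := LinearMap.exists_leftInverse_of_injective β hβ
  have hθ' : ∀ u (k : K), θ (X u + k) = (u, k) := fun u k => by
    have := congrFun (congrArg DFunLike.coe hθ) (u, k)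
    simpa [β] using this
  obtain ⟨s, hs⟩ := LinearMap.exists_rightInverse_of_surjective Y' (LinearMap.range_eq_top.2 hY')
  have hs' : ∀ u, Y' (s u) = u := fun u => congrFun (congrArg DFunLike.coe hs) u
  let π : V →ₗ[ℂ] U := LinearMap.fst ℂ U K ∘ₗ θ
  let ρ : V →ₗ[ℂ] K := LinearMap.snd ℂ U K ∘ₗ θ
  have hπ : ∀ u (k : K), π (X u + k) = u := fun u k => by simp [π, hθ']
  have hρ : ∀ u (k : K), ρ (X u + k) = k := fun u k => by simp [ρ, hθ']
  have hπX : ∀ u, π (X u) = u := fun u => by simpa using hπ u 0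
  have hρX : ∀ u, ρ (X u) = 0 := fun u => by simpa using hρ u 0
  let e : V →ₗ[ℂ] V' := X' ∘ₗ φ.toLinearMap ∘ₗ π + s ∘ₗ φ.toLinearMap ∘ₗ Y ∘ₗ (LinearMap.id - X ∘ₗ π)
    + K'.subtype ∘ₗ ψ.toLinearMap ∘ₗ ρ
  have he : ∀ v, e v = X' (φ (π v)) + s (φ (Y (v - X (π v)))) + (ψ (ρ v) : V') := fun v => rfl
  have heX : ∀ u, e (X u) = X' (φ u) := fun u => by rw [he, hπX, hρX]; simp
  have hYe : ∀ v, Y' (e v) = φ (Y v) := fun v => by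
    rw [he, map_add, map_add, hs', show Y' (ψ (ρ v) : V') = 0 from hK' (ψ (ρ v)).2]
    have := hφ (π v)
    simp only [LinearMap.comp_apply] at this
    rw [← this, map_sub, map_sub]; simp
  have hinj : Function.Injective e := by
    rw [injective_iff_map_eq_zero]
    intro v hv
    have h3 : Y v = 0 := by
      have := hYe v; rw [hv, map_zero] at this
      exact (map_eq_zero_iff φ φ.injective).1 this.symm
    obtain ⟨u, k, hk, rfl⟩ := hKd v h3
    have h4 := hπ u ⟨k, hk⟩
    have h5 := hρ u ⟨k, hk⟩
    simp only at h4 h5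
    rw [he, h4, h5, add_sub_cancel_left, show Y k = 0 from hK hk, map_zero, map_zero, add_zero] at hv
    have h6 : φ u = 0 := hKX' _ (by rw [eq_neg_of_add_eq_zero_left hv]; exact K'.neg_mem (ψ _).2)
    rw [h6, map_zero, zero_add] at hv
    have h7 : ψ ⟨k, hk⟩ = 0 := Subtype.ext hv
    have h8 : (⟨k, hk⟩ : K) = 0 := (map_eq_zero_iff ψ ψ.injective).1 h7
    have h9 : k = 0 := congrArg Subtype.val h8
    have h10 : u = 0 := (map_eq_zero_iff φ φ.injective).1 h6
    rw [h9, h10]; simp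
  refine ⟨LinearEquiv.ofInjectiveOfFinrankEq e hinj hd, fun v => ?_⟩
  show e (X (Y v)) = X' (Y' (e v))
  rw [heX, hYe]

lemma ker_factor_le (X : U →ₗ[ℂ] V) (Y : V →ₗ[ℂ] U) (c : ℂ) (hc : c ≠ 0) :
      finrank ℂ (LinearMap.ker ((X ∘ₗ Y : End ℂ V) - c • (1 : End ℂ V))) ≤
        finrank ℂ (LinearMap.ker ((Y ∘ₗ X : End ℂ U) - c • (1 : End ℂ U))) := by
  let g : LinearMap.ker ((X ∘ₗ Y : End ℂ V) - c • (1 : End ℂ V)) →ₗ[ℂ]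
        LinearMap.ker ((Y ∘ₗ X : End ℂ U) - c • (1 : End ℂ U)) :=
      Y.restrict (by
        intro v hv
        have hv : X (Y v) - c • v = 0 := hv
        show Y (X (Y v)) - c • Y v = 0
        rw [sub_eq_zero.1 hv]; simp)
  apply LinearMap.finrank_le_finrank_of_injective (f := g)
  rw [injective_iff_map_eq_zero]
  rintro ⟨v, hv⟩ h
  have h' : Y v = 0 := congrArg Subtype.val h
  have hv : X (Y v) - c • v = 0 := hv
  rw [h', map_zero, zero_sub, neg_eq_zero] at hv
  exact Subtype.ext ((smul_eq_zero.1 hv).resolve_left hc)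

lemma rg_factor (X : U →ₗ[ℂ] V) (Y : V →ₗ[ℂ] U) (c : ℂ) (hc : c ≠ 0) :
    rg (X ∘ₗ Y : End ℂ V) c + finrank ℂ U = finrank ℂ V + rg (Y ∘ₗ X : End ℂ U) c := by
  have h1 := LinearMap.finrank_range_add_finrank_ker ((X ∘ₗ Y : End ℂ V) - c • (1 : End ℂ V))
  have h2 := LinearMap.finrank_range_add_finrank_ker ((Y ∘ₗ X : End ℂ U) - c • (1 : End ℂ U))
  have h3 := ker_factor_le X Y c hc
  have h4 := ker_factor_le Y X c hc
  unfold rg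
  omega

/-- centralizer -/
def cent (f : End ℂ V) : Submodule ℂ (End ℂ V) where
  carrier := {Z | f * Z = Z * f}
  add_mem' := by
    intro a b ha hb
    simp only [Set.mem_setOf_eq] at *
    rw [mul_add, add_mul, ha, hb]
  zero_mem' := by simp
  smul_mem' := by
    intro c a ha
    simp only [Set.mem_setOf_eq] at *
    rw [mul_smul_comm, smul_mul_assoc, ha]

lemma mem_cent {f Z : End ℂ V} : Z ∈ cent f ↔ f * Z = Z * f := Iff.rfl

noncomputable def dZ (f : End ℂ V) : ℤ := (finrank ℂ V : ℤ) ^ 2 - finrank ℂ (cent f)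

lemma cent_sub (f : End ℂ V) (c : ℂ) : cent (f - c • (1 : End ℂ V)) = cent f := by
  ext Z
  rw [mem_cent, mem_cent, sub_mul, mul_sub]
  simp

lemma dZ_sub (f : End ℂ V) (c : ℂ) : dZ (f - c • (1 : End ℂ V)) = dZ f := by
  unfold dZ; rw [cent_sub]

lemma dZ_factor (X : U →ₗ[ℂ] V) (Y : V →ₗ[ℂ] U) (hX : Function.Injective X) (hY : Function.Surjective Y) :
    dZ (X ∘ₗ Y : End ℂ V) = 2 * finrank ℂ U * (finrank ℂ V - finrank ℂ U) + dZ (Y ∘ₗ X : End ℂ U) := by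
  obtain ⟨π, hπ⟩ := LinearMap.exists_leftInverse_of_injective X (LinearMap.ker_eq_bot.2 hX)
  obtain ⟨s, hs⟩ := LinearMap.exists_rightInverse_of_surjective Y (LinearMap.range_eq_top.2 hY)
  have hπ' : ∀ u, π (X u) = u := fun u => congrFun (congrArg DFunLike.coe hπ) u
  have hs' : ∀ u, Y (s u) = u := fun u => congrFun (congrArg DFunLike.coe hs) u
  -- elements of the centralizer
  have hc : ∀ Z : End ℂ V, Z ∈ cent (X ∘ₗ Y : End ℂ V) → ∀ v, X (Y (Z v)) = Z (X (Y v)) := fun Z hZ v =>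
    congrFun (congrArg DFunLike.coe (mem_cent.1 hZ)) v
  -- Z X u = X (π Z X u)
  have hZX : ∀ Z : End ℂ V, Z ∈ cent (X ∘ₗ Y : End ℂ V) → ∀ u, Z (X u) = X (π (Z (X u))) := fun Z hZ u => by
    have := hc Z hZ (s u)
    rw [hs'] at this
    rw [← this, hπ']
  have hYZ : ∀ Z : End ℂ V, Z ∈ cent (X ∘ₗ Y : End ℂ V) → ∀ v, Y (Z v) = π (Z (X (Y v))) := fun Z hZ v => by
    rw [← hc Z hZ, hπ']
  let Φ0 : End ℂ V →ₗ[ℂ] End ℂ U := (LinearMap.lcomp ℂ U X) ∘ₗ (LinearMap.compRight ℂ π)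
  have hΦ0 : ∀ Z u, Φ0 Z u = π (Z (X u)) := fun Z u => rfl
  let Φ : cent (X ∘ₗ Y : End ℂ V) →ₗ[ℂ] End ℂ U := Φ0 ∘ₗ (cent (X ∘ₗ Y : End ℂ V)).subtype
  have hΦ : ∀ Z u, Φ Z u = π ((Z : End ℂ V) (X u)) := fun Z u => rfl
  have hrange : LinearMap.range Φ = cent (Y ∘ₗ X : End ℂ U) := by
    ext Q
    constructor
    · rintro ⟨⟨Z, hZ⟩, rfl⟩
      rw [mem_cent]
      ext u
      show Y (X (Φ ⟨Z, hZ⟩ u)) = Φ ⟨Z, hZ⟩ (Y (X u))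
      rw [hΦ, hΦ, ← hZX Z hZ, hYZ Z hZ]
    · intro hQ
      have hQ' : ∀ u, Y (X (Q u)) = Q (Y (X u)) := fun u => congrFun (congrArg DFunLike.coe (mem_cent.1 hQ)) u
      let Z : End ℂ V := X ∘ₗ Q ∘ₗ π + s ∘ₗ Q ∘ₗ Y ∘ₗ (LinearMap.id - X ∘ₗ π)
      have hZ : ∀ v, Z v = X (Q (π v)) + s (Q (Y (v - X (π v)))) := fun v => rfl
      have hZX : ∀ u, Z (X u) = X (Q u) := fun u => by rw [hZ, hπ']; simp
      have hYZ : ∀ v, Y (Z v) = Q (Y v) := fun v => by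
        rw [hZ, map_add, hs', hQ', map_sub, map_sub]; simp
      refine ⟨⟨Z, ?_⟩, ?_⟩
      · rw [mem_cent]
        apply LinearMap.ext; intro v
        show X (Y (Z v)) = Z (X (Y v))
        rw [hYZ, hZX]
      · apply LinearMap.ext; intro u
        rw [hΦ]; show π (Z (X u)) = Q u
        rw [hZX, hπ']
  -- kernel
  let Ψ : ((V ⧸ LinearMap.range X) →ₗ[ℂ] LinearMap.ker Y) →ₗ[ℂ] End ℂ V :=
    (LinearMap.lcomp ℂ V (LinearMap.range X).mkQ) ∘ₗ (LinearMap.compRight ℂ (LinearMap.ker Y).subtype)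
  have hΨ : ∀ f v, Ψ f v = (f ((LinearMap.range X).mkQ v) : V) := fun f v => rfl
  have hΨinj : Function.Injective Ψ := by
    rw [injective_iff_map_eq_zero]
    intro f hf
    apply LinearMap.ext; intro x
    obtain ⟨v, rfl⟩ := Submodule.mkQ_surjective _ x
    apply Subtype.ext
    rw [← hΨ, hf]; rfl
  have hker : (LinearMap.ker Φ).map (cent (X ∘ₗ Y : End ℂ V)).subtype = LinearMap.range Ψ := by
    ext Z
    constructor
    · rintro ⟨⟨Z, hZ⟩, hk, rfl⟩
      have hk' : ∀ u, π (Z (X u)) = 0 := fun u => congrFun (congrArg DFunLike.coe (LinearMap.mem_ker.1 hk)) u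
      have h1 : ∀ u, Z (X u) = 0 := fun u => by rw [hZX Z hZ, hk', map_zero]
      have h2 : ∀ v, Y (Z v) = 0 := fun v => by rw [hYZ Z hZ, hk']
      refine ⟨(LinearMap.range X).liftQ (Z.codRestrict (LinearMap.ker Y) h2) ?_, ?_⟩
      · rintro _ ⟨u, rfl⟩
        exact Subtype.ext (h1 u)
      · apply LinearMap.ext; intro v
        rw [hΨ]; rfl
    · rintro ⟨f, rfl⟩
      have h1 : ∀ u, Ψ f (X u) = 0 := fun u => by
        rw [hΨ, show (LinearMap.range X).mkQ (X u) = 0 from (Submodule.Quotient.mk_eq_zero _).2 ⟨u, rfl⟩]; simp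
      have h2 : ∀ v, Y (Ψ f v) = 0 := fun v => (f ((LinearMap.range X).mkQ v)).2
      refine ⟨⟨Ψ f, ?_⟩, ?_, rfl⟩
      · rw [mem_cent]; apply LinearMap.ext; intro v
        show X (Y (Ψ f v)) = Ψ f (X (Y v))
        rw [h1, h2, map_zero]
      · apply LinearMap.mem_ker.2
        apply LinearMap.ext; intro u
        rw [hΦ]; show π (Ψ f (X u)) = 0
        rw [h1, map_zero]
  have f1 := LinearMap.finrank_range_add_finrank_ker Φ
  rw [hrange] at f1
  have f2 : finrank ℂ (LinearMap.ker Φ) = finrank ℂ (LinearMap.range Ψ) := by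
    rw [← hker]; exact LinearEquiv.finrank_eq (Submodule.equivMapOfInjective _ (Submodule.injective_subtype _) _)
  rw [LinearMap.finrank_range_of_inj hΨinj, Module.finrank_linearMap] at f2
  have f3 := Submodule.finrank_quotient_add_finrank (LinearMap.range X)
  rw [LinearMap.finrank_range_of_inj hX] at f3
  have f4 := LinearMap.finrank_range_add_finrank_ker Y
  rw [LinearMap.range_eq_top.2 hY, finrank_top] at f4
  unfold dZ
  rw [← f1, f2]
  have f3' : (finrank ℂ (V ⧸ LinearMap.range X) : ℤ) = finrank ℂ V - finrank ℂ U := by omega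
  have f4' : (finrank ℂ (LinearMap.ker Y) : ℤ) = finrank ℂ V - finrank ℂ U := by omega
  push_cast
  rw [f3', f4']; ring

end factor
end KP

namespace KP
set_option linter.unusedSectionVars false
open Module

section
variable {V U V' U' : Type*} [AddCommGroup V] [Module ℂ V] [FiniteDimensional ℂ V]
  [AddCommGroup U] [Module ℂ U] [FiniteDimensional ℂ U]
  [AddCommGroup V'] [Module ℂ V'] [FiniteDimensional ℂ V']
  [AddCommGroup U'] [Module ℂ U'] [FiniteDimensional ℂ U']

lemma exists_factor (V : Type*) [AddCommGroup V] [Module ℂ V] [FiniteDimensional ℂ V] (D : End ℂ U)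
    (h2 : 2 * finrank ℂ U ≤ finrank ℂ V + finrank ℂ (LinearMap.range D)) :
    ∃ (X : U →ₗ[ℂ] V) (Y : V →ₗ[ℂ] U), Function.Injective X ∧ Function.Surjective Y ∧ Y ∘ₗ X = D := by
  obtain ⟨q, hq⟩ := Submodule.exists_isCompl (LinearMap.range D)
  have h3 := Submodule.finrank_add_eq_of_isCompl hq
  let e : V ≃ₗ[ℂ] U × (q × (Fin (finrank ℂ V - finrank ℂ U - finrank ℂ q) → ℂ)) :=
    LinearEquiv.ofFinrankEq _ _ (by rw [finrank_prod, finrank_prod, finrank_fin_fun]; omega)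
  refine ⟨e.symm.toLinearMap ∘ₗ LinearMap.inl ℂ _ _,
    (D.coprod (q.subtype ∘ₗ LinearMap.fst ℂ _ _)) ∘ₗ e.toLinearMap, ?_, ?_, ?_⟩
  · exact e.symm.injective.comp LinearMap.inl_injective
  · intro u
    have : u ∈ LinearMap.range D ⊔ q := by rw [hq.sup_eq_top]; trivial
    obtain ⟨_, ⟨a, rfl⟩, z, hz, rfl⟩ := Submodule.mem_sup.1 this
    exact ⟨e.symm (a, (⟨z, hz⟩, 0)), by simp⟩
  · ext u; simp

lemma dZ_small (f : End ℂ V) (h : finrank ℂ V ≤ 1) : dZ f = 0 := by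
  obtain ⟨v, hv⟩ := finrank_le_one_iff.1 h
  have : cent f = ⊤ := by
    rw [eq_top_iff]
    intro Z _
    rw [mem_cent]
    obtain ⟨a, ha⟩ := hv (f v)
    obtain ⟨b, hb⟩ := hv (Z v)
    apply LinearMap.ext; intro w
    obtain ⟨c, rfl⟩ := hv w
    simp only [Module.End.mul_apply, map_smul, ← ha, ← hb]
    rw [smul_smul a, smul_smul b, mul_comm]
  unfold dZ
  rw [this, finrank_top, finrank_linearMap]; push_cast; ring

lemma dZ_low (f : End ℂ V) (c : ℂ) (h : rg f c ≤ 1) :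
    dZ f = 2 * rg f c * (finrank ℂ V - rg f c) := by
  have h1 := dZ_factor (LinearMap.range (f - c • (1 : End ℂ V))).subtype (f - c • (1 : End ℂ V)).rangeRestrict
    (Submodule.injective_subtype _) (LinearMap.surjective_rangeRestrict _)
  rw [LinearMap.subtype_comp_codRestrict _ _ (fun x => LinearMap.mem_range_self _ x), dZ_sub, dZ_small _ h] at h1
  rw [h1]; unfold rg; ring

lemma dZ_zero : dZ (0 : End ℂ V) = 0 := by
  have h : rg (0 : End ℂ V) 0 = 0 := by simp [rg]
  rw [dZ_low 0 0 (by omega), h]; simp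

lemma exists_eigbasis {n : ℕ} (f : End ℂ V) (μ : Fin n → ℂ) (hμ : Function.Injective μ) (hV : finrank ℂ V = n)
    (h : ∀ i, f.HasEigenvalue (μ i)) : ∃ b : Basis (Fin n) ℂ V, ∀ i, f (b i) = μ i • b i := by
  choose v hv using fun i => (h i).exists_hasEigenvector
  have hl := Module.End.eigenvectors_linearIndependent' f μ hμ v hv
  rcases Nat.eq_zero_or_pos n with rfl | hn
  · exact ⟨finBasisOfFinrankEq ℂ V hV, fun i => i.elim0⟩
  haveI : Nonempty (Fin n) := ⟨⟨0, hn⟩⟩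
  refine ⟨basisOfLinearIndependentOfCardEqFinrank hl (by simp [hV]), fun i => ?_⟩
  simp [(hv i).apply_eq_smul]

variable {n : ℕ} {f : End ℂ V} {μ : Fin n → ℂ}

lemma eig_range (b : Basis (Fin n) ℂ V) (hb : ∀ i, f (b i) = μ i • b i) (c : ℂ) (i : Fin n) (hi : μ i ≠ c) : b i ∈ LinearMap.range (f - c • (1 : End ℂ V)) := by
  refine ⟨(μ i - c)⁻¹ • b i, ?_⟩
  rw [map_smul, LinearMap.sub_apply, hb, LinearMap.smul_apply, Module.End.one_apply, ← sub_smul, smul_smul,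
    inv_mul_cancel₀ (sub_ne_zero.2 hi), one_smul]

lemma eig_top (b : Basis (Fin n) ℂ V) (hb : ∀ i, f (b i) = μ i • b i) (c : ℂ) (hc : ∀ i, μ i ≠ c) : LinearMap.range (f - c • (1 : End ℂ V)) = ⊤ := by
  rw [eq_top_iff, ← b.span_eq, Submodule.span_le]
  rintro _ ⟨i, rfl⟩
  exact eig_range b hb c i (hc i)

lemma eig_rg (b : Basis (Fin n) ℂ V) (hb : ∀ i, f (b i) = μ i • b i) (hμ : Function.Injective μ) (c : ℂ) : n ≤ rg f c + 1 := by
  have hV : finrank ℂ V = n := by rw [finrank_eq_card_basis b]; simp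
  by_cases hc : ∀ i, μ i ≠ c
  · have := eig_top b hb c hc
    unfold rg; rw [this, finrank_top]; omega
  · push Not at hc
    obtain ⟨i0, h0⟩ := hc
    have h1 : LinearMap.range (f - c • (1 : End ℂ V)) ⊔ Submodule.span ℂ {b i0} = ⊤ := by
      rw [eq_top_iff, ← b.span_eq, Submodule.span_le]
      rintro _ ⟨i, rfl⟩
      by_cases hi : i = i0
      · subst hi
        exact Submodule.mem_sup_right (Submodule.mem_span_singleton_self _)
      · exact Submodule.mem_sup_left (eig_range b hb c i (fun h => hi (hμ (h.trans h0.symm))))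
    have h2 := Submodule.finrank_add_le_finrank_add_finrank (LinearMap.range (f - c • (1 : End ℂ V))) (Submodule.span ℂ {b i0})
    rw [h1, finrank_top, hV] at h2
    have h3 := finrank_span_le_card (R := ℂ) ({b i0} : Set V)
    simp at h3
    unfold rg; omega

lemma eig_sim (b : Basis (Fin n) ℂ V) (hb : ∀ i, f (b i) = μ i • b i) {g : End ℂ V'} (b' : Basis (Fin n) ℂ V') (hb' : ∀ i, g (b' i) = μ i • b' i) : Sim f g := by
  refine ⟨b.equiv b' (Equiv.refl _), fun v => ?_⟩
  have : (b.equiv b' (Equiv.refl _)).toLinearMap ∘ₗ f = g ∘ₗ (b.equiv b' (Equiv.refl _)).toLinearMap := by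
    apply b.ext; intro i
    simp [hb, hb']
  exact congrFun (congrArg DFunLike.coe this) v

lemma eig_dZ (b : Basis (Fin n) ℂ V) (hb : ∀ i, f (b i) = μ i • b i) : dZ f ≤ (n : ℤ) ^ 2 - n := by
  have hV : finrank ℂ V = n := by rw [finrank_eq_card_basis b]; simp
  let F : (Fin n → ℂ) → cent f := fun a => ⟨b.constr ℂ (fun i => a i • b i), by
    rw [mem_cent]; apply b.ext; intro i
    simp [hb, smul_smul, mul_comm]⟩
  let L : (Fin n → ℂ) →ₗ[ℂ] cent f :=
    { toFun := F
      map_add' := fun x y => by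
        apply Subtype.ext; apply b.ext; intro i
        show b.constr ℂ (fun i => (x + y) i • b i) (b i) = b.constr ℂ (fun i => x i • b i) (b i) + b.constr ℂ (fun i => y i • b i) (b i)
        simp only [Basis.constr_basis, Pi.add_apply, add_smul]
      map_smul' := fun x y => by
        apply Subtype.ext; apply b.ext; intro i
        show b.constr ℂ (fun i => (x • y) i • b i) (b i) = x • b.constr ℂ (fun i => y i • b i) (b i)
        simp only [Basis.constr_basis, Pi.smul_apply, smul_assoc] }
  have hL : Function.Injective L := by
    rw [injective_iff_map_eq_zero]
    intro a ha
    funext i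
    have h1 : (b.constr ℂ (fun i => a i • b i) : V →ₗ[ℂ] V) = 0 := congrArg Subtype.val ha
    have h2 := congrFun (congrArg DFunLike.coe h1) (b i)
    simp [b.ne_zero] at h2
    exact h2
  have h3 := LinearMap.finrank_le_finrank_of_injective hL
  rw [finrank_fin_fun] at h3
  unfold dZ; rw [hV]; omega

lemma exists_diag (μ : Fin n → ℂ) : ∃ M : End ℂ (Fin n → ℂ), (∀ i, M.HasEigenvalue (μ i)) ∧
    LinearMap.trace ℂ _ M = ∑ i, μ i := by
  refine ⟨Matrix.toLin' (Matrix.diagonal μ), fun i => ?_, ?_⟩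
  · apply Module.End.hasEigenvalue_of_hasEigenvector (x := Pi.single i 1)
    rw [Module.End.hasEigenvector_iff, Module.End.mem_eigenspace_iff]
    refine ⟨?_, by simp⟩
    rw [Matrix.toLin'_apply, Matrix.mulVec_single_one]
    ext j
    by_cases h : j = i
    · subst h; simp
    · simp [h, Matrix.diagonal_apply_ne _ h]
  · rw [Matrix.trace_toLin'_eq, Matrix.trace_diagonal]

lemma Sim.hasEig {f : End ℂ V} {g : End ℂ V'} (h : Sim f g) {c : ℂ} (hc : f.HasEigenvalue c) : g.HasEigenvalue c := by
  obtain ⟨e, he⟩ := h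
  obtain ⟨v, hv⟩ := hc.exists_hasEigenvector
  apply Module.End.hasEigenvalue_of_hasEigenvector (x := e v)
  rw [Module.End.hasEigenvector_iff, Module.End.mem_eigenspace_iff]
  refine ⟨?_, by simpa using hv.2⟩
  rw [← he, hv.apply_eq_smul, map_smul]

end
end KP

namespace KP
set_option linter.unusedSectionVars false
open Module

lemma MC {J : Type*} [Fintype J] [DecidableEq J] {U : J → Type*} [∀ j, AddCommGroup (U j)] [∀ j, Module ℂ (U j)]
    [∀ j, FiniteDimensional ℂ (U j)] {W : Type*} [AddCommGroup W] [Module ℂ W] [FiniteDimensional ℂ W] {m : ℕ}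
    (hW : finrank ℂ W = m) (hU : ∑ j, finrank ℂ (U j) = m + 1)
    (X : ∀ j, U j →ₗ[ℂ] W) (Y : ∀ j, W →ₗ[ℂ] U j) (hX : ∀ j, Function.Injective (X j))
    (hY : ∀ j, Function.Surjective (Y j)) (hI : Irr fun j => (X j ∘ₗ Y j : End ℂ W))
    (ν : Fin (m + 1) → ℂ) (hν : Function.Injective ν) (hν0 : ∀ i, ν i ≠ 0)
    (he : ∀ i : Fin m, (∑ j, (X j ∘ₗ Y j) : End ℂ W).HasEigenvalue (ν i.succ - ν 0)) :
    ∃ A : J → End ℂ (∀ j, U j), Irr A ∧ (∀ i, (∑ j, A j).HasEigenvalue (ν i)) ∧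
      ∀ j, ∃ (X' : U j →ₗ[ℂ] (∀ j, U j)) (Y' : (∀ j, U j) →ₗ[ℂ] U j), Function.Injective X' ∧ Function.Surjective Y' ∧
        A j = X' ∘ₗ Y' ∧ Y' ∘ₗ X' = Y j ∘ₗ X j + ν 0 • (1 : End ℂ (U j)) := by
  let XX : (∀ j, U j) →ₗ[ℂ] W := ∑ j, X j ∘ₗ LinearMap.proj j
  let YY : W →ₗ[ℂ] (∀ j, U j) := LinearMap.pi Y
  let G : End ℂ (∀ j, U j) := YY ∘ₗ XX + ν 0 • (1 : End ℂ (∀ j, U j))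
  have hG : ∀ w, G w = YY (XX w) + ν 0 • w := fun w => rfl
  have hXX : ∀ w, XX w = ∑ j, X j (w j) := fun w => by simp [XX]
  have hXs : ∀ j u, XX (Pi.single j u) = X j u := fun j u => by
    rw [hXX, Finset.sum_eq_single j]
    · simp
    · intro b _ hb; simp [Pi.single_eq_of_ne hb]
    · simp
  have hYY : ∀ v j, YY v j = Y j v := fun v j => rfl
  have hXY : ∀ v, XX (YY v) = (∑ j, (X j ∘ₗ Y j) : End ℂ W) v := fun v => by
    rw [hXX]; simp [hYY]
  have hV : finrank ℂ (∀ j, U j) = m + 1 := by rw [finrank_pi_fintype, hU]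
  have hGe : ∀ i, G.HasEigenvalue (ν i) := by
    intro i
    refine Fin.cases ?_ (fun i => ?_) i
    · have := LinearMap.ker_ne_bot_of_finrank_lt (f := XX) (by omega)
      obtain ⟨w, hw, hw0⟩ := Submodule.exists_mem_ne_zero_of_ne_bot this
      apply Module.End.hasEigenvalue_of_hasEigenvector (x := w)
      rw [Module.End.hasEigenvector_iff, Module.End.mem_eigenspace_iff]
      refine ⟨?_, hw0⟩
      rw [hG, LinearMap.mem_ker.1 hw, map_zero, zero_add]
    · obtain ⟨v, hv⟩ := (he i).exists_hasEigenvector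
      have h1 := hv.apply_eq_smul
      rw [← hXY] at h1
      apply Module.End.hasEigenvalue_of_hasEigenvector (x := YY v)
      rw [Module.End.hasEigenvector_iff, Module.End.mem_eigenspace_iff]
      constructor
      · rw [hG, h1, map_smul, ← add_smul]; congr 1; ring
      · intro h
        rw [h, map_zero] at h1
        rcases smul_eq_zero.1 h1.symm with h2 | h2
        · exact absurd (hν (sub_eq_zero.1 h2)) (Fin.succ_ne_zero i)
        · exact hv.2 h2
  obtain ⟨b, hb⟩ := exists_eigbasis G ν hν hV hGe
  have hGs : Function.Surjective G := by
    have := eig_top b hb 0 hν0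
    rw [zero_smul, sub_zero] at this
    exact LinearMap.range_eq_top.1 this
  have hGi : Function.Injective G := LinearMap.injective_iff_surjective.2 hGs
  let A : J → End ℂ (∀ j, U j) := fun j => LinearMap.single ℂ U j ∘ₗ (LinearMap.proj j ∘ₗ G)
  have hA : ∀ j w, A j w = Pi.single j (G w j) := fun j w => rfl
  have hAs : ∑ j, A j = G := by
    apply LinearMap.ext; intro w
    rw [LinearMap.sum_apply]
    simp only [hA]
    exact Finset.univ_sum_single (G w)
  refine ⟨A, ?_, fun i => by rw [hAs]; exact hGe i, fun j => ⟨LinearMap.single ℂ U j, LinearMap.proj j ∘ₗ G, ?_, ?_, rfl, ?_⟩⟩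
  · intro S hS
    have hGS : ∀ w ∈ S, G w ∈ S := fun w hw => by
      rw [← hAs, LinearMap.sum_apply]; exact S.sum_mem fun j _ => hS j w hw
    have hmap : S.map G = S := by
      apply Submodule.eq_of_le_of_finrank_eq
      · rintro _ ⟨w, hw, rfl⟩; exact hGS w hw
      · exact (LinearEquiv.finrank_eq (Submodule.equivMapOfInjective G hGi S)).symm
    have hE : ∀ w ∈ S, ∀ j, Pi.single j (w j) ∈ S := by
      intro w hw j
      rw [← hmap] at hw
      obtain ⟨w', hw', rfl⟩ := hw
      exact hS j w' hw'
    have hYX : ∀ w ∈ S, YY (XX w) ∈ S := fun w hw => by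
      have := S.sub_mem (hGS w hw) (S.smul_mem (ν 0) hw)
      rwa [hG, add_sub_cancel_right] at this
    rcases hI (S.map XX) (by
      rintro j _ ⟨w, hw, rfl⟩
      refine ⟨Pi.single j (YY (XX w) j), hE _ (hYX w hw) j, ?_⟩
      rw [hXs]; rfl) with h | h
    · left
      rw [eq_bot_iff]
      intro w hw
      rw [Submodule.mem_bot]
      funext j
      have h1 : XX (Pi.single j (w j)) ∈ S.map XX := ⟨_, hE w hw j, rfl⟩
      rw [h, Submodule.mem_bot, hXs] at h1
      exact (map_eq_zero_iff _ (hX j)).1 h1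
    · right
      rw [eq_top_iff]
      intro w _
      rw [← Finset.univ_sum_single w]
      refine S.sum_mem fun j _ => ?_
      obtain ⟨v, hv⟩ := hY j (w j)
      have h1 : v ∈ S.map XX := by rw [h]; trivial
      obtain ⟨w', hw', rfl⟩ := h1
      have := hE _ (hYX w' hw') j
      rwa [hYY, hv] at this
  · exact Pi.single_injective j
  · exact (LinearMap.proj_surjective (R := ℂ) (φ := U) j).comp hGs
  · apply LinearMap.ext; intro u
    show G (Pi.single j u) j = Y j (X j u) + ν 0 • u
    rw [hG, hXs]; simp [hYY]

def Sol' {n m : ℕ} {J : Type*} [Fintype J] (B : J → End ℂ (Fin n → ℂ)) (ν : Fin m → ℂ) : Prop :=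
  ∃ A : J → End ℂ (Fin n → ℂ), (∀ j, Sim (A j) (B j)) ∧ Irr A ∧ ∀ i, (∑ j, A j).HasEigenvalue (ν i)

lemma transfer {n m : ℕ} {J : Type*} [Fintype J] {V : Type*} [AddCommGroup V] [Module ℂ V] [FiniteDimensional ℂ V]
    (hV : finrank ℂ V = n) (A : J → End ℂ V) (B : J → End ℂ (Fin n → ℂ)) (ν : Fin m → ℂ)
    (h1 : ∀ j, Sim (A j) (B j)) (h2 : Irr A) (h3 : ∀ i, (∑ j, A j).HasEigenvalue (ν i)) : Sol' B ν := by
  let e : V ≃ₗ[ℂ] (Fin n → ℂ) := LinearEquiv.ofFinrankEq _ _ (by simp [hV])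
  have hs : ∀ j, Sim (A j) (e.conj (A j)) := fun j => ⟨e, fun v => by simp [LinearEquiv.conj_apply]⟩
  refine ⟨fun j => e.conj (A j), fun j => (hs j).symm.trans (h1 j), ?_, fun i => ?_⟩
  · intro W hW
    rcases h2 (W.comap e.toLinearMap) (fun j v hv => by
      have := hW j (e v) hv
      simpa [LinearEquiv.conj_apply] using this) with h | h
    · left
      rw [eq_bot_iff]; intro w hw
      have : e.symm w ∈ W.comap e.toLinearMap := by simpa using hw
      rw [h, Submodule.mem_bot] at this
      simpa using this
    · right
      rw [eq_top_iff]; intro w _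
      have : e.symm w ∈ W.comap e.toLinearMap := by rw [h]; trivial
      simpa using this
  · have : Sim (∑ j, A j) (∑ j, e.conj (A j)) := ⟨e, fun v => by simp [LinearEquiv.conj_apply, LinearMap.sum_apply]⟩
    exact this.hasEig (h3 i)

/-- shifting -/
lemma shift {n m : ℕ} {J : Type*} [Fintype J] (B : J → End ℂ (Fin n → ℂ)) (ν : Fin m → ℂ) (δ : J → ℂ)
    (h : Sol' (fun j => B j - δ j • (1 : End ℂ (Fin n → ℂ))) (fun i => ν i - ∑ j, δ j)) : Sol' B ν := by
  obtain ⟨A, h1, h2, h3⟩ := h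
  refine ⟨fun j => A j + δ j • (1 : End ℂ (Fin n → ℂ)), fun j => ?_, ?_, fun i => ?_⟩
  · have := (h1 j).sub_smul (-δ j)
    have e1 : ∀ T : End ℂ (Fin n → ℂ), T - -δ j • (1 : End ℂ (Fin n → ℂ)) = T + δ j • (1 : End ℂ (Fin n → ℂ)) := fun T => by
      apply LinearMap.ext; intro v; simp
    rwa [e1, e1, sub_add_cancel] at this
  · intro W hW
    apply h2 W
    intro j v hv
    have := W.sub_mem (hW j v hv) (W.smul_mem (δ j) hv)
    simpa using this
  · obtain ⟨v, hv⟩ := (h3 i).exists_hasEigenvector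
    apply Module.End.hasEigenvalue_of_hasEigenvector (x := v)
    rw [Module.End.hasEigenvector_iff, Module.End.mem_eigenspace_iff]
    refine ⟨?_, hv.2⟩
    rw [Finset.sum_add_distrib, LinearMap.add_apply, hv.apply_eq_smul, ← Finset.sum_smul]
    simp [← add_smul]

/-- pulling a factorization through a similarity, then middle convolution -/
lemma MC' {J : Type*} [Fintype J] {m : ℕ} (B : J → End ℂ (Fin (m + 1) → ℂ))
    {U : J → Type*} [∀ j, AddCommGroup (U j)] [∀ j, Module ℂ (U j)] [∀ j, FiniteDimensional ℂ (U j)]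
    (hU : ∑ j, finrank ℂ (U j) = m + 1)
    (X0 : ∀ j, U j →ₗ[ℂ] (Fin (m + 1) → ℂ)) (Y0 : ∀ j, (Fin (m + 1) → ℂ) →ₗ[ℂ] U j)
    (hX0 : ∀ j, Function.Injective (X0 j)) (hY0 : ∀ j, Function.Surjective (Y0 j)) (hB : ∀ j, X0 j ∘ₗ Y0 j = B j)
    (X : ∀ j, U j →ₗ[ℂ] (Fin m → ℂ)) (Y : ∀ j, (Fin m → ℂ) →ₗ[ℂ] U j)
    (hX : ∀ j, Function.Injective (X j)) (hY : ∀ j, Function.Surjective (Y j))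
    (ν : Fin (m + 1) → ℂ) (hν : Function.Injective ν) (hν0 : ∀ i, ν i ≠ 0)
    (hXY : ∀ j, Y j ∘ₗ X j = Y0 j ∘ₗ X0 j - ν 0 • (1 : End ℂ (U j)))
    (h : Sol' (fun j => (X j ∘ₗ Y j : End ℂ (Fin m → ℂ))) (fun i : Fin m => ν i.succ - ν 0)) : Sol' B ν := by
  classical
  obtain ⟨A, h1, h2, h3⟩ := h
  choose e he using h1
  let X2 : ∀ j, U j →ₗ[ℂ] (Fin m → ℂ) := fun j => (e j).symm.toLinearMap ∘ₗ X j
  let Y2 : ∀ j, (Fin m → ℂ) →ₗ[ℂ] U j := fun j => Y j ∘ₗ (e j).toLinearMap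
  have hA : ∀ j, A j = X2 j ∘ₗ Y2 j := fun j => by
    apply LinearMap.ext; intro v
    show A j v = (e j).symm (X j (Y j (e j v)))
    rw [LinearEquiv.eq_symm_apply, he]; rfl
  have hYX : ∀ j, Y2 j ∘ₗ X2 j = Y j ∘ₗ X j := fun j => by
    apply LinearMap.ext; intro v
    show Y j ((e j) ((e j).symm (X j v))) = _
    rw [LinearEquiv.apply_symm_apply]; rfl
  obtain rfl : A = fun j => X2 j ∘ₗ Y2 j := funext hA
  obtain ⟨A', g1, g2, g3⟩ := MC (by simp) hU X2 Y2 (fun j => (e j).symm.injective.comp (hX j))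
    (fun j => (hY j).comp (e j).surjective) h2 ν hν hν0 h3
  refine transfer (by rw [finrank_pi_fintype, hU]) A' B ν (fun j => ?_) g1 g2
  obtain ⟨X', Y', k1, k2, k3, k4⟩ := g3 j
  have k5 : Y' ∘ₗ X' = Y0 j ∘ₗ X0 j := by
    rw [k4, hYX, hXY]; apply LinearMap.ext; intro v; simp
  have := lemQ X' Y' k1 k2 (X0 j) (Y0 j) (hX0 j) (hY0 j)
    (by rw [finrank_pi_fintype, hU]; simp) (by rw [k5]; exact Sim.refl _)
  rw [k3, ← hB]
  exact this

end KP

namespace KP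
set_option linter.unusedSectionVars false
open Module

lemma rg_sub {V : Type*} [AddCommGroup V] [Module ℂ V] (f : End ℂ V) (d c : ℂ) :
    rg (f - d • (1 : End ℂ V)) c = rg f (d + c) := by
  unfold rg; rw [sub_sub, ← add_smul]

lemma rg_zero {V : Type*} [AddCommGroup V] [Module ℂ V] (f : End ℂ V) : rg f 0 = finrank ℂ (LinearMap.range f) := by
  unfold rg; rw [zero_smul, sub_zero]

lemma tilde {m : ℕ} {U : Type*} [AddCommGroup U] [Module ℂ U] [FiniteDimensional ℂ U]
    (X0 : U →ₗ[ℂ] (Fin (m + 1) → ℂ)) (Y0 : (Fin (m + 1) → ℂ) →ₗ[ℂ] U) (hX0i : Function.Injective X0)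
    (hY0s : Function.Surjective Y0)
    (B : End ℂ (Fin (m + 1) → ℂ)) (hB : X0 ∘ₗ Y0 = B) (r : ℕ) (hr0 : rg B 0 = r) (hr : ∀ c, r ≤ rg B c)
    (ν0 : ℂ) (hν0 : ν0 ≠ 0) (hnt : rg B ν0 ≠ r) :
    ∃ (X : U →ₗ[ℂ] (Fin m → ℂ)) (Y : (Fin m → ℂ) →ₗ[ℂ] U),
      Function.Injective X ∧ Function.Surjective Y ∧
      Y ∘ₗ X = Y0 ∘ₗ X0 - ν0 • (1 : End ℂ U) ∧
      rg (X ∘ₗ Y : End ℂ (Fin m → ℂ)) 0 = r ∧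
      (∀ c, c ≠ 0 → c + ν0 ≠ 0 → rg (X ∘ₗ Y : End ℂ (Fin m → ℂ)) c + 1 = rg B (c + ν0)) ∧
      (∀ c, c ≠ 0 → r ≤ rg (X ∘ₗ Y : End ℂ (Fin m → ℂ)) c + 1) ∧
      dZ (X ∘ₗ Y : End ℂ (Fin m → ℂ)) = dZ B - 2 * r ∧
      LinearMap.trace ℂ _ (X ∘ₗ Y : End ℂ (Fin m → ℂ)) = LinearMap.trace ℂ _ B - r * ν0 ∧
      (∀ c (ρ : ℕ), c ≠ 0 → rg (X ∘ₗ Y : End ℂ (Fin m → ℂ)) c + r = m + ρ → ρ ≤ 1 →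
        dZ B = 2 * r * (m + 1 - r) + 2 * ρ * (r - ρ)) ∧
      (∀ c, c ≠ 0 → m ≤ rg (X ∘ₗ Y : End ℂ (Fin m → ℂ)) c + r) := by
  have hU : finrank ℂ U = r := by
    rw [← hr0, rg_zero, ← hB, LinearMap.range_comp_of_range_eq_top _ (LinearMap.range_eq_top.2 hY0s),
      LinearMap.finrank_range_of_inj hX0i]
  obtain ⟨C, hC⟩ : ∃ C : End ℂ U, C = Y0 ∘ₗ X0 := ⟨_, rfl⟩
  have hfac : ∀ c, c ≠ 0 → rg B c + r = m + 1 + rg C c := fun c hc => by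
    have := rg_factor X0 Y0 c hc
    rwa [hB, hU, finrank_fin_fun, ← hC] at this
  have hC0 : 2 * r ≤ m + 1 + rg C 0 := by
    have h1 := LinearMap.finrank_range_add_finrank_ker C
    have h2 := LinearMap.finrank_range_add_finrank_ker B
    have h3 : finrank ℂ (LinearMap.ker C) ≤ finrank ℂ (LinearMap.ker B) := by
      have h4 : (LinearMap.ker C).map X0 ≤ LinearMap.ker B := by
        rintro _ ⟨u, hu, rfl⟩
        have hu : Y0 (X0 u) = 0 := by rw [hC] at hu; exact hu
        rw [LinearMap.mem_ker, ← hB, LinearMap.comp_apply, hu, map_zero]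
      have h5 := Submodule.finrank_mono h4
      rwa [← LinearEquiv.finrank_eq (Submodule.equivMapOfInjective X0 hX0i _)] at h5
    have h6 : rg C 0 = finrank ℂ (LinearMap.range C) := rg_zero C
    have h7 : finrank ℂ (LinearMap.range B) = r := by rw [← rg_zero, hr0]
    rw [finrank_fin_fun] at h2
    omega
  obtain ⟨X, Y, hX, hY, hYX⟩ := exists_factor (Fin m → ℂ) (C - ν0 • (1 : End ℂ U)) (by
    have h1 := hfac ν0 hν0
    have h2 := hr ν0
    rw [hU, finrank_fin_fun]
    unfold rg at h1 h2 hnt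
    omega)
  have hfac2 : ∀ c, c ≠ 0 → rg (X ∘ₗ Y : End ℂ (Fin m → ℂ)) c + r = m + rg C (c + ν0) := fun c hc => by
    have := rg_factor X Y c hc
    rwa [hYX, hU, finrank_fin_fun, rg_sub, add_comm ν0] at this
  have hd1 := dZ_factor X0 Y0 hX0i hY0s
  rw [hB, hU, finrank_fin_fun, ← hC] at hd1
  have hd2 := dZ_factor X Y hX hY
  rw [hYX, dZ_sub, hU, finrank_fin_fun] at hd2
  refine ⟨X, Y, hX, hY, hC ▸ hYX, ?_, ?_, ?_, ?_, ?_, ?_, ?_⟩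
  · rw [rg_zero, LinearMap.range_comp_of_range_eq_top _ (LinearMap.range_eq_top.2 hY),
      LinearMap.finrank_range_of_inj hX, hU]
  · intro c hc hc2
    have h1 := hfac _ hc2
    have h2 := hfac2 c hc
    omega
  · intro c hc
    have h2 := hfac2 c hc
    by_cases hc2 : c + ν0 = 0
    · rw [hc2] at h2; omega
    · have h1 := hfac _ hc2
      have h3 := hr (c + ν0)
      omega
  · rw [hd2, hd1]; push_cast; ring
  · rw [LinearMap.trace_comp_comm', hYX, LinearMap.map_sub, LinearMap.map_smul, LinearMap.trace_one, hU, hC, LinearMap.trace_comp_comm', hB,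
      smul_eq_mul, mul_comm]
  · intro c ρ hc h1 h2
    have h3 := hfac2 c hc
    have h4 : rg C (c + ν0) = ρ := by omega
    have h5 := dZ_low C (c + ν0) (by omega)
    rw [hd1, h5, h4, hU]; push_cast; ring
  · intro c hc
    rw [hfac2 c hc]; omega

theorem T2n {J : Type*} [Fintype J] : ∀ (m : ℕ) (B : J → End ℂ (Fin (m + 1) → ℂ)) (r : J → ℕ) (ν : Fin (m + 1) → ℂ),
    Function.Injective ν → (∀ j, rg (B j) 0 = r j) → (∀ j c, r j ≤ rg (B j) c) → ∑ j, r j = m + 1 →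
    ((m + 1 : ℤ) ^ 2 + (m + 1) - 1 ≤ ∑ j, dZ (B j)) → ∑ i, ν i = ∑ j, LinearMap.trace ℂ _ (B j) →
    (∀ j c i, rg (B j) c = r j → c ≠ ν i) → Sol' B ν := by
  classical
  intro m
  induction m with
  | zero =>
    intro B r ν _ _ _ _ hd
    exfalso
    rw [Finset.sum_eq_zero (fun j _ => dZ_small (B j) (by simp))] at hd
    norm_num at hd
  | succ k ih =>
    intro B r ν hν hr0 hr hs hd htr htie
    have hne : ∃ j : J, True := by
      by_contra h
      push Not at h
      rw [Finset.sum_eq_zero (fun j _ => (h j).elim)] at hs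
      omega
    obtain ⟨jj, -⟩ := hne
    have hν0 : ∀ i, ν i ≠ 0 := fun i => (htie jj 0 i (hr0 jj)).symm
    have hrm : ∀ j, r j ≤ k + 1 := fun j => by
      obtain ⟨c, hc⟩ := rg_lt (by omega) (B j)
      have := hr j c; omega
    choose X Y hX hY hYX ha hb hf hdt htt hg hh using fun j => tilde (LinearMap.range (B j)).subtype
      (LinearMap.rangeRestrict (B j)) (Submodule.injective_subtype _) (LinearMap.surjective_rangeRestrict _) (B j)
      (LinearMap.subtype_comp_codRestrict _ _ _) (r j) (hr0 j) (hr j) (ν 0) (hν0 0)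
      (fun h => htie j _ 0 h rfl)
    have hUs : ∑ j, finrank ℂ (LinearMap.range (B j)) = k + 1 + 1 := by
      refine Eq.trans ?_ hs
      exact Finset.sum_congr rfl fun j _ => by rw [← hr0 j, rg_zero]
    apply MC' B hUs (fun j => (LinearMap.range (B j)).subtype) (fun j => LinearMap.rangeRestrict (B j))
      (fun j => Submodule.injective_subtype _) (fun j => LinearMap.surjective_rangeRestrict _)
      (fun j => LinearMap.subtype_comp_codRestrict _ _ _) X Y hX hY ν hν hν0 hYX
    generalize hBt : (fun j => (X j ∘ₗ Y j : End ℂ (Fin (k + 1) → ℂ))) = Bt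
    have hBt' : ∀ j, X j ∘ₗ Y j = Bt j := fun j => congrFun hBt j
    simp only [hBt'] at ha hb hf hdt htt hg hh
    clear hBt hBt' hYX hX hY X Y
    have hT : ∀ j c i, c ≠ 0 → rg (Bt j) c + 1 = r j → c + ν 0 ≠ ν i := by
      intro j c i hc h
      by_cases hc2 : c + ν 0 = 0
      · rw [hc2]; exact (hν0 i).symm
      · exact htie j _ i (by rw [← hb j c hc hc2, h])
    have htr2 : ∑ i : Fin (k + 1), (ν i.succ - ν 0) = ∑ j, LinearMap.trace ℂ _ (Bt j) := by
      have e1 : ∑ j, LinearMap.trace ℂ _ (Bt j) = ∑ i, ν i - (k + 2) * ν 0 := by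
        rw [Finset.sum_congr rfl (fun j _ => htt j), Finset.sum_sub_distrib, ← htr, ← Finset.sum_mul, ← Nat.cast_sum, hs]
        push_cast; ring
      rw [e1, Fin.sum_univ_succ ν, Finset.sum_sub_distrib]
      simp; ring
    have hinj : Function.Injective fun i : Fin (k + 1) => ν i.succ - ν 0 := fun a b h => by
      have h : ν a.succ - ν 0 = ν b.succ - ν 0 := h
      exact Fin.succ_injective _ (hν (sub_left_inj.1 h))
    by_cases hnt : ∀ j c, c ≠ 0 → r j ≤ rg (Bt j) c
    · -- no ties
      rcases Nat.eq_zero_or_pos k with rfl | hk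
      · exfalso
        have h1 : ∀ j, dZ (B j) = 2 * r j := fun j => by
          have h2 := dZ_low (B j) 0 (by rw [hr0]; have := hrm j; omega)
          rw [hr0] at h2
          have h3 := hrm j
          have : r j = 0 ∨ r j = 1 := by omega
          rcases this with h | h <;> rw [h2, h] <;> simp
        rw [Finset.sum_congr rfl (fun j _ => h1 j), ← Finset.mul_sum, ← Nat.cast_sum, hs] at hd
        norm_num at hd
      · obtain ⟨M, hM1, hM2⟩ := exists_diag fun i : Fin (k + 1) => ν i.succ - ν 0
        obtain ⟨b, hbb⟩ := exists_eigbasis M _ hinj (by simp) hM1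
        obtain ⟨A, h1, h2, h3⟩ := T1 (by omega) M (eig_rg b hbb hinj) Bt r (by rw [hM2, htr2])
          (fun j c => by
            by_cases hc : c = 0
            · rw [hc, ha]
            · exact hnt j c hc) (by omega)
        exact ⟨A, h1, h3, fun i => h2.symm.hasEig (hM1 i)⟩
    · push Not at hnt
      obtain ⟨j0, c1, hc1, hlt⟩ := hnt
      have htie0 : rg (Bt j0) c1 + 1 = r j0 := by have := hf j0 c1 hc1; omega
      have near : ∀ j, j ≠ j0 → ∀ c, c ≠ 0 → r j < rg (Bt j) c := by
        intro j hj c hc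
        by_contra hle
        push Not at hle
        have h1 := sum_two hj.symm r
        rw [hs] at h1
        have h2 := sum_two hj.symm fun l => dZ (B l)
        rw [h2] at hd
        have g3 := hf j c hc
        have e1 := hh j0 c1 hc1
        have e2 := hh j c hc
        obtain ⟨ρ, hρ⟩ := Nat.exists_eq_add_of_le e2
        obtain ⟨σ, hσ⟩ := Nat.exists_eq_add_of_le e1
        have hR : ∑ l ∈ Finset.univ.filter (fun l => l ≠ j0 ∧ l ≠ j), r l = 0 := by omega
        have hR2 : ∑ l ∈ Finset.univ.filter (fun l => l ≠ j0 ∧ l ≠ j), dZ (B l) = 0 := by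
          refine Finset.sum_eq_zero fun l hl => ?_
          have h3 := Finset.sum_eq_zero_iff.1 hR l hl
          have h4 := dZ_low (B l) 0 (by rw [hr0, h3]; omega)
          rw [h4, hr0, h3]; simp
        have g1 := hg j0 c1 σ hc1 hσ (by omega)
        have g2 := hg j c ρ hc hρ (by omega)
        rw [hR2, g1, g2] at hd
        clear g1 g2 h2
        have hcase : (r j0 = r j ∧ k + 2 = 2 * r j ∧ σ = 0 ∧ ρ ≤ 1) ∨
            (r j0 = r j + 1 ∧ k + 1 = 2 * r j ∧ σ = 1 ∧ ρ = 0) := by omega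
        rcases hcase with ⟨q1, q2, q3, q4⟩ | ⟨q1, q2, q3, q4⟩
        · obtain ⟨t, ht⟩ : ∃ t, r j = t + 1 := ⟨r j - 1, by omega⟩
          obtain rfl : k = 2 * t := by omega
          rw [q1, q3, ht] at hd
          have hρ2 : ρ = 0 ∨ ρ = 1 := by omega
          rcases hρ2 with q | q <;> rw [q] at hd <;> push_cast at hd <;> nlinarith
        · obtain ⟨t, ht⟩ : ∃ t, r j = t + 1 := ⟨r j - 1, by omega⟩
          obtain rfl : k = 2 * t + 1 := by omega
          rw [q1, q3, q4, ht] at hd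
          push_cast at hd; nlinarith
      apply shift Bt _ (Pi.single j0 c1)
      apply ih (fun j => Bt j - (Pi.single j0 c1 : J → ℂ) j • (1 : End ℂ (Fin (k + 1) → ℂ)))
        (fun j => if j = j0 then r j - 1 else r j)
      · intro a b h
        exact hinj (sub_left_inj.1 h)
      · intro j
        rw [rg_sub, add_zero]
        by_cases hj : j = j0
        · subst hj; simp; omega
        · simp [hj, ha]
      · intro j c
        rw [rg_sub]
        by_cases hj : j = j0
        · subst hj
          simp only [if_true]
          by_cases hc : (Pi.single j c1 : J → ℂ) j + c = 0
          · rw [hc, ha]; omega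
          · have := hf j _ hc; omega
        · simp only [hj, if_false, Pi.single_eq_of_ne hj, zero_add]
          by_cases hc : c = 0
          · rw [hc, ha]
          · exact (near j hj c hc).le
      · have h1 := Finset.add_sum_erase Finset.univ (fun j => r j) (Finset.mem_univ j0)
        rw [← Finset.add_sum_erase Finset.univ _ (Finset.mem_univ j0)]
        rw [Finset.sum_congr rfl (g := fun j => r j) (fun j hj => if_neg (Finset.ne_of_mem_erase hj))]
        simp only [if_true]
        omega
      · simp only [dZ_sub, hdt]
        rw [Finset.sum_sub_distrib, ← Finset.mul_sum, ← Nat.cast_sum, hs]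
        push_cast at hd ⊢
        linarith
      · simp only [map_sub, map_smul, LinearMap.trace_one, smul_eq_mul]
        have e1 : ∑ j, (Pi.single j0 c1 : J → ℂ) j = c1 := by simp
        rw [e1, Finset.sum_sub_distrib (f := fun j => LinearMap.trace ℂ _ (Bt j)), ← htr2, ← Finset.sum_mul, e1,
          Finset.sum_sub_distrib (f := fun i : Fin (k + 1) => ν i.succ - ν 0)]
        simp; ring
      · intro j c i h
        rw [rg_sub] at h
        by_cases hj : j = j0
        · subst hj
          simp only [if_true, Pi.single_eq_same] at h
          have h0 : c1 + c ≠ 0 := fun h0 => by rw [h0, ha] at h; omega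
          have := hT j _ i.succ h0 (by omega)
          simp only [Finset.sum_pi_single', Finset.mem_univ, if_true]
          rintro rfl
          apply this; ring
        · simp only [hj, if_false, Pi.single_eq_of_ne hj, zero_add] at h
          have h0 : c = 0 := by
            by_contra h0
            have := near j hj c h0; omega
          have := hT j0 c1 i.succ hc1 htie0
          simp only [Finset.sum_pi_single', Finset.mem_univ, if_true]
          rintro rfl
          apply this
          have h0 : ν i.succ - ν 0 - c1 = 0 := h0
          linear_combination -h0

end KP

namespace KP
set_option linter.unusedSectionVars false
open Module

theorem T2 {J : Type*} [Fintype J] {n : ℕ} (hn : 1 ≤ n) (B : J → End ℂ (Fin n → ℂ)) (r : J → ℕ) (l : J → ℂ) (μ : Fin n → ℂ)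
    (hμ : Function.Injective μ) (hl : ∀ j, rg (B j) (l j) = r j) (hr : ∀ j c, r j ≤ rg (B j) c) (hs : ∑ j, r j = n)
    (hd : (n : ℤ) ^ 2 + n - 1 ≤ ∑ j, dZ (B j)) (htr : ∑ i, μ i = ∑ j, LinearMap.trace ℂ _ (B j))
    (htie : ∀ j c i, rg (B j) (l j + c) = r j → ∑ j, l j + c ≠ μ i) : Sol' B μ := by
  obtain ⟨m, rfl⟩ : ∃ m, n = m + 1 := ⟨n - 1, by omega⟩
  apply shift B μ l
  apply T2n m _ r
  · intro a b h
    exact hμ (sub_left_inj.1 h)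
  · intro j; rw [rg_sub, add_zero, hl]
  · intro j c; rw [rg_sub]; exact hr j _
  · exact hs
  · simp only [dZ_sub]; push_cast at hd; exact hd
  · simp only [map_sub, map_smul, LinearMap.trace_one, smul_eq_mul]
    rw [Finset.sum_sub_distrib, htr, Finset.sum_sub_distrib, ← Finset.sum_mul]
    simp; ring
  · intro j c i h
    rw [rg_sub] at h
    have := htie j c i h
    rintro rfl
    apply this; ring

lemma rg_mat {n : ℕ} (Y : Matrix (Fin n) (Fin n) ℂ) (c : ℂ) :
    rg (Matrix.toLin' Y) c = (Y - c • (1 : Matrix (Fin n) (Fin n) ℂ)).rank := by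
  unfold rg Matrix.rank
  rw [← Matrix.toLin'_apply', map_sub, map_smul, Matrix.toLin'_one]; rfl

lemma rk_le {n : ℕ} (Y : Matrix (Fin n) (Fin n) ℂ) (c : ℂ) : rk Y ≤ rg (Matrix.toLin' Y) c := by
  rw [rg_mat]; exact ciInf_le ⟨0, fun _ _ => Nat.zero_le _⟩ c

lemma rk_att {n : ℕ} (Y : Matrix (Fin n) (Fin n) ℂ) : ∃ c, rg (Matrix.toLin' Y) c = rk Y := by
  obtain ⟨c, hc⟩ := Nat.sInf_mem (Set.range_nonempty fun c : ℂ => (Y - c • (1 : Matrix (Fin n) (Fin n) ℂ)).rank)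
  exact ⟨c, by rw [rg_mat]; exact hc⟩

lemma dd_eq {n : ℕ} (Y : Matrix (Fin n) (Fin n) ℂ) : (dd Y : ℤ) = dZ (Matrix.toLin' Y) := by
  have h1 : finrank ℂ (centSub Y) ≤ n ^ 2 := by
    have := Submodule.finrank_le (centSub Y)
    rw [finrank_matrix] at this
    simpa [sq] using this
  have h2 : (centSub Y).map (Matrix.toLin' : Matrix (Fin n) (Fin n) ℂ ≃ₗ[ℂ] _).toLinearMap = cent (Matrix.toLin' Y) := by
    ext Z
    rw [mem_cent]
    constructor
    · rintro ⟨Z, hZ, rfl⟩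
      have hZ : Y * Z = Z * Y := hZ
      show Matrix.toLin' Y ∘ₗ Matrix.toLin' Z = Matrix.toLin' Z ∘ₗ Matrix.toLin' Y
      rw [← Matrix.toLin'_mul, ← Matrix.toLin'_mul, hZ]
    · intro h
      refine ⟨LinearMap.toMatrix' Z, ?_, Matrix.toLin'_toMatrix' Z⟩
      show Y * LinearMap.toMatrix' Z = LinearMap.toMatrix' Z * Y
      apply Matrix.toLin'.injective
      rw [Matrix.toLin'_mul, Matrix.toLin'_mul, Matrix.toLin'_toMatrix']
      exact h
  have h3 : finrank ℂ (centSub Y) = finrank ℂ (cent (Matrix.toLin' Y)) := by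
    rw [← h2]
    exact LinearEquiv.finrank_eq (Submodule.equivMapOfInjective _ (Matrix.toLin' : Matrix (Fin n) (Fin n) ℂ ≃ₗ[ℂ] _).injective _)
  unfold dd dZ
  rw [Nat.cast_sub h1, h3]; simp

lemma sameClass_of_sim {n : ℕ} (A B : Matrix (Fin n) (Fin n) ℂ) (h : Sim (Matrix.toLin' A) (Matrix.toLin' B)) :
    SameClass A B := by
  obtain ⟨e, he⟩ := h
  have h1 : LinearMap.toMatrix' e.symm.toLinearMap * LinearMap.toMatrix' e.toLinearMap = 1 := by
    rw [← LinearMap.toMatrix'_comp, LinearEquiv.symm_comp, LinearMap.toMatrix'_id]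
  have h2 : LinearMap.toMatrix' e.toLinearMap * LinearMap.toMatrix' e.symm.toLinearMap = 1 := by
    rw [← LinearMap.toMatrix'_comp, LinearEquiv.comp_symm, LinearMap.toMatrix'_id]
  refine ⟨LinearMap.toMatrix' e.symm.toLinearMap, IsUnit.of_mul_eq_one _ h1, ?_⟩
  rw [Matrix.inv_eq_right_inv h1]
  apply Matrix.toLin'.injective
  rw [Matrix.toLin'_mul, Matrix.toLin'_mul, Matrix.toLin'_toMatrix', Matrix.toLin'_toMatrix']
  apply LinearMap.ext; intro v
  show _ = e.symm (Matrix.toLin' B (e v))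
  rw [← he]; simp

lemma eig_iff {n : ℕ} (Y : Matrix (Fin n) (Fin n) ℂ) (lam : Fin n → ℂ) (h : Y.charpoly = ∏ k, (X - C (lam k))) (c : ℂ) :
    Module.End.HasEigenvalue (Matrix.toLin' Y) c ↔ ∃ k, c = lam k := by
  rw [Module.End.hasEigenvalue_iff_isRoot_charpoly, Matrix.charpoly_toLin', h, IsRoot.def, eval_prod,
    Finset.prod_eq_zero_iff]
  simp [sub_eq_zero]

lemma trace_lam {n : ℕ} (Y : Matrix (Fin n) (Fin n) ℂ) (lam : Fin n → ℂ) (h : Y.charpoly = ∏ k, (X - C (lam k))) :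
    LinearMap.trace ℂ _ (Matrix.toLin' Y) = ∑ k, lam k := by
  rw [Matrix.trace_toLin'_eq, Matrix.trace_eq_sum_roots_charpoly, h, roots_prod _ _ (Finset.prod_ne_zero_iff.2 fun k _ => X_sub_C_ne_zero _)]
  simp [List.sum_ofFn]

lemma contra {n p : ℕ} (B : Fin (p + 1) → Matrix (Fin n) (Fin n) ℂ) (A : Fin p → End ℂ (Fin n → ℂ))
    (h1 : ∀ j, Sim (A j) (Matrix.toLin' (B j.succ))) (h2 : Sim (∑ j, A j) (-Matrix.toLin' (B 0))) (h3 : Irr A) :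
    ∃ A, (∀ j, SameClass (A j) (B j)) ∧ ∑ j, A j = 0 ∧ IrreducibleTuple A := by
  refine ⟨Fin.cons (LinearMap.toMatrix' (-∑ j, A j)) fun j => LinearMap.toMatrix' (A j), ?_, ?_, ?_⟩
  · intro j
    refine Fin.cases ?_ (fun j => ?_) j
    · apply sameClass_of_sim
      rw [Fin.cons_zero, Matrix.toLin'_toMatrix']
      simpa using h2.neg
    · apply sameClass_of_sim
      rw [Fin.cons_succ, Matrix.toLin'_toMatrix']
      exact h1 j
  · rw [Fin.sum_univ_succ]
    simp only [Fin.cons_zero, Fin.cons_succ]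
    rw [← map_sum, ← map_add, neg_add_cancel, map_zero]
  · intro W hW
    apply h3 W
    intro j v hv
    have := hW j.succ v hv
    rw [Fin.cons_succ, ← Matrix.toLin'_apply, Matrix.toLin'_toMatrix'] at this
    exact this

end KP

/-- If `(α_n)` and `(β_n)` hold but the DSP is not solvable (no irreducible tuple with
zero sum exists), then `r_2 + ⋯ + r_{p+1} = n` and either `κ = 2` or the eigenvalues
satisfy a 1-relation. -/
theorem stmt10 (n p : ℕ) (hn : 2 ≤ n) (hp : 1 ≤ p)
    (B : Fin (p + 1) → Matrix (Fin n) (Fin n) ℂ)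
    (lam : Fin n → Fin (p + 1) → ℂ)
    (hchar : ∀ j, (B j).charpoly = ∏ k, (Polynomial.X - Polynomial.C (lam k j)))
    (hdist : Function.Injective fun k => lam k 0)
    (htrace : ∑ j, ∑ k, lam k j = 0)
    (hα : 2 * n ^ 2 - 2 ≤ ∑ j, dd (B j))
    (hβ : ∀ j, n ≤ ∑ i ∈ Finset.univ.erase j, rk (B i))
    (hno : ¬ ∃ A : Fin (p + 1) → Matrix (Fin n) (Fin n) ℂ,
        (∀ j, SameClass (A j) (B j)) ∧ ∑ j, A j = 0 ∧ IrreducibleTuple A) :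
    (∑ j ∈ Finset.univ.erase 0, rk (B j) = n) ∧
      (2 * (n : ℤ) ^ 2 - ∑ j, (dd (B j) : ℤ) = 2 ∨
        ∃ k : Fin (p + 1) → Fin n, ∑ j, lam (k j) j = 0) := by
  classical
  have hsum : ∑ j ∈ Finset.univ.erase 0, rk (B j) = ∑ j : Fin p, rk (B j.succ) := by
    have h1 := Finset.add_sum_erase Finset.univ (fun j => rk (B j)) (Finset.mem_univ 0)
    rw [Fin.sum_univ_succ] at h1
    exact Nat.add_left_cancel h1
  obtain ⟨b, hb⟩ := KP.exists_eigbasis (Matrix.toLin' (B 0)) (fun k => lam k 0) hdist (by simp)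
    (fun i => (KP.eig_iff _ _ (hchar 0) _).2 ⟨i, rfl⟩)
  have hb' : ∀ i, (-Matrix.toLin' (B 0) : Module.End ℂ (Fin n → ℂ)) (b i) = (fun i => -lam i 0) i • b i := fun i => by
    rw [LinearMap.neg_apply, hb]; simp
  have hdist' : Function.Injective fun i => -lam i 0 := fun x y h => hdist (neg_injective h)
  have htr : ∑ j : Fin p, LinearMap.trace ℂ _ (Matrix.toLin' (B j.succ)) = ∑ i, -lam i 0 := by
    rw [Finset.sum_congr rfl fun (j : Fin p) _ => KP.trace_lam (B j.succ) (fun k => lam k j.succ) (hchar j.succ)]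
    rw [Fin.sum_univ_succ] at htrace
    rw [Finset.sum_neg_distrib]; linear_combination htrace
  have hN : ∑ j : Fin p, rk (B j.succ) = n := by
    by_contra hne
    have h0 := hβ 0
    rw [hsum] at h0
    obtain ⟨A, h1, h2, h3⟩ := KP.T1 hn (-Matrix.toLin' (B 0)) (KP.eig_rg b hb' hdist') (fun j : Fin p => Matrix.toLin' (B j.succ))
      (fun j => rk (B j.succ)) (by rw [htr, map_neg, KP.trace_lam _ _ (hchar 0), Finset.sum_neg_distrib])
      (fun j c => KP.rk_le _ c) (by omega)
    exact hno (KP.contra B A h1 h2 h3)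
  refine ⟨hsum.trans hN, ?_⟩
  by_contra hcon
  push Not at hcon
  obtain ⟨hκ, hrel⟩ := hcon
  choose l hl using fun j : Fin p => KP.rk_att (B j.succ)
  have hd : (n : ℤ) ^ 2 + n - 1 ≤ ∑ j : Fin p, KP.dZ (Matrix.toLin' (B j.succ)) := by
    have h0 := KP.eig_dZ b hb
    rw [← KP.dd_eq] at h0
    have h1 : 2 ≤ 2 * n ^ 2 := by nlinarith
    have h2 : (2 : ℤ) * n ^ 2 - 2 ≤ ∑ j, (dd (B j) : ℤ) := by
      have : ((2 * n ^ 2 - 2 : ℕ) : ℤ) ≤ ((∑ j, dd (B j) : ℕ) : ℤ) := by exact_mod_cast hα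
      rw [Nat.cast_sub h1] at this
      push_cast at this; exact this
    have h3 : (2 : ℤ) * n ^ 2 - 1 ≤ ∑ j, (dd (B j) : ℤ) := by omega
    rw [Fin.sum_univ_succ] at h3
    simp only [← KP.dd_eq]
    linarith
  obtain ⟨A, h1, h2, h3⟩ := KP.T2 (by omega) (fun j : Fin p => Matrix.toLin' (B j.succ)) (fun j => rk (B j.succ)) l
    (fun i => -lam i 0) hdist' hl (fun j c => KP.rk_le _ c) hN hd htr.symm (by
      intro j c i h heq
      have hk : ∀ t : Fin p, ∃ k, l t + (Pi.single j c : Fin p → ℂ) t = lam k t.succ := fun t => by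
        rw [← KP.eig_iff (B t.succ) (fun k => lam k t.succ) (hchar t.succ)]
        have hx : KP.rg (Matrix.toLin' (B t.succ)) (l t + (Pi.single j c : Fin p → ℂ) t) = rk (B t.succ) := by
          by_cases ht : t = j
          · subst ht; simpa using h
          · simpa [ht] using hl t
        by_contra hne
        have h5 := KP.range_eq_top_of_not_eig (Matrix.toLin' (B t.succ)) _ hne
        unfold KP.rg at hx
        rw [h5, finrank_top, Module.finrank_fin_fun] at hx
        obtain ⟨c', hc'⟩ := KP.rg_lt (by omega) (Matrix.toLin' (B t.succ))
        have := KP.rk_le (B t.succ) c'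
        omega
      choose k hk using hk
      apply hrel (Fin.cons i k)
      rw [Fin.sum_univ_succ]
      simp only [Fin.cons_zero, Fin.cons_succ, ← hk]
      rw [Finset.sum_add_distrib]
      simp only [Finset.sum_pi_single', Finset.mem_univ, if_true]
      rw [heq]; ring)
  obtain ⟨b2, hb2⟩ := KP.exists_eigbasis (∑ j, A j) _ hdist' (by simp) h3
  exact hno (KP.contra B A h1 (KP.eig_sim b2 hb2 b hb') h2)
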